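/- arXiv:2109.04923 — 2 statements merged into one kernel-verified Lean document; each statement's English description precedes it below -/
import Mathlib

section
/- Fix admissible q, a non-square B ∈ M^×, and a ∈ M^× with a^Q = a. Then: (i) if P_{q,B,a} and P_{q,B,a′} are isotopic then they are strongly isotopic; and (ii) the set {a′ ∈ M^× : (a′)^Q = a′ and P_{q,B,a′} is isotopic to P_{q,B,a}} has at most 2m elements. -/
/-- The family-`S` pre-semifield multiplication `P_{q,B,a}` on `M × M` (with `A = a/B`):
`(x,y) ∗ (u,v) = (x^q u + x u^q + B(y^q v + y v^q), x^r v + y u^r + A(x v^r + y^r u))`. -/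
def sstar (K : Type) [Field K] (q r : ℕ) (B A : K) (z w : K × K) : K × K :=
  (z.1 ^ q * w.1 + z.1 * w.1 ^ q + B * (z.2 ^ q * w.2 + z.2 * w.2 ^ q),
   z.1 ^ r * w.2 + z.2 * w.1 ^ r + A * (z.1 * w.2 ^ r + z.2 ^ r * w.1))

namespace FamS

section
variable {K G : Type} [Field K] [CommGroup G] [MulSemiringAction G K]

/-- Embedding of `K × K` into the space of conjugate vectors. -/
def hat (z : K × K) : G → K × K := fun j => (j • z.1, j • z.2)

/-- The polarised multiplication. -/
def SF (f r : G) (B A : K) (X W : G → K × K) : G → K × K := fun j =>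
  ((X (j * f)).1 * (W j).1 + (X j).1 * (W (j * f)).1
    + j • B * ((X (j * f)).2 * (W j).2 + (X j).2 * (W (j * f)).2),
   (X (j * r)).1 * (W j).2 + (X j).2 * (W (j * r)).1
    + j • A * ((X j).1 * (W (j * r)).2 + (X (j * r)).2 * (W j).1))

/-- The polarised multiplication as a bilinear map. -/
def SB (f r : G) (B A : K) : (G → K × K) →ₗ[K] (G → K × K) →ₗ[K] (G → K × K) :=
  LinearMap.mk₂ K (SF f r B A)
    (by intro X X' W; funext j; ext <;> simp [SF] <;> ring)
    (by intro c X W; funext j; ext <;> simp [SF] <;> ring)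
    (by intro X X' W; funext j; ext <;> simp [SF] <;> ring)
    (by intro c X W; funext j; ext <;> simp [SF] <;> ring)

theorem SB_apply (f r : G) (B A : K) (X W : G → K × K) : SB f r B A X W = SF f r B A X W := rfl

theorem SF_comm (f r : G) (B A : K) (X W : G → K × K) : SF f r B A X W = SF f r B A W X := by
  funext j; ext <;> simp [SF] <;> ring

/-- The multiplication written with automorphisms. -/
def st (f r : G) (B A : K) (z w : K × K) : K × K :=
  (f • z.1 * w.1 + z.1 * f • w.1 + B * (f • z.2 * w.2 + z.2 * f • w.2),
   r • z.1 * w.2 + z.2 * r • w.1 + A * (z.1 * r • w.2 + r • z.2 * w.1))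

theorem SF_hat (f r : G) (B A : K) (z w : K × K) :
    SF f r B A (hat z) (hat w) = hat (st f r B A z w) := by
  funext j; ext <;> simp [SF, hat, st, mul_smul, smul_add, smul_mul']

/-- Galois shift. -/
def sh (g : G) (X : G → K × K) : G → K × K := fun j => (g • (X (g⁻¹ * j)).1, g • (X (g⁻¹ * j)).2)

variable [Fintype G]

theorem span_hat (hind : ∀ c : G → K, (∀ x : K, ∑ g, c g * g • x = 0) → c = 0) :
    Submodule.span K (Set.range (hat : K × K → G → K × K)) = ⊤ := by
  classical
  by_contra hne
  obtain ⟨F, hF0, hF⟩ := Submodule.exists_le_ker_of_lt_top _ (lt_top_iff_ne_top.2 hne)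
  have hexp : ∀ X : G → K × K, F X = ∑ g, (X g).1 * F (Pi.single g (1, 0))
      + ∑ g, (X g).2 * F (Pi.single g (0, 1)) := by
    intro X
    have : X = ∑ g, ((X g).1 • (Pi.single g (1, 0) : G → K × K)
        + (X g).2 • (Pi.single g (0, 1) : G → K × K)) := by
      funext j
      rw [Finset.sum_apply, Finset.sum_eq_single j]
      · ext <;> simp
      · intro b _ hb; simp [Pi.single_eq_of_ne hb.symm]
      · simp
    conv_lhs => rw [this]
    simp [map_sum, Finset.sum_add_distrib]
  have hz : ∀ z : K × K, F (hat z) = 0 := fun z => hF (Submodule.subset_span ⟨z, rfl⟩)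
  have h1 : (fun g : G => F (Pi.single g (1, 0))) = 0 := by
    apply hind; intro x
    have := hz (x, 0)
    rw [hexp] at this
    simpa [hat, mul_comm] using this
  have h2 : (fun g : G => F (Pi.single g (0, 1))) = 0 := by
    apply hind; intro x
    have := hz (0, x)
    rw [hexp] at this
    simpa [hat, mul_comm] using this
  apply hF0
  refine LinearMap.ext fun X => ?_
  rw [hexp]
  have h1' := fun g => congrFun h1 g
  have h2' := fun g => congrFun h2 g
  simp only [Pi.zero_apply] at h1' h2'
  simp [h1', h2']

theorem exists_hat (hexp : ∀ f : K →+ K, ∃ c : G → K, ∀ x, f x = ∑ g, c g * g • x)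
    (L : K × K →+ K × K) : ∃ H : (G → K × K) →ₗ[K] (G → K × K),
      (∀ z, H (hat z) = hat (L z)) ∧ ∀ g X, H (sh g X) = sh g (H X) := by
  obtain ⟨a, ha⟩ := hexp ((AddMonoidHom.fst K K).comp (L.comp (AddMonoidHom.inl K K)))
  obtain ⟨b, hb⟩ := hexp ((AddMonoidHom.fst K K).comp (L.comp (AddMonoidHom.inr K K)))
  obtain ⟨c, hc⟩ := hexp ((AddMonoidHom.snd K K).comp (L.comp (AddMonoidHom.inl K K)))
  obtain ⟨d, hd⟩ := hexp ((AddMonoidHom.snd K K).comp (L.comp (AddMonoidHom.inr K K)))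
  simp only [AddMonoidHom.comp_apply, AddMonoidHom.coe_fst, AddMonoidHom.coe_snd,
    AddMonoidHom.inl_apply, AddMonoidHom.inr_apply] at ha hb hc hd
  have hL : ∀ z, L z = L (z.1, 0) + L (0, z.2) := by
    intro z; rw [← map_add]; simp
  refine ⟨{ toFun := fun X j =>
      (∑ g, (j • a g * (X (j * g)).1 + j • b g * (X (j * g)).2),
       ∑ g, (j • c g * (X (j * g)).1 + j • d g * (X (j * g)).2))
            map_add' := ?_
            map_smul' := ?_ }, ?_, ?_⟩
  · intro X Y; funext j
    ext <;> simp only [Pi.add_apply, Prod.fst_add, Prod.snd_add, ← Finset.sum_add_distrib] <;>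
      exact Finset.sum_congr rfl fun g _ => by ring
  · intro s X; funext j
    ext <;> simp only [Pi.smul_apply, Prod.smul_fst, Prod.smul_snd, smul_eq_mul, RingHom.id_apply,
      Finset.mul_sum] <;>
      exact Finset.sum_congr rfl fun g _ => by ring
  · intro z; funext j
    rw [hL]
    ext
    · simp only [LinearMap.coe_mk, AddHom.coe_mk, hat, Prod.fst_add, ha, hb, smul_add,
        Finset.smul_sum, smul_mul', mul_smul, Finset.sum_add_distrib]
    · simp only [LinearMap.coe_mk, AddHom.coe_mk, hat, Prod.snd_add, hc, hd, smul_add,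
        Finset.smul_sum, smul_mul', mul_smul, Finset.sum_add_distrib]
  · intro s X; funext j
    ext <;> simp only [LinearMap.coe_mk, AddHom.coe_mk, sh, smul_add,
        Finset.smul_sum, smul_mul', smul_smul, mul_inv_cancel_left, mul_assoc]

/-- Polarised form of an isotopism. -/
theorem exists_polar (hind : ∀ c : G → K, (∀ x : K, ∑ g, c g * g • x = 0) → c = 0)
    (hexp : ∀ f : K →+ K, ∃ c : G → K, ∀ x, f x = ∑ g, c g * g • x)
    (f r : G) (B A B' A' : K) (N L M : K × K ≃+ K × K)
    (h : ∀ z w, N (st f r B A z w) = st f r B' A' (L z) (M w)) :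
    ∃ Nh Lh Mh : (G → K × K) ≃ₗ[K] (G → K × K),
      (∀ X W, Nh (SF f r B A X W) = SF f r B' A' (Lh X) (Mh W)) ∧
      (∀ g X, Lh (sh g X) = sh g (Lh X)) ∧ (∀ g X, Mh (sh g X) = sh g (Mh X)) := by
  have key : ∀ L : K × K ≃+ K × K, ∃ H : (G → K × K) ≃ₗ[K] (G → K × K),
      (∀ z, H (hat z) = hat (L z)) ∧ ∀ g X, H (sh g X) = sh g (H X) := by
    intro L
    obtain ⟨H, hH, hs⟩ := exists_hat hexp L.toAddMonoidHom
    obtain ⟨H', hH', hs'⟩ := exists_hat hexp L.symm.toAddMonoidHom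
    simp only [AddEquiv.toAddMonoidHom_eq_coe, AddMonoidHom.coe_coe] at hH hH'
    refine ⟨LinearEquiv.ofLinearMap H H' ?_ ?_, hH, hs⟩
    · apply LinearMap.ext_on (span_hat hind)
      rintro _ ⟨z, rfl⟩
      simp [hH, hH']
    · apply LinearMap.ext_on (span_hat hind)
      rintro _ ⟨z, rfl⟩
      simp [hH, hH']
  obtain ⟨Nh, hN, -⟩ := key N
  obtain ⟨Lh, hL, hLs⟩ := key L
  obtain ⟨Mh, hM, hMs⟩ := key M
  refine ⟨Nh, Lh, Mh, ?_, hLs, hMs⟩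
  have e : (SB f r B A).compr₂ Nh.toLinearMap
      = (SB f r B' A').compl₁₂ Lh.toLinearMap Mh.toLinearMap := by
    apply LinearMap.ext_on (span_hat hind)
    rintro _ ⟨z, rfl⟩
    apply LinearMap.ext_on (span_hat hind)
    rintro _ ⟨w, rfl⟩
    simp [SB_apply, SF_hat, hN, hL, hM, h]
  intro X W
  exact LinearMap.congr_fun₂ e X W
end

section
variable {G : Type} [CommGroup G]

/-- The group-theoretic facts that are used. -/
structure GF (f t r : G) : Prop where
  hr : r = f * t
  t2 : t * t = 1
  t1 : t ≠ 1
  f8 : f ^ 8 ≠ 1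

namespace GF
variable {f t r : G}

theorem tinv (h : GF f t r) : t⁻¹ = t := inv_eq_of_mul_eq_one_left h.t2

theorem f4 (h : GF f t r) : f ^ 4 ≠ 1 := fun e => h.f8 (by rw [show f ^ 8 = f ^ 4 * f ^ 4 by rw [← pow_add], e, one_mul])
theorem f4t (h : GF f t r) : f ^ 4 ≠ t := fun e =>
  h.f8 (by rw [show f ^ 8 = f ^ 4 * f ^ 4 by rw [← pow_add], e, h.t2])
theorem f2 (h : GF f t r) : f * f ≠ 1 := fun e =>
  h.f4 (by rw [show f ^ 4 = (f * f) * (f * f) by simp only [pow_succ, pow_zero, one_mul, mul_assoc], e, one_mul])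
theorem f2t (h : GF f t r) : f * f ≠ t := fun e =>
  h.f4 (by rw [show f ^ 4 = (f * f) * (f * f) by simp only [pow_succ, pow_zero, one_mul, mul_assoc], e, h.t2])
theorem f1 (h : GF f t r) : f ≠ 1 := fun e => h.f2 (by simp [e])
theorem f1t (h : GF f t r) : f ≠ t := fun e => h.f2 (by rw [e, h.t2])
theorem r1 (h : GF f t r) : r ≠ 1 := fun e => h.f1t (by
  rw [h.hr] at e; rw [eq_inv_of_mul_eq_one_left e, h.tinv])

theorem i_f (h : GF f t r) (i : G) : i * f ≠ i := by simpa using h.f1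
theorem i_r (h : GF f t r) (i : G) : i * r ≠ i := by simpa using h.r1
theorem i_f' (h : GF f t r) (i : G) : i * f⁻¹ ≠ i := by simpa using h.f1
theorem i_r' (h : GF f t r) (i : G) : i * r⁻¹ ≠ i := by simpa using h.r1
theorem f_f' (h : GF f t r) (i : G) : i * f ≠ i * f⁻¹ := fun e => h.f2 (by
  rw [mul_right_inj] at e; nth_rewrite 2 [e]; simp)
theorem r_r' (h : GF f t r) (i : G) : i * r ≠ i * r⁻¹ := fun e => h.f2 (by
  rw [mul_right_inj] at e
  have : r * r = 1 := by nth_rewrite 2 [e]; simp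
  rw [h.hr, mul_mul_mul_comm, h.t2, mul_one] at this; exact this)
theorem f_r (h : GF f t r) (i : G) : i * f ≠ i * r := fun e => h.t1 (by
  rw [mul_right_inj, h.hr] at e; simpa using e.symm)
theorem fi_ri (h : GF f t r) (i : G) : i * f⁻¹ ≠ i * r⁻¹ := fun e => h.t1 (by
  rw [mul_right_inj, h.hr, inv_inj] at e; simpa using e.symm)
theorem f_r' (h : GF f t r) (i : G) : i * f ≠ i * r⁻¹ := fun e => h.f2t (by
  rw [mul_right_inj, h.hr] at e; nth_rewrite 2 [e]; simp [h.tinv])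
theorem fi_r (h : GF f t r) (i : G) : i * f⁻¹ ≠ i * r := fun e => h.f2t (by
  rw [mul_right_inj, h.hr, inv_eq_iff_mul_eq_one, ← mul_assoc] at e
  rw [eq_inv_of_mul_eq_one_left e, h.tinv])

/-- Two vertices not in the same fibre have a non-common neighbour. -/
theorem nbr (h : GF f t r) (i j : G) (h1 : j ≠ i) (h2 : j ≠ i * t) :
    ∃ l, (j = l * f ∨ j = l * f⁻¹ ∨ j = l * r ∨ j = l * r⁻¹) ∧
      l ≠ i ∧ l ≠ i * f ∧ l ≠ i * f⁻¹ ∧ l ≠ i * r ∧ l ≠ i * r⁻¹ := by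
  by_contra hc
  push Not at hc
  obtain ⟨g, rfl⟩ : ∃ g, j = i * g := ⟨i⁻¹ * j, by simp⟩
  have h1 : g ≠ 1 := by simpa using h1
  have h2 : g ≠ t := by simpa using h2
  have hti := h.tinv
  have a1 := hc (i * g * f) (by simp)
  have a2 := hc (i * g * r) (by simp)
  have a3 := hc (i * g * f⁻¹) (by simp)
  have a4 := hc (i * g * r⁻¹) (by simp)
  simp only [mul_assoc, mul_right_inj, ne_eq, mul_eq_left] at a1 a2 a3 a4
  have hr := h.hr
  have ht2 := h.t2
  have b1 : g = f⁻¹ * f⁻¹ ∨ g = f⁻¹ * f⁻¹ * t := by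
    by_contra hb
    push Not at hb
    have c : ∀ x, g * f = x → g = x * f⁻¹ := fun x e => by rw [← e]; simp
    have c' : ∀ x, g * r = x → g = x * t * f⁻¹ := fun x e => by
      rw [← e, hr, mul_assoc g, mul_assoc f, ht2]; simp
    have e1 : g * f = 1 := by
      by_contra hne
      by_cases x2 : g * f = f
      · exact h1 (by simpa using c _ x2)
      by_cases x3 : g * f = f⁻¹
      · exact hb.1 (c _ x3)
      by_cases x4 : g * f = r
      · exact h2 (by rw [c _ x4, hr, mul_comm f t]; simp)
      exact hb.2 (by rw [c _ (a1 hne x2 x3 x4), hr, mul_inv, hti, mul_right_comm])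
    have e2 : g * r = 1 := by
      by_contra hne
      by_cases x2 : g * r = f
      · exact h2 (by rw [c' _ x2, mul_comm f t]; simp)
      by_cases x3 : g * r = f⁻¹
      · exact hb.2 (by rw [c' _ x3, mul_right_comm])
      by_cases x4 : g * r = r
      · exact h1 (by simpa using x4)
      exact hb.1 (by rw [c' _ (a2 hne x2 x3 x4), hr, mul_inv, hti, mul_assoc f⁻¹, ht2, mul_one])
    rw [hr, ← mul_assoc, e1, one_mul] at e2
    exact h.t1 e2
  have b2 : g = f * f ∨ g = f * f * t := by
    by_contra hb
    push Not at hb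
    have c : ∀ x, g * f⁻¹ = x → g = x * f := fun x e => by rw [← e]; simp
    have c' : ∀ x, g * r⁻¹ = x → g = x * t * f := fun x e => by
      rw [← e, hr, mul_inv, hti, mul_assoc g, mul_assoc f⁻¹, ht2]; simp
    have e1 : g * f⁻¹ = 1 := by
      by_contra hne
      by_cases x2 : g * f⁻¹ = f
      · exact hb.1 (c _ x2)
      by_cases x3 : g * f⁻¹ = f⁻¹
      · exact h1 (by simpa using c _ x3)
      by_cases x4 : g * f⁻¹ = r
      · exact hb.2 (by rw [c _ x4, hr, mul_right_comm])
      exact h2 (by rw [c _ (a3 hne x2 x3 x4), hr, mul_inv, hti, mul_right_comm]; simp)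
    have e2 : g * r⁻¹ = 1 := by
      by_contra hne
      by_cases x2 : g * r⁻¹ = f
      · exact hb.2 (by rw [c' _ x2, mul_right_comm])
      by_cases x3 : g * r⁻¹ = f⁻¹
      · exact h2 (by rw [c' _ x3, mul_right_comm]; simp)
      by_cases x4 : g * r⁻¹ = r
      · exact hb.1 (by rw [c' _ x4, hr, mul_assoc f, ht2, mul_one])
      exact h1 (by simpa using a4 hne x2 x3 x4)
    rw [hr, mul_inv, hti, ← mul_assoc, e1, one_mul] at e2
    exact h.t1 e2
  have k : ∀ s, f⁻¹ * f⁻¹ * s = f * f → f ^ 4 = s := by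
    intro s e
    have : f ^ 4 = (f * f) * (f * f) := by simp only [pow_succ, pow_zero, one_mul, mul_assoc]
    rw [this]; nth_rewrite 2 [← e]
    rw [← mul_inv, mul_inv_cancel_left]
  rcases b1 with b1 | b1 <;> rcases b2 with b2 | b2
  · exact h.f4 (k 1 (by rw [mul_one, ← b1, b2]))
  · exact h.f4t (k t (by rw [← b1, b2, mul_assoc, ht2, mul_one]))
  · exact h.f4t (k t (by rw [← b1, b2]))
  · refine h.f4 (k 1 ?_)
    rw [mul_one]; exact mul_right_cancel (b1.symm.trans b2)
end GF
end

section
variable {K G : Type} [Field K] [CommGroup G] [MulSemiringAction G K] [Fintype G]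

theorem solve2 (x y s t c : K) (hs : s ≠ 0) (ht : t ≠ 0) (h : (x, y) ≠ ((0, 0) : K × K)) :
    ∃ w : K × K, s * x * w.1 + t * y * w.2 = c := by
  by_cases hx : x = 0
  · have hy : y ≠ 0 := fun hy => h (by rw [hx, hy])
    exact ⟨(0, c / (t * y)), by simp; field_simp⟩
  · exact ⟨(c / (s * x), 0), by simp; field_simp⟩

theorem exists_fun5 {α V : Type} [Zero V] (a b c d e : α) (v1 v2 v3 v4 : V)
    (h1 : b ≠ a) (h2 : c ≠ a) (h3 : d ≠ a) (h4 : e ≠ a) (h5 : b ≠ c) (h6 : b ≠ d) (h7 : b ≠ e)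
    (h8 : c ≠ d) (h9 : c ≠ e) (h10 : d ≠ e) :
    ∃ W : α → V, W a = 0 ∧ W b = v1 ∧ W c = v2 ∧ W d = v3 ∧ W e = v4 := by
  classical
  refine ⟨fun j => if j = b then v1 else if j = c then v2 else if j = d then v3
    else if j = e then v4 else 0, ?_, ?_, ?_, ?_, ?_⟩
  · simp [h1.symm, h2.symm, h3.symm, h4.symm]
  · simp
  · simp [h5.symm]
  · simp [h6.symm, h8.symm]
  · simp [h7.symm, h9.symm, h10.symm]

/-- The four coordinates of the star at `i`. -/
def starC (f r : G) (i : G) : (G → K × K) →ₗ[K] (Fin 4 → K) where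
  toFun Z := ![(Z i).1, (Z (i * f⁻¹)).1, (Z i).2, (Z (i * r⁻¹)).2]
  map_add' X Y := by ext k; fin_cases k <;> simp
  map_smul' X Y := by ext k; fin_cases k <;> simp

theorem star_inj {f t r : G} (h : GF f t r) {B A : K} (hB : B ≠ 0) (hA : A ≠ 0)
    (Y : G → K × K) (hrk : Module.finrank K (LinearMap.range (SB f r B A Y)) ≤ 4)
    (i : G) (hi : Y i ≠ 0) (W : G → K × K)
    (h1 : (SF f r B A Y W i).1 = 0) (h2 : (SF f r B A Y W (i * f⁻¹)).1 = 0)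
    (h3 : (SF f r B A Y W i).2 = 0) (h4 : (SF f r B A Y W (i * r⁻¹)).2 = 0) :
    SF f r B A Y W = 0 := by
  set T := SB f r B A Y with hT
  have hAn : ∀ j : G, j • A ≠ 0 := fun j => (smul_ne_zero_iff_ne j).2 hA
  have hBn : ∀ j : G, j • B ≠ 0 := fun j => (smul_ne_zero_iff_ne j).2 hB
  have hi' : ((Y i).1, (Y i).2) ≠ ((0, 0) : K × K) := hi
  have hi'' : ((Y i).2, (Y i).1) ≠ ((0, 0) : K × K) := fun e => hi (by
    simp only [Prod.mk.injEq] at e; exact Prod.ext e.2 e.1)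
  have hsurj : Function.Surjective ((starC f r i).domRestrict (LinearMap.range T)) := by
    intro c
    obtain ⟨w1, e1⟩ := solve2 (Y i).1 (Y i).2 1 (i • B) (c 0) one_ne_zero (hBn _) hi'
    obtain ⟨w2, e2⟩ := solve2 (Y i).1 (Y i).2 1 ((i * f⁻¹) • B) (c 1) one_ne_zero (hBn _) hi'
    obtain ⟨w3, e3⟩ := solve2 (Y i).2 (Y i).1 1 (i • A) (c 2) one_ne_zero (hAn _) hi''
    obtain ⟨w4, e4⟩ := solve2 (Y i).2 (Y i).1 ((i * r⁻¹) • A) 1 (c 3) (hAn _) one_ne_zero hi''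
    obtain ⟨U, u0, u1, u2, u3, u4⟩ := exists_fun5 i (i * f) (i * f⁻¹) (i * r) (i * r⁻¹) w1 w2 w3 w4
      (h.i_f i) (h.i_f' i) (h.i_r i) (h.i_r' i) (h.f_f' i) (h.f_r i) (h.f_r' i) (h.fi_r i)
      (h.fi_ri i) (h.r_r' i)
    refine ⟨⟨T U, U, rfl⟩, ?_⟩
    rw [LinearMap.domRestrict_apply]
    ext k
    fin_cases k
    · simp [starC, hT, SB_apply, SF, u0, u1, ← e1]; ring
    · simp [starC, hT, SB_apply, SF, u0, u2, ← e2]; ring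
    · simp [starC, hT, SB_apply, SF, u0, u3, ← e3]; ring
    · simp [starC, hT, SB_apply, SF, u0, u4, ← e4]; ring
  have hfin : Module.finrank K (LinearMap.range T) = Module.finrank K (Fin 4 → K) := by
    apply le_antisymm
    · simpa using hrk
    · exact LinearMap.finrank_le_finrank_of_surjective hsurj
  have hinj := (LinearMap.injective_iff_surjective_of_finrank_eq_finrank hfin).2 hsurj
  have : (⟨T W, W, rfl⟩ : LinearMap.range T) = 0 := by
    apply hinj
    rw [map_zero, LinearMap.domRestrict_apply]
    ext k
    fin_cases k
    · exact h1
    · exact h2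
    · exact h3
    · exact h4
  exact congrArg Subtype.val this

theorem nbr_zero {f t r : G} (h : GF f t r) {B A : K} (hB : B ≠ 0) (hA : A ≠ 0)
    (Y : G → K × K) (l : G)
    (h0 : ∀ W : G → K × K, (∀ j, j ≠ l → W j = 0) → SF f r B A Y W = 0) :
    Y (l * f) = 0 ∧ Y (l * f⁻¹) = 0 ∧ Y (l * r) = 0 ∧ Y (l * r⁻¹) = 0 := by
  classical
  have hAn : ∀ j : G, j • A ≠ 0 := fun j => (smul_ne_zero_iff_ne j).2 hA
  have hBn : ∀ j : G, j • B ≠ 0 := fun j => (smul_ne_zero_iff_ne j).2 hB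
  have hs : ∀ w : K × K, SF f r B A Y (Pi.single l w) = 0 := fun w =>
    h0 _ fun j hj => Pi.single_eq_of_ne hj _
  have c1 : ∀ w j, (SF f r B A Y (Pi.single l w) j).1 = 0 := fun w j => by rw [hs]; rfl
  have c2 : ∀ w j, (SF f r B A Y (Pi.single l w) j).2 = 0 := fun w j => by rw [hs]; rfl
  have hf := Pi.single_eq_of_ne (M := fun _ : G => K × K) (h.i_f l)
  have hf' := Pi.single_eq_of_ne (M := fun _ : G => K × K) (h.i_f' l)
  have hr := Pi.single_eq_of_ne (M := fun _ : G => K × K) (h.i_r l)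
  have hr' := Pi.single_eq_of_ne (M := fun _ : G => K × K) (h.i_r' l)
  refine ⟨Prod.ext ?_ ?_, Prod.ext ?_ ?_, Prod.ext ?_ ?_, Prod.ext ?_ ?_⟩
  · simpa [SF, hf] using c1 (1, 0) l
  · simpa [SF, hf, hBn] using c1 (0, 1) l
  · simpa [SF, hf'] using c1 (1, 0) (l * f⁻¹)
  · simpa [SF, hf', hBn] using c1 (0, 1) (l * f⁻¹)
  · simpa [SF, hr] using c2 (0, 1) l
  · simpa [SF, hr, hAn] using c2 (1, 0) l
  · simpa [SF, hr', hAn] using c2 (0, 1) (l * r⁻¹)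
  · simpa [SF, hr'] using c2 (1, 0) (l * r⁻¹)

theorem caseA {f t r : G} (h : GF f t r) {B A : K} (hB : B ≠ 0) (hA : A ≠ 0)
    (Y : G → K × K) (hrk : Module.finrank K (LinearMap.range (SB f r B A Y)) ≤ 4)
    (i j : G) (hi : Y i ≠ 0) (hj : Y j ≠ 0) : j = i ∨ j = i * t := by
  by_contra hc
  push Not at hc
  obtain ⟨l, hl, n0, n1, n2, n3, n4⟩ := h.nbr i j hc.1 hc.2
  have := nbr_zero h hB hA Y l (by
    intro W hW
    have w0 := hW _ n0.symm
    have w1 := hW _ n1.symm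
    have w2 := hW _ n2.symm
    have w3 := hW _ n3.symm
    have w4 := hW _ n4.symm
    apply star_inj h hB hA Y hrk i hi <;> simp [SF, w0, w1, w2, w3, w4])
  rcases hl with rfl | rfl | rfl | rfl
  · exact hj this.1
  · exact hj this.2.1
  · exact hj this.2.2.1
  · exact hj this.2.2.2

theorem caseB {f t r : G} (h : GF f t r) {B A : K} (hB : B ≠ 0) (hA : A ≠ 0)
    (hBA : f⁻¹ • (A * B) * t • A ≠ B)
    (Y : G → K × K) (hrk : Module.finrank K (LinearMap.range (SB f r B A Y)) ≤ 4)
    (i : G) (hi : Y i ≠ 0) :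
    (Y i).1 * (Y (i * t)).1 = 0 ∧ (Y i).2 * (Y (i * t)).2 = 0 := by
  classical
  have hAn : ∀ j : G, j • A ≠ 0 := fun j => (smul_ne_zero_iff_ne j).2 hA
  have hBn : ∀ j : G, j • B ≠ 0 := fun j => (smul_ne_zero_iff_ne j).2 hB
  have hrt : i * t * r = i * f := by rw [h.hr, mul_comm f t, mul_assoc, ← mul_assoc t, h.t2, one_mul]
  have hrt' : i * f⁻¹ * r = i * t := by rw [h.hr]; simp [mul_assoc]
  have s0 : ∀ w : K × K, (Pi.single (i * f) w : G → K × K) i = 0 := fun w =>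
    Pi.single_eq_of_ne (h.i_f i).symm _
  have s2 : ∀ w : K × K, (Pi.single (i * f) w : G → K × K) (i * f⁻¹) = 0 := fun w =>
    Pi.single_eq_of_ne (h.f_f' i).symm _
  have s3 : ∀ w : K × K, (Pi.single (i * f) w : G → K × K) (i * r) = 0 := fun w =>
    Pi.single_eq_of_ne (h.f_r i).symm _
  have s4 : ∀ w : K × K, (Pi.single (i * f) w : G → K × K) (i * r⁻¹) = 0 := fun w =>
    Pi.single_eq_of_ne (h.f_r' i).symm _
  have nt : i * t ≠ i * f := fun e => h.f1t (mul_left_cancel e).symm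
  have s5 : ∀ w : K × K, (Pi.single (i * f) w : G → K × K) (i * t) = 0 := fun w =>
    Pi.single_eq_of_ne nt _
  have q0 : ∀ w : K × K, (Pi.single (i * f⁻¹) w : G → K × K) i = 0 := fun w =>
    Pi.single_eq_of_ne (h.i_f' i).symm _
  have q1 : ∀ w : K × K, (Pi.single (i * f⁻¹) w : G → K × K) (i * f) = 0 := fun w =>
    Pi.single_eq_of_ne (h.f_f' i) _
  have q3 : ∀ w : K × K, (Pi.single (i * f⁻¹) w : G → K × K) (i * r) = 0 := fun w =>
    Pi.single_eq_of_ne (h.fi_r i).symm _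
  have q4 : ∀ w : K × K, (Pi.single (i * f⁻¹) w : G → K × K) (i * r⁻¹) = 0 := fun w =>
    Pi.single_eq_of_ne (h.fi_ri i).symm _
  have nt' : i * t ≠ i * f⁻¹ := fun e => h.f1t (by
    rw [← inv_inj, ← mul_left_cancel e, h.tinv])
  have q5 : ∀ w : K × K, (Pi.single (i * f⁻¹) w : G → K × K) (i * t) = 0 := fun w =>
    Pi.single_eq_of_ne nt' _
  set x := (Y i).1 with hx
  set y := (Y i).2 with hy
  set x' := (Y (i * t)).1 with hx'
  set y' := (Y (i * t)).2 with hy'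
  have E1 : x * ((i * t) • A * x') = i • B * y * y' := by
    have := star_inj h hB hA Y hrk i hi (Pi.single (i * f) (i • B * y, - x))
      (by simp [SF, s0, ← hx, ← hy]; ring) (by simp [SF, s0, s2]) (by simp [SF, s0, s3])
      (by simp [SF, s0, s4])
    have := congrArg Prod.snd (congrFun this (i * t))
    simp [SF, s5, hrt, ← hx', ← hy'] at this
    linear_combination -this
  have E2 : x * x' = (i * f⁻¹) • A * (i * f⁻¹) • B * (y * y') := by
    have := star_inj h hB hA Y hrk i hi (Pi.single (i * f⁻¹) ((i * f⁻¹) • B * y, - x))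
      (by simp [SF, q0, q1]) (by simp [SF, q0, ← hx, ← hy]; ring) (by simp [SF, q0, q3])
      (by simp [SF, q0, q4])
    have := congrArg Prod.snd (congrFun this (i * f⁻¹))
    simp [SF, q5, hrt', ← hx', ← hy'] at this
    linear_combination -this
  have hne : (i * f⁻¹) • A * (i * f⁻¹) • B * (i * t) • A ≠ i • B := by
    intro e
    apply hBA
    apply smul_left_cancel i
    simpa [smul_mul', mul_smul] using e
  have hyy : y * y' = 0 := by
    by_contra hn
    apply hne
    apply mul_right_cancel₀ hn
    linear_combination E1 - (i * t) • A * E2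
  refine ⟨?_, hyy⟩
  rw [E2, hyy, mul_zero]

/-- Low-rank vectors have at most one coordinate of each type. -/
theorem low_rank {f t r : G} (h : GF f t r) {B A : K} (hB : B ≠ 0) (hA : A ≠ 0)
    (hBA : f⁻¹ • (A * B) * t • A ≠ B)
    (Y : G → K × K) (hrk : Module.finrank K (LinearMap.range (SB f r B A Y)) ≤ 4) :
    (∀ i j, (Y i).1 ≠ 0 → (Y j).1 ≠ 0 → i = j) ∧ (∀ i j, (Y i).2 ≠ 0 → (Y j).2 ≠ 0 → i = j) := by
  constructor <;> intro i j hi hj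
  · have hi0 : Y i ≠ 0 := fun e => hi (by simp [e])
    have hj0 : Y j ≠ 0 := fun e => hj (by simp [e])
    rcases caseA h hB hA Y hrk i j hi0 hj0 with rfl | rfl
    · rfl
    · exact absurd (caseB h hB hA hBA Y hrk i hi0).1 (mul_ne_zero hi hj)
  · have hi0 : Y i ≠ 0 := fun e => hi (by simp [e])
    have hj0 : Y j ≠ 0 := fun e => hj (by simp [e])
    rcases caseA h hB hA Y hrk i j hi0 hj0 with rfl | rfl
    · rfl
    · exact absurd (caseB h hB hA hBA Y hrk i hi0).2 (mul_ne_zero hi hj)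

theorem rank_le_of_ker (T : (G → K × K) →ₗ[K] (G → K × K)) (P : (G → K × K) →ₗ[K] (Fin 4 → K))
    (hP : ∀ W, P W = 0 → T W = 0) : Module.finrank K (LinearMap.range T) ≤ 4 := by
  have h1 := LinearMap.finrank_range_add_finrank_ker T
  have h2 := LinearMap.finrank_range_add_finrank_ker P
  have h3 : Module.finrank K (LinearMap.ker P) ≤ Module.finrank K (LinearMap.ker T) :=
    Submodule.finrank_mono fun W hW => hP W hW
  have h4 : Module.finrank K (LinearMap.range P) ≤ 4 := by
    simpa using Submodule.finrank_le (LinearMap.range P)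
  omega

theorem rank_V (f r : G) {B A : K} (X : G → K × K) (i : G)
    (hX : ∀ j, j ≠ i → X j = 0) : Module.finrank K (LinearMap.range (SB f r B A X)) ≤ 4 := by
  apply rank_le_of_ker _ ((starC f r i).comp (SB f r B A X))
  intro W hW
  have c0 : (SF f r B A X W i).1 = 0 := congrFun hW 0
  have c1 : (SF f r B A X W (i * f⁻¹)).1 = 0 := congrFun hW 1
  have c2 : (SF f r B A X W i).2 = 0 := congrFun hW 2
  have c3 : (SF f r B A X W (i * r⁻¹)).2 = 0 := congrFun hW 3
  funext j
  refine Prod.ext ?_ ?_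
  · by_cases h1 : j = i
    · rw [h1]; exact c0
    by_cases h2 : j * f = i
    · rw [eq_mul_inv_of_mul_eq h2]; exact c1
    simp [SB_apply, SF, hX _ h1, hX _ h2]
  · by_cases h1 : j = i
    · rw [h1]; exact c2
    by_cases h2 : j * r = i
    · rw [eq_mul_inv_of_mul_eq h2]; exact c3
    simp [SB_apply, SF, hX _ h1, hX _ h2]

/-- Four coordinates for the second kind of plane. -/
def coordW (f r : G) (i : G) : (G → K × K) →ₗ[K] (Fin 4 → K) where
  toFun Z := ![(Z (i * f)).1, (Z (i * f⁻¹)).1, (Z (i * r)).2, (Z (i * r⁻¹)).2]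
  map_add' X Y := by ext k; fin_cases k <;> simp
  map_smul' X Y := by ext k; fin_cases k <;> simp

theorem rank_W {f t r : G} (h : GF f t r) {B A : K} (X : G → K × K) (i : G)
    (hX1 : ∀ j, j ≠ i → (X j).1 = 0) (hX2 : ∀ j, j ≠ i * t → (X j).2 = 0) :
    Module.finrank K (LinearMap.range (SB f r B A X)) ≤ 4 := by
  apply rank_le_of_ker _ (coordW f r i)
  intro W hW
  have c0 : (W (i * f)).1 = 0 := congrFun hW 0
  have c1 : (W (i * f⁻¹)).1 = 0 := congrFun hW 1
  have c2 : (W (i * r)).2 = 0 := congrFun hW 2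
  have c3 : (W (i * r⁻¹)).2 = 0 := congrFun hW 3
  have m1 : ∀ j, (X j).1 * (W (j * f)).1 = 0 := fun j => by
    by_cases e : j = i
    · rw [e, c0, mul_zero]
    · rw [hX1 _ e, zero_mul]
  have m2 : ∀ j, (X (j * f)).1 * (W j).1 = 0 := fun j => by
    by_cases e : j * f = i
    · rw [eq_mul_inv_of_mul_eq e, c1, mul_zero]
    · rw [hX1 _ e, zero_mul]
  have m3 : ∀ j, (X j).2 * (W (j * f)).2 = 0 := fun j => by
    by_cases e : j = i * t
    · rw [e, mul_assoc, mul_comm t f, ← h.hr, c2, mul_zero]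
    · rw [hX2 _ e, zero_mul]
  have m4 : ∀ j, (X (j * f)).2 * (W j).2 = 0 := fun j => by
    by_cases e : j * f = i * t
    · have : j = i * r⁻¹ := by
        rw [eq_mul_inv_of_mul_eq e, h.hr, mul_inv, h.tinv, mul_assoc, mul_comm t]
      rw [this, c3, mul_zero]
    · rw [hX2 _ e, zero_mul]
  have m5 : ∀ j, (X (j * r)).1 * (W j).2 = 0 := fun j => by
    by_cases e : j * r = i
    · rw [eq_mul_inv_of_mul_eq e, c3, mul_zero]
    · rw [hX1 _ e, zero_mul]
  have m6 : ∀ j, (X j).2 * (W (j * r)).1 = 0 := fun j => by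
    by_cases e : j = i * t
    · have : i * t * r = i * f := by
        rw [h.hr, mul_comm f t, mul_assoc, ← mul_assoc t, h.t2, one_mul]
      rw [e, this, c0, mul_zero]
    · rw [hX2 _ e, zero_mul]
  have m7 : ∀ j, (X j).1 * (W (j * r)).2 = 0 := fun j => by
    by_cases e : j = i
    · rw [e, c2, mul_zero]
    · rw [hX1 _ e, zero_mul]
  have m8 : ∀ j, (X (j * r)).2 * (W j).1 = 0 := fun j => by
    by_cases e : j * r = i * t
    · have : j = i * f⁻¹ := by
        rw [eq_mul_inv_of_mul_eq e, h.hr, mul_inv, h.tinv, mul_comm f⁻¹, mul_assoc, ← mul_assoc t,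
          h.t2, one_mul]
      rw [this, c1, mul_zero]
    · rw [hX2 _ e, zero_mul]
  funext j
  refine Prod.ext ?_ ?_ <;> simp [SB_apply, SF, m1, m2, m3, m4, m5, m6, m7, m8]
end

section
variable {G : Type} [CommGroup G]

theorem GF.adj {f t r : G} (h : GF f t r) (s s' : G)
    (h1 : f * s = s' * f ∨ s' = f * s * f ∨ f * s = s' * r ∨ s' = f * s * r)
    (h2 : s = f * s' * f ∨ f * s' = s * f ∨ s = f * s' * r ∨ f * s' = s * r) :
    s' = s ∨ s' = s * t := by
  obtain ⟨g, rfl⟩ : ∃ g, s' = s * g := ⟨s⁻¹ * s', by simp⟩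
  have hr := h.hr
  have ht2 := h.t2
  have hti := h.tinv
  have g1 : g = 1 ∨ g = t ∨ g = f * f ∨ g = f * f * t := by
    rcases h1 with e | e | e | e
    · left; rw [mul_comm f s, mul_assoc, mul_right_inj] at e; simpa using e.symm
    · right; right; left
      rw [mul_comm f s, mul_assoc, mul_right_inj] at e; exact e
    · right; left
      rw [mul_comm f s, mul_assoc, mul_right_inj, hr, mul_left_comm] at e
      have e : g * t = 1 := by simpa using e.symm
      rw [eq_inv_of_mul_eq_one_left e, hti]
    · right; right; right
      rw [mul_comm f s, mul_assoc, mul_right_inj, hr] at e; rw [e, mul_assoc]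
  have g2 : g = 1 ∨ g = t ∨ g * (f * f) = 1 ∨ g * (f * f) * t = 1 := by
    rcases h2 with e | e | e | e
    · right; right; left
      have : s * 1 = s * (g * (f * f)) := by
        rw [mul_one]; nth_rewrite 1 [e]; simp only [mul_comm, mul_left_comm]
      exact (mul_left_cancel this).symm
    · left
      rw [mul_left_comm, mul_right_inj] at e; simpa using e
    · right; right; right
      have : s * 1 = s * (g * (f * f) * t) := by
        rw [mul_one]; nth_rewrite 1 [e]; rw [hr]; simp only [mul_comm, mul_left_comm, mul_assoc]
      exact (mul_left_cancel this).symm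
    · right; left
      rw [mul_left_comm, mul_right_inj, hr] at e; simpa using e
  have f4 := h.f4
  have f4t := h.f4t
  have hp : f * f * (f * f) = f ^ 4 := by simp only [pow_succ, pow_zero, one_mul, mul_assoc]
  rcases g1 with e | e | e | e
  · left; rw [e, mul_one]
  · right; rw [e]
  · exfalso
    rcases g2 with e' | e' | e' | e'
    · exact h.f2 (e ▸ e')
    · exact h.f2t (e ▸ e')
    · rw [e, hp] at e'; exact f4 e'
    · rw [e, hp] at e'; exact f4t (by rw [eq_inv_of_mul_eq_one_left e', hti])
  · exfalso
    rcases g2 with e' | e' | e' | e'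
    · rw [e] at e'; exact h.f2t (by rw [eq_inv_of_mul_eq_one_left e', hti])
    · rw [e] at e'; exact h.f2 (by simpa using e')
    · rw [e, mul_right_comm, hp] at e'; exact f4t (by rw [eq_inv_of_mul_eq_one_left e', hti])
    · have e2 : f * f * t * (f * f) * t = f * f * (f * f) * (t * t) := by
        simp only [mul_comm, mul_left_comm, mul_assoc]
      rw [e, e2, hp, ht2, mul_one] at e'; exact f4 e'

variable {K : Type} [Field K] [MulSemiringAction G K] [DecidableEq G]

theorem SF_nonadj (f r : G) (B A : K) (a b : G) (x y : K × K)
    (hne : SF f r B A (Pi.single a x) (Pi.single b y) ≠ 0) :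
    a = b * f ∨ b = a * f ∨ a = b * r ∨ b = a * r := by
  by_contra hc
  push Not at hc
  obtain ⟨c1, c2, c3, c4⟩ := hc
  apply hne
  have k : ∀ g : G, a ≠ b * g → ∀ j, (Pi.single a x : G → K × K) (j * g) = 0 ∨
      (Pi.single b y : G → K × K) j = 0 := by
    intro g hg j
    by_cases e : j = b
    · left; rw [e]; exact Pi.single_eq_of_ne hg.symm _
    · right; exact Pi.single_eq_of_ne e _
  have k' : ∀ g : G, b ≠ a * g → ∀ j, (Pi.single a x : G → K × K) j = 0 ∨
      (Pi.single b y : G → K × K) (j * g) = 0 := by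
    intro g hg j
    by_cases e : j = a
    · right; rw [e]; exact Pi.single_eq_of_ne hg.symm _
    · left; exact Pi.single_eq_of_ne e _
  funext j
  refine Prod.ext ?_ ?_
  · rcases k f c1 j with e | e <;> rcases k' f c2 j with e' | e' <;> simp [SF, e, e']
  · rcases k r c3 j with e | e <;> rcases k' r c4 j with e' | e' <;> simp [SF, e, e']

theorem SF_f {f t r : G} (h : GF f t r) (B A : K) (s : G) (x y : K × K) :
    SF f r B A (Pi.single (f * s) x) (Pi.single s y)
      = Pi.single s (x.1 * y.1 + s • B * (x.2 * y.2), 0) := by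
  have n1 : f * s ≠ s := by simpa using h.f1
  have a1 : f * s * f ≠ s := fun e => h.f2 (by
    have : s * (f * f) = s * 1 := by rw [mul_one]; nth_rewrite 2 [← e]; simp only [mul_comm, mul_left_comm]
    exact mul_left_cancel this)
  have a2 : f * s * r ≠ s := fun e => h.f2t (by
    have : s * (f * f * t) = s * 1 := by
      rw [mul_one]; nth_rewrite 2 [← e]; rw [h.hr]; simp only [mul_comm, mul_left_comm, mul_assoc]
    rw [eq_inv_of_mul_eq_one_left (mul_left_cancel this), h.tinv])
  have a3 : s * r ≠ f * s := fun e => h.f_r s (by rw [e, mul_comm])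
  funext j
  by_cases e1 : j = s
  · subst e1
    refine Prod.ext ?_ ?_
    · simp [SF, mul_comm j f, Pi.single_eq_of_ne n1.symm]
    · simp [SF, Pi.single_eq_of_ne n1.symm, Pi.single_eq_of_ne a3]
  · by_cases e2 : j = f * s
    · subst e2
      refine Prod.ext ?_ ?_
      · simp [SF, Pi.single_eq_of_ne n1, Pi.single_eq_of_ne a1]
      · simp [SF, Pi.single_eq_of_ne n1, Pi.single_eq_of_ne a2]
    · refine Prod.ext ?_ ?_ <;> simp [SF, Pi.single_eq_of_ne e1, Pi.single_eq_of_ne e2]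

theorem SF_r {f t r : G} (h : GF f t r) (B A : K) (s : G) (x y : K × K) :
    SF f r B A (Pi.single (r * s) x) (Pi.single s y)
      = Pi.single s (0, x.1 * y.2 + s • A * (x.2 * y.1)) := by
  have n1 : r * s ≠ s := by simpa using h.r1
  have a1 : r * s * f ≠ s := fun e => h.f2t (by
    have : s * (f * f * t) = s * 1 := by
      rw [mul_one]; nth_rewrite 2 [← e]; rw [h.hr]; simp only [mul_comm, mul_left_comm, mul_assoc]
    rw [eq_inv_of_mul_eq_one_left (mul_left_cancel this), h.tinv])
  have a2 : r * s * r ≠ s := fun e => h.r_r' s (by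
    rw [eq_mul_inv_iff_mul_eq, mul_comm s r, e])
  have a3 : s * f ≠ r * s := fun e => h.f_r s (by rw [e, mul_comm])
  funext j
  by_cases e1 : j = s
  · subst e1
    refine Prod.ext ?_ ?_
    · simp [SF, Pi.single_eq_of_ne n1.symm, Pi.single_eq_of_ne a3]
    · simp [SF, mul_comm j r, Pi.single_eq_of_ne n1.symm]
  · by_cases e2 : j = r * s
    · subst e2
      refine Prod.ext ?_ ?_
      · simp [SF, Pi.single_eq_of_ne n1, Pi.single_eq_of_ne a1]
      · simp [SF, Pi.single_eq_of_ne n1, Pi.single_eq_of_ne a2]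
    · refine Prod.ext ?_ ?_ <;> simp [SF, Pi.single_eq_of_ne e1, Pi.single_eq_of_ne e2]

theorem SF_f' {f t r : G} (h : GF f t r) (B A : K) (s : G) (x y : K × K) :
    SF f r B A (Pi.single s y) (Pi.single (f * s) x)
      = Pi.single s (x.1 * y.1 + s • B * (x.2 * y.2), 0) := by
  rw [SF_comm, SF_f h]

theorem SF_r' {f t r : G} (h : GF f t r) (B A : K) (s : G) (x y : K × K) :
    SF f r B A (Pi.single s y) (Pi.single (r * s) x)
      = Pi.single s (0, x.1 * y.2 + s • A * (x.2 * y.1)) := by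
  rw [SF_comm, SF_r h]

theorem sh_single (g a : G) (x : K × K) :
    sh g (Pi.single a x) = Pi.single (g * a) ((g • x.1, g • x.2) : K × K) := by
  funext j
  by_cases e : j = g * a
  · subst e; simp [sh]
  · have : g⁻¹ * j ≠ a := fun e' => e (by rw [← e']; simp)
    simp [sh, Pi.single_eq_of_ne e, Pi.single_eq_of_ne this]

theorem match_idx {f t r : G} (h : GF f t r) (B A : K) (s s' : G) (x x' : K × K)
    (he : SF f r B A (Pi.single (f * s) ((f • x.1, f • x.2) : K × K)) (Pi.single s' x')
      = SF f r B A (Pi.single s x) (Pi.single (f * s') ((f • x'.1, f • x'.2) : K × K)))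
    (hne : SF f r B A (Pi.single s x) (Pi.single (f * s') ((f • x'.1, f • x'.2) : K × K)) ≠ 0) :
    s' = s := by
  have h1 := SF_nonadj f r B A _ _ _ _ (he ▸ hne)
  have h2 := SF_nonadj f r B A _ _ _ _ hne
  rcases h.adj s s' h1 h2 with e | e
  · exact e
  · exfalso
    have e1 : f * s = r * s' := by
      rw [e, h.hr, mul_comm s t, mul_assoc, ← mul_assoc t, h.t2, one_mul]
    have e2 : f * s' = r * s := by
      rw [e, h.hr, mul_comm s t, ← mul_assoc]
    rw [e1, e2, SF_r h, SF_r' h] at he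
    rw [e2, SF_r' h] at hne
    have hs : s ≠ s' := fun e' => h.t1 (by rw [← e'] at e; simpa using e.symm)
    have := congrFun he s
    rw [Pi.single_eq_same, Pi.single_eq_of_ne hs] at this
    rw [← this] at hne
    simp at hne

/-- At most one coordinate of each type. -/
def Low (Y : G → K × K) : Prop :=
    (∀ i j, (Y i).1 ≠ 0 → (Y j).1 ≠ 0 → i = j) ∧ (∀ i j, (Y i).2 ≠ 0 → (Y j).2 ≠ 0 → i = j)

theorem not_both (hK : ∀ x y u v : K, x ≠ 0 → y ≠ 0 → ∃ b : K, b ≠ 0 ∧ x + b * u ≠ 0 ∧ y + b * v ≠ 0)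
    {t : G} (ht : t ≠ 1) (P R : G → K × K) (hR : R ≠ 0)
    (h1 : ∀ b : K, Low (P + b • R)) (h2 : ∀ b : K, Low (P + b • sh t R))
    (i j : G) (hi : (P i).1 ≠ 0) (hj : (P j).2 ≠ 0) : False := by
  have key : ∀ Q : G → K × K, (∀ b : K, Low (P + b • Q)) →
      ∀ l, ((Q l).1 ≠ 0 → l = i) ∧ ((Q l).2 ≠ 0 → l = j) := by
    intro Q hQ l
    have hP : Low P := by simpa using hQ 0
    obtain ⟨b, hb, b1, b2⟩ := hK (P i).1 (P j).2 (Q i).1 (Q j).2 hi hj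
    constructor
    · intro hq
      by_contra hl
      have p0 : (P l).1 = 0 := by
        by_contra hp; exact hl (hP.1 l i hp hi)
      exact hl ((hQ b).1 l i (by simp [p0, hb, hq]) (by simpa using b1))
    · intro hq
      by_contra hl
      have p0 : (P l).2 = 0 := by
        by_contra hp; exact hl (hP.2 l j hp hj)
      exact hl ((hQ b).2 l j (by simp [p0, hb, hq]) (by simpa using b2))
  have k1 := key R h1
  have k2 := key _ h2
  obtain ⟨l, hl⟩ := Function.ne_iff.1 hR
  by_cases hl1 : (R l).1 = 0
  · have hl2 : (R l).2 ≠ 0 := fun e => hl (Prod.ext hl1 e)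
    have e1 := (k1 l).2 hl2
    have e2 := (k2 (t * l)).2 (by simp only [sh, inv_mul_cancel_left]; exact (smul_ne_zero_iff_ne t).2 hl2)
    rw [← e1] at e2
    exact ht (by simpa using e2)
  · have e1 := (k1 l).1 hl1
    have e2 := (k2 (t * l)).1 (by simp only [sh, inv_mul_cancel_left]; exact (smul_ne_zero_iff_ne t).2 hl1)
    rw [← e1] at e2
    exact ht (by simpa using e2)

theorem low_single (P : G → K × K) (hP0 : P ≠ 0) (hP : Low P)
    (hn : ∀ i j, (P i).1 ≠ 0 → (P j).2 ≠ 0 → False) :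
    ∃ s : G, ∃ c : K, c ≠ 0 ∧ (P = Pi.single s (c, 0) ∨ P = Pi.single s (0, c)) := by
  obtain ⟨l, hl⟩ := Function.ne_iff.1 hP0
  by_cases hl1 : (P l).1 = 0
  · have hl2 : (P l).2 ≠ 0 := fun e => hl (Prod.ext hl1 e)
    refine ⟨l, _, hl2, Or.inr ?_⟩
    funext j
    by_cases e : j = l
    · subst e; simp only [Pi.single_eq_same]; exact Prod.ext hl1 rfl
    · rw [Pi.single_eq_of_ne e]
      refine Prod.ext ?_ ?_
      · by_contra hc; exact hn _ _ hc hl2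
      · by_contra hc; exact e (hP.2 _ _ hc hl2)
  · refine ⟨l, _, hl1, Or.inl ?_⟩
    funext j
    by_cases e : j = l
    · subst e; simp only [Pi.single_eq_same]
      refine Prod.ext rfl ?_
      by_contra hc; exact hn _ _ hl1 hc
    · rw [Pi.single_eq_of_ne e]
      refine Prod.ext ?_ ?_
      · by_contra hc; exact e (hP.1 _ _ hc hl1)
      · by_contra hc; exact hn _ _ hl1 hc
end

section
variable {K G : Type} [Field K] [CommGroup G] [MulSemiringAction G K] [Fintype G] [DecidableEq G]

theorem mono_all (hK : ∀ x y u v : K, x ≠ 0 → y ≠ 0 → ∃ b : K, b ≠ 0 ∧ x + b * u ≠ 0 ∧ y + b * v ≠ 0)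
    {f t r : G} (h : GF f t r) {B A B' A' : K}
    (hB : B' ≠ 0) (hA : A' ≠ 0) (hBA : f⁻¹ • (A' * B') * t • A' ≠ B')
    (Nh Lh Mh : (G → K × K) ≃ₗ[K] (G → K × K))
    (hiso : ∀ X W, Nh (SF f r B A X W) = SF f r B' A' (Lh X) (Mh W))
    (hsh : ∀ g X, Lh (sh g X) = sh g (Lh X)) :
    (∃ s : G, ∃ c : K, c ≠ 0 ∧ (Lh (Pi.single 1 (1, 0)) = Pi.single s (c, 0)
      ∨ Lh (Pi.single 1 (1, 0)) = Pi.single s (0, c))) ∧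
    (∃ s : G, ∃ c : K, c ≠ 0 ∧ (Lh (Pi.single 1 (0, 1)) = Pi.single s (c, 0)
      ∨ Lh (Pi.single 1 (0, 1)) = Pi.single s (0, c))) := by
  have hlow : ∀ X, Module.finrank K (LinearMap.range (SB f r B A X)) ≤ 4 → Low (Lh X) := by
    intro X hX
    apply low_rank h hB hA hBA
    have : SB f r B' A' (Lh X) = (Nh.toLinearMap ∘ₗ SB f r B A X) ∘ₗ Mh.symm.toLinearMap := by
      apply LinearMap.ext; intro W
      have := hiso X (Mh.symm W)
      simp only [LinearEquiv.apply_symm_apply] at this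
      exact this.symm
    rw [this]
    refine le_trans (Submodule.finrank_mono (LinearMap.range_comp_le_range _ _)) ?_
    rw [LinearMap.range_comp]
    exact le_trans (Submodule.finrank_map_le _ _) hX
  have he0 : Lh (Pi.single 1 (1, 0)) ≠ 0 := by
    rw [Ne, LinearEquiv.map_eq_zero_iff, Pi.single_eq_zero_iff]; simp
  have hf0 : Lh (Pi.single 1 (0, 1)) ≠ 0 := by
    rw [Ne, LinearEquiv.map_eq_zero_iff, Pi.single_eq_zero_iff]; simp
  have l1 : ∀ b c : K, Low (b • Lh (Pi.single 1 (1, 0)) + c • Lh (Pi.single 1 (0, 1))) := by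
    intro b c
    rw [← map_smul, ← map_smul, ← map_add]
    apply hlow
    apply rank_V f r _ 1
    intro j hj; simp [Pi.single_eq_of_ne hj]
  have l2 : ∀ b c : K, Low (b • Lh (Pi.single 1 (1, 0)) + c • sh t (Lh (Pi.single 1 (0, 1)))) := by
    intro b c
    rw [← hsh, sh_single, mul_one, ← map_smul, ← map_smul, ← map_add]
    apply hlow
    apply rank_W h _ 1
    · intro j hj; by_cases e : j = t
      · subst e; simp [Pi.single_eq_of_ne hj]
      · simp [Pi.single_eq_of_ne hj, Pi.single_eq_of_ne e]
    · intro j hj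
      rw [mul_comm, mul_one] at hj
      by_cases e : j = 1
      · subst e; simp [Pi.single_eq_of_ne hj]
      · simp [Pi.single_eq_of_ne hj, Pi.single_eq_of_ne e]
  have l3 : ∀ b c : K, Low (b • Lh (Pi.single 1 (0, 1)) + c • sh t (Lh (Pi.single 1 (1, 0)))) := by
    intro b c
    rw [← hsh, sh_single, mul_one, ← map_smul, ← map_smul, ← map_add]
    apply hlow
    apply rank_W h _ t
    · intro j hj
      by_cases e : j = 1
      · subst e; simp [Pi.single_eq_of_ne hj]
      · simp [Pi.single_eq_of_ne hj, Pi.single_eq_of_ne e]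
    · intro j hj
      rw [h.t2] at hj
      by_cases e : j = t
      · subst e; simp [Pi.single_eq_of_ne hj]
      · simp [Pi.single_eq_of_ne hj, Pi.single_eq_of_ne e]
  constructor
  · refine low_single _ he0 (by simpa using l1 1 0) ?_
    exact not_both hK h.t1 _ _ hf0 (fun b => by simpa using l1 1 b) (fun b => by simpa using l2 1 b)
  · refine low_single _ hf0 (by simpa using l1 0 1) ?_
    exact not_both hK h.t1 _ _ he0 (fun b => by simpa [add_comm] using l1 b 1)
      (fun b => by simpa using l3 1 b)

/-- The equations satisfied by the coefficients of a monomial isotopism. -/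
structure Eqs (f r : G) (B A b a α β α' β' : K) : Prop where
  α0 : α ≠ 0
  β0 : β ≠ 0
  α'0 : α' ≠ 0
  β'0 : β' ≠ 0
  e1 : f • α * α' = α * f • α'
  e2 : b * (f • β * β') = B * (f • α * α')
  e3 : b * (β * f • β') = B * (f • α * α')
  e4 : r • α * β' = β * r • α'
  e5 : a * (α * r • β') = A * (r • α * β')
  e6 : a * (r • β * α') = A * (r • α * β')

theorem eqs_of_iso
    (hK : ∀ x y u v : K, x ≠ 0 → y ≠ 0 → ∃ b : K, b ≠ 0 ∧ x + b * u ≠ 0 ∧ y + b * v ≠ 0)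
    {f t r : G} (h : GF f t r) {B A B' A' : K} (hB0 : B ≠ 0)
    (hB : B' ≠ 0) (hA : A' ≠ 0) (hBA : f⁻¹ • (A' * B') * t • A' ≠ B')
    (Nh Lh Mh : (G → K × K) ≃ₗ[K] (G → K × K))
    (hiso : ∀ X W, Nh (SF f r B A X W) = SF f r B' A' (Lh X) (Mh W))
    (hsh : ∀ g X, Lh (sh g X) = sh g (Lh X)) (hsh' : ∀ g X, Mh (sh g X) = sh g (Mh X)) :
    ∃ s : G, ∃ α β α' β' : K, Eqs f r B A (s • B') (s • A') α β α' β' ∨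
      Eqs f r B A (s • B')⁻¹ (s • A')⁻¹ α β α' β' := by
  have hiso' : ∀ X W, Nh (SF f r B A X W) = SF f r B' A' (Mh X) (Lh W) := by
    intro X W; rw [SF_comm, hiso, SF_comm]
  obtain ⟨⟨s, α, hα, hLe⟩, ⟨s₂, β, hβ, hLf⟩⟩ := mono_all hK h hB hA hBA Nh Lh Mh hiso hsh
  obtain ⟨⟨s', α', hα', hMe⟩, ⟨s₂', β', hβ', hMf⟩⟩ := mono_all hK h hB hA hBA Nh Mh Lh hiso' hsh'
  have hsm : ∀ (g : G) (c : K), c ≠ 0 → g • c ≠ 0 := fun g c hc => (smul_ne_zero_iff_ne g).2 hc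
  -- vector form
  obtain ⟨x, hx, hxc⟩ : ∃ x : K × K, Lh (Pi.single 1 (1, 0)) = Pi.single s x ∧
      (x = (α, 0) ∨ x = (0, α)) := by
    rcases hLe with e | e
    · exact ⟨_, e, Or.inl rfl⟩
    · exact ⟨_, e, Or.inr rfl⟩
  obtain ⟨x', hx', hxc'⟩ : ∃ x : K × K, Mh (Pi.single 1 (1, 0)) = Pi.single s' x ∧
      (x = (α', 0) ∨ x = (0, α')) := by
    rcases hMe with e | e
    · exact ⟨_, e, Or.inl rfl⟩
    · exact ⟨_, e, Or.inr rfl⟩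
  obtain ⟨y, hy, hyc⟩ : ∃ x : K × K, Lh (Pi.single 1 (0, 1)) = Pi.single s₂ x ∧
      (x = (β, 0) ∨ x = (0, β)) := by
    rcases hLf with e | e
    · exact ⟨_, e, Or.inl rfl⟩
    · exact ⟨_, e, Or.inr rfl⟩
  obtain ⟨y', hy', hyc'⟩ : ∃ x : K × K, Mh (Pi.single 1 (0, 1)) = Pi.single s₂' x ∧
      (x = (β', 0) ∨ x = (0, β')) := by
    rcases hMf with e | e
    · exact ⟨_, e, Or.inl rfl⟩
    · exact ⟨_, e, Or.inr rfl⟩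
  have Le : ∀ g, Lh (Pi.single (g * 1) (1, 0)) = Pi.single (g * s) ((g • x.1, g • x.2) : K × K) := by
    intro g
    have := hsh g (Pi.single 1 (1, 0))
    rw [hx, sh_single, sh_single] at this
    simpa using this
  have Me : ∀ g, Mh (Pi.single (g * 1) (1, 0)) = Pi.single (g * s') ((g • x'.1, g • x'.2) : K × K) := by
    intro g
    have := hsh' g (Pi.single 1 (1, 0))
    rw [hx', sh_single, sh_single] at this
    simpa using this
  have Lf : ∀ g, Lh (Pi.single (g * 1) (0, 1)) = Pi.single (g * s₂) ((g • y.1, g • y.2) : K × K) := by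
    intro g
    have := hsh g (Pi.single 1 (0, 1))
    rw [hy, sh_single, sh_single] at this
    simpa using this
  have Mf : ∀ g, Mh (Pi.single (g * 1) (0, 1)) = Pi.single (g * s₂') ((g • y'.1, g • y'.2) : K × K) := by
    intro g
    have := hsh' g (Pi.single 1 (0, 1))
    rw [hy', sh_single, sh_single] at this
    simpa using this
  set E : G → K × K := Nh (Pi.single 1 (1, 0)) with hE
  set F : G → K × K := Nh (Pi.single 1 (0, 1)) with hF
  have hE0 : E ≠ 0 := by
    rw [hE, Ne, LinearEquiv.map_eq_zero_iff, Pi.single_eq_zero_iff]; simp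
  have sE : ∀ c : K, Nh (Pi.single 1 (c, 0)) = c • E := by
    intro c; rw [hE, ← map_smul, ← Pi.single_smul]; simp
  have sF : ∀ c : K, Nh (Pi.single 1 (0, c)) = c • F := by
    intro c; rw [hF, ← map_smul, ← Pi.single_smul]; simp
  -- the relations
  have R1 := hiso (Pi.single (f * 1) (1, 0)) (Pi.single 1 (1, 0))
  have R2 := hiso (Pi.single 1 (1, 0)) (Pi.single (f * 1) (1, 0))
  have R3 := hiso (Pi.single (f * 1) (0, 1)) (Pi.single 1 (0, 1))
  have R4 := hiso (Pi.single 1 (0, 1)) (Pi.single (f * 1) (0, 1))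
  have R5 := hiso (Pi.single (r * 1) (1, 0)) (Pi.single 1 (0, 1))
  have R6 := hiso (Pi.single 1 (0, 1)) (Pi.single (r * 1) (1, 0))
  have R7 := hiso (Pi.single 1 (1, 0)) (Pi.single (r * 1) (0, 1))
  have R8 := hiso (Pi.single (r * 1) (0, 1)) (Pi.single 1 (1, 0))
  rw [SF_f h, Le, hx'] at R1
  rw [SF_f' h, hx, Me] at R2
  rw [SF_f h, Lf, hy'] at R3
  rw [SF_f' h, hy, Mf] at R4
  rw [SF_r h, Le, hy'] at R5
  rw [SF_r' h, hy, Me] at R6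
  rw [SF_r' h, hx, Mf] at R7
  rw [SF_r h, Lf, hx'] at R8
  simp only [mul_one, mul_zero, add_zero, zero_add, one_smul, sE, sF] at R1 R2 R3 R4 R5 R6 R7 R8
  have i1 : s' = s := match_idx h B' A' s s' x x' (R1.symm.trans R2) (R2 ▸ hE0)
  have i2 : s₂' = s₂ := match_idx h B' A' s₂ s₂' y y' (R3.symm.trans R4)
    (R4 ▸ smul_ne_zero hB0 hE0)
  subst i1 i2
  rw [SF_f h] at R1 R3
  rw [SF_f' h] at R2 R4
  have i3 : s₂' = s' := by
    by_contra hne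
    have h1 := congrFun R1 s'
    have h3 := congrFun R3 s'
    rw [Pi.single_eq_of_ne (Ne.symm hne), Pi.smul_apply] at h3
    rw [Pi.single_eq_same] at h1
    have e0 : E s' = 0 := by
      simpa [hB0] using h3
    rw [e0] at h1
    rw [← h1] at R1
    simp at R1
    exact hE0 R1
  subst i3
  rw [SF_r h] at R5 R8
  rw [SF_r' h] at R6 R7
  have v1 := congrArg Prod.fst (congrFun R1 s₂')
  have v2 := congrArg Prod.fst (congrFun R2 s₂')
  have v3 := congrArg Prod.fst (congrFun R3 s₂')
  have v4 := congrArg Prod.fst (congrFun R4 s₂')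
  have v5 := congrArg Prod.snd (congrFun R5 s₂')
  have v6 := congrArg Prod.snd (congrFun R6 s₂')
  have v7 := congrArg Prod.snd (congrFun R7 s₂')
  have v8 := congrArg Prod.snd (congrFun R8 s₂')
  simp only [Pi.single_eq_same, Pi.smul_apply, Prod.smul_fst, Prod.smul_snd, smul_eq_mul] at v1 v2 v3 v4 v5 v6 v7 v8
  have hE1 : (E s₂').1 ≠ 0 := by
    intro e0
    rw [v1] at e0
    rw [e0] at R1
    apply hE0
    rw [R1]; funext j; simp [Pi.single_apply]
  have hb : s₂' • B' ≠ 0 := hsm _ _ hB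
  have ha : s₂' • A' ≠ 0 := hsm _ _ hA
  refine ⟨s₂', α, β, α', β', ?_⟩
  have inj : ∀ c d : K, c ≠ 0 → c • x ≠ d • y := by
    intro c d hc e
    have : Lh (c • (Pi.single 1 (1, 0) : G → K × K) - d • (Pi.single 1 (0, 1) : G → K × K)) = 0 := by
      rw [map_sub, map_smul, map_smul, hx, hy, ← Pi.single_smul, ← Pi.single_smul, e, sub_self]
    rw [LinearEquiv.map_eq_zero_iff] at this
    have := congrArg Prod.fst (congrFun this 1)
    simp at this
    exact hc this
  rcases hxc with rfl | rfl <;> rcases hxc' with rfl | rfl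
  · rcases hyc with rfl | rfl
    · exact absurd (by simp [mul_comm]) (inj β α hβ)
    rcases hyc' with rfl | rfl
    · simp [hB0, hE1] at v3
    left
    simp only [smul_zero, mul_zero, zero_mul, add_zero, zero_add] at v1 v2 v3 v4 v5 v6 v7 v8
    refine ⟨hα, hβ, hα', hβ', ?_, ?_, ?_, ?_, ?_, ?_⟩
    · linear_combination v2 - v1
    · linear_combination B * v1 - v3
    · linear_combination B * v1 - v4
    · linear_combination v6 - v5
    · linear_combination A * v5 - v7
    · linear_combination A * v5 - v8
  · simp [hE1] at v1
  · simp [hE1] at v1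
  · rcases hyc with rfl | rfl
    swap
    · exact absurd (by simp [mul_comm]) (inj β α hβ)
    rcases hyc' with rfl | rfl
    swap
    · simp [hB0, hE1] at v3
    right
    simp only [smul_zero, mul_zero, zero_mul, add_zero, zero_add] at v1 v2 v3 v4 v5 v6 v7 v8
    refine ⟨hα, hβ, hα', hβ', ?_, ?_, ?_, ?_, ?_, ?_⟩
    · apply mul_left_cancel₀ hb; linear_combination v2 - v1
    · field_simp; linear_combination B * v1 - v3
    · field_simp; linear_combination B * v1 - v4
    · apply mul_left_cancel₀ ha; linear_combination v6 - v5
    · field_simp; linear_combination A * v5 - v7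
    · field_simp; linear_combination A * v5 - v8
end

section
variable {K G : Type} [Field K] [Finite K] [CommGroup G] [MulSemiringAction G K]

/-- Arithmetic facts on the Frobenius powers. -/
structure PF (K : Type) {G : Type} [Field K] [CommGroup G] [MulSemiringAction G K]
    (f t : G) (n D : ℕ) : Prop where
  hθ : ∀ x : K, t • x = x ^ (2 * n + 1)
  hf : ∀ x : K, x * f • x = x ^ (2 * D)
  hD : Odd D
  hfix : ∀ x : K, f • f • x = x → f • x = x
  hneg : (-1 : K) ≠ 1

theorem PF.pm {f t : G} {n D : ℕ} (h : PF K f t n D) {z : K} (hz : z * f • z = 1) :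
    z = 1 ∨ z = -1 := by
  have hz0 : z ≠ 0 := by rintro rfl; simp at hz
  have h1 : f • z = z⁻¹ := eq_inv_of_mul_eq_one_right hz
  have h2 : f • f • z = z := by rw [h1, smul_inv'', h1, inv_inv]
  have h3 := h.hfix z h2
  rw [h3] at hz
  exact mul_self_eq_one_iff.1 hz

theorem PF.powD {f t : G} {n D : ℕ} (h : PF K f t n D) {z : K} (hz : z ^ D = 1) : z = 1 := by
  have : z * f • z = 1 := by rw [h.hf, mul_comm, pow_mul, hz, one_pow]
  rcases h.pm this with e | e
  · exact e
  · rw [e, h.hD.neg_one_pow] at hz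
    exact absurd hz h.hneg

theorem PF.powD_inj {f t : G} {n D : ℕ} (h : PF K f t n D) {x y : K} (hy : y ≠ 0)
    (hz : x ^ D = y ^ D) : x = y := by
  have : (x / y) ^ D = 1 := by rw [div_pow, hz, div_self (pow_ne_zero _ hy)]
  exact (div_eq_one_iff_eq hy).1 (h.powD this)

theorem PF.powD_surj {f t : G} {n D : ℕ} (h : PF K f t n D) (y : K) (hy : y ≠ 0) :
    ∃ x : K, x ≠ 0 ∧ x ^ D = y := by
  have inj : Function.Injective (fun x : K => x ^ D) := by
    intro x y hxy
    by_cases hy : y = 0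
    · subst hy
      have : x ^ D = 0 := by
        have := hxy
        simp only [zero_pow h.hD.pos.ne'] at this
        exact this
      exact pow_eq_zero_iff (h.hD.pos.ne') |>.1 this
    · exact h.powD_inj hy hxy
  obtain ⟨x, hx⟩ := (Finite.injective_iff_surjective.1 inj) y
  refine ⟨x, ?_, hx⟩
  rintro rfl
  simp only [zero_pow h.hD.pos.ne'] at hx
  exact hy hx.symm

theorem PF.tau {f t : G} {n D : ℕ} (h : PF K f t n D) {B : K} (hB0 : B ≠ 0)
    (hBn : B ^ (n * (2 * n + 2)) = -1) :
    ∃ τ : K, τ ≠ 0 ∧ τ * f • τ * t • B = B ∧ τ * t • τ = -1 := by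
  obtain ⟨x, hx0, hx⟩ := h.powD_surj (B ^ n) (pow_ne_zero _ hB0)
  have h1 : x * f • x = B ^ (2 * n) := by
    rw [h.hf, mul_comm 2 D, pow_mul, hx, ← pow_mul, mul_comm]
  have h2 : x * t • x = -1 := by
    apply h.powD_inj (by simp)
    rw [h.hθ, ← pow_succ', h.hD.neg_one_pow, ← hBn, ← pow_mul, mul_comm _ D, pow_mul, hx, ← pow_mul]
  refine ⟨x⁻¹, inv_ne_zero hx0, ?_, ?_⟩
  · rw [smul_inv'', ← mul_inv, h1, h.hθ, pow_succ, inv_mul_cancel_left₀ (pow_ne_zero _ hB0)]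
  · rw [smul_inv'', ← mul_inv, h2, inv_neg_one]

theorem norm_form {f t r : G} {n D : ℕ} (h : PF K f t n D) (hr : r = f * t) (t2 : t * t = 1)
    {B A b a α β α' β' : K} (hE : Eqs f r B A b a α β α' β') (hb : b ≠ 0) :
    ∃ t0 : K, t0 ≠ 0 ∧ t0 * f • t0 * b = B ∧
      (f • (t0 * t • t0) * (a * b) = A * B ∨ f • (t0 * t • t0) * (a * b) = -(A * B)) := by
  have hsm : ∀ (g : G) (c : K), c ≠ 0 → g • c ≠ 0 := fun g c hc => (smul_ne_zero_iff_ne g).2 hc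
  obtain ⟨α0, β0, α'0, β'0, e1, e2, e3, e4, e5, e6⟩ := hE
  obtain ⟨c, rfl⟩ : ∃ c, α' = c * α := ⟨α' / α, by field_simp⟩
  obtain ⟨u, rfl⟩ : ∃ u, β = u * α := ⟨β / α, by field_simp⟩
  obtain ⟨d, rfl⟩ : ∃ d, β' = d * (u * α) := ⟨β' / (u * α), (div_mul_cancel₀ _ β0).symm⟩
  have c0 : c ≠ 0 := left_ne_zero_of_mul α'0
  have u0 : u ≠ 0 := left_ne_zero_of_mul β0
  have d0 : d ≠ 0 := left_ne_zero_of_mul β'0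
  simp only [smul_mul'] at e1 e2 e3 e4 e5 e6
  have fα := hsm f α α0
  have fu := hsm f u u0
  have ru := hsm r u u0
  have rα := hsm r α α0
  have q1 : f • c = c := by
    apply mul_left_cancel₀ (mul_ne_zero α0 fα); linear_combination -e1
  have q2 : b * (f • u * u * d) = B * c := by
    apply mul_left_cancel₀ (mul_ne_zero α0 fα); linear_combination e2
  have q3 : f • d = d := by
    apply mul_left_cancel₀ (mul_ne_zero (mul_ne_zero α0 fα) (mul_ne_zero (mul_ne_zero hb u0) fu))
    linear_combination e3 - e2
  have q4 : d = t • c := by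
    have : d = r • c := by
      apply mul_left_cancel₀ (mul_ne_zero (mul_ne_zero α0 rα) u0); linear_combination e4
    rw [this, hr, mul_comm, mul_smul, q1]
  have q6 : a * (r • u * c) = A * (d * u) := by
    apply mul_left_cancel₀ (mul_ne_zero α0 rα); linear_combination e6
  have td : t • d = c := by rw [q4, ← mul_smul, t2, one_smul]
  have key : f • u * r • u * (a * b) = A * B := by
    apply mul_left_cancel₀ (mul_ne_zero (mul_ne_zero c0 d0) u0)
    linear_combination (a * (r • u * c)) * q2 + B * c * q6
  set w := c ^ n with hw
  have w0 : w ≠ 0 := pow_ne_zero _ c0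
  have w2 : w * w * c = d := by
    rw [q4, h.hθ, hw, pow_succ, ← pow_add, two_mul]
  have fw : f • w = w := by rw [hw, smul_pow', q1]
  have tw : t • w * t • w * d = c := by
    have e := congrArg (t • ·) w2
    simp only [smul_mul', td, ← q4] at e
    exact e
  have hpm : (w * t • w) * (w * t • w) = 1 := by
    apply mul_left_cancel₀ (mul_ne_zero c0 d0)
    linear_combination (t • w * t • w * d) * w2 + d * tw
  refine ⟨u * w, mul_ne_zero u0 w0, ?_, ?_⟩
  · rw [smul_mul', fw]
    apply mul_left_cancel₀ c0
    linear_combination (u * f • u * b) * w2 + q2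
  · have e : f • (u * w * t • (u * w)) = f • u * r • u * (f • (w * t • w)) := by
      simp only [smul_mul', hr, mul_smul]; ring
    rw [e]
    rcases mul_self_eq_one_iff.1 hpm with e | e
    · left; rw [e, smul_one]; linear_combination key
    · right; rw [e, smul_neg, smul_one]; linear_combination -key

theorem normal {f t r : G} {n D : ℕ} (h : PF K f t n D) (hr : r = f * t) (t2 : t * t = 1)
    {B A B' A' α β α' β' : K} {s : G} (hE : Eqs f r B A (s • B') (s • A') α β α' β')
    (hB0 : B' ≠ 0) (hBn : B' ^ (n * (2 * n + 2)) = -1) (hAB : t • (A' * B') = A' * B') :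
    ∃ (s : G) (t0 : K), t0 ≠ 0 ∧ t0 * f • t0 * s • B' = B ∧
      f • (t0 * t • t0) * s • (A' * B') = A * B := by
  obtain ⟨t0, h0, h1, h2⟩ := norm_form h hr t2 hE ((smul_ne_zero_iff_ne s).2 hB0)
  rw [← smul_mul'] at h2
  rcases h2 with h2 | h2
  · exact ⟨s, t0, h0, h1, h2⟩
  · obtain ⟨τ, τ0, τ1, τ2⟩ := h.tau hB0 hBn
    have τ1' := congrArg (s • ·) τ1
    have τ2' := congrArg (s • ·) τ2
    simp only [smul_mul', smul_neg, smul_one] at τ1' τ2'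
    refine ⟨s * t, t0 * s • τ, mul_ne_zero h0 ((smul_ne_zero_iff_ne s).2 τ0), ?_, ?_⟩
    · rw [smul_mul', smul_comm f s τ, mul_smul]
      rw [← h1]
      linear_combination (t0 * f • t0) * τ1'
    · rw [mul_smul s t, hAB]
      have : t0 * s • τ * t • (t0 * s • τ) = -(t0 * t • t0) := by
        rw [smul_mul', smul_comm t s τ]
        linear_combination (t0 * t • t0) * τ2'
      rw [this, smul_neg]
      linear_combination -h2

theorem strong_of_normal {f t r : G} (hr : r = f * t) {B A B' A' : K} {s : G} {t0 : K}
    (hB0 : B' ≠ 0) (h0 : t0 ≠ 0) (h1 : t0 * f • t0 * s • B' = B)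
    (h2 : f • (t0 * t • t0) * s • (A' * B') = A * B) :
    ∃ N L : K × K ≃+ K × K, ∀ z w, N (st f r B A z w) = st f r B' A' (L z) (L w) := by
  have hsm : ∀ (g : G) (c : K), c ≠ 0 → g • c ≠ 0 := fun g c hc => (smul_ne_zero_iff_ne g).2 hc
  have h3 : s • A' * r • t0 = A * t0 := by
    apply mul_left_cancel₀ (mul_ne_zero (hsm f _ h0) (hsm s _ hB0))
    rw [← h1] at h2
    rw [hr, mul_smul]
    simp only [smul_mul'] at h2
    linear_combination h2
  let σ : K ≃+ K := DistribMulAction.toAddEquiv K s⁻¹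
  let μ : K ≃+ K := ((LinearEquiv.smulOfNeZero K K t0 h0).toAddEquiv).trans σ
  have hσ : ∀ x, σ x = s⁻¹ • x := fun _ => rfl
  have hμ : ∀ x, μ x = s⁻¹ • (t0 * x) := fun _ => rfl
  have hsB : B' = s⁻¹ • (s • B') := by simp
  have hsA : A' = s⁻¹ • (s • A') := by simp
  refine ⟨AddEquiv.prodCongr σ μ, AddEquiv.prodCongr σ μ, ?_⟩
  rintro ⟨x, y⟩ ⟨u, v⟩
  have hpc : ∀ z, (AddEquiv.prodCongr σ μ) z = (σ z.1, μ z.2) := fun _ => rfl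
  rw [hsB, hsA]
  simp only [st, hpc, hσ, hμ, smul_comm f s⁻¹, smul_comm r s⁻¹,
    ← smul_mul', ← smul_add]
  refine Prod.ext ?_ ?_
  · simp only [smul_mul' f]
    congr 1
    rw [← h1]; ring
  · simp only [smul_mul' r]
    congr 1
    linear_combination -(x * r • v + r • y * u) * h3

theorem st_swap (f r : G) {B A : K} (hB : B ≠ 0) (hA : A ≠ 0) (z w : K × K) :
    st f r B A z.swap w.swap
      = (B * (st f r B⁻¹ A⁻¹ z w).1, A * (st f r B⁻¹ A⁻¹ z w).2) := by
  simp only [st, Prod.swap]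
  refine Prod.ext ?_ ?_
  · field_simp; ring
  · field_simp; ring

theorem strong_swap {f r : G} {B A B' A' : K} (hB : B' ≠ 0) (hA : A' ≠ 0)
    (h : ∃ N L : K × K ≃+ K × K, ∀ z w, N (st f r B A z w) = st f r B'⁻¹ A'⁻¹ (L z) (L w)) :
    ∃ N L : K × K ≃+ K × K, ∀ z w, N (st f r B A z w) = st f r B' A' (L z) (L w) := by
  obtain ⟨N, L, h⟩ := h
  refine ⟨N.trans (AddEquiv.prodCongr ((LinearEquiv.smulOfNeZero K K B' hB).toAddEquiv) ((LinearEquiv.smulOfNeZero K K A' hA).toAddEquiv)),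
    L.trans AddEquiv.prodComm, ?_⟩
  intro z w
  have := st_swap f r hB hA (L z) (L w)
  simp only [AddEquiv.trans_apply, h]
  exact this.symm

theorem PF.uniq {f t : G} {n D : ℕ} (h : PF K f t n D) {x y b : K} (hb : b ≠ 0)
    (hy : y ≠ 0) (he : x * f • x * b = y * f • y * b) : x * t • x = y * t • y := by
  have e := mul_right_cancel₀ hb he
  have hfy : f • y ≠ 0 := (smul_ne_zero_iff_ne f).2 hy
  have : (x / y) * f • (x / y) = 1 := by
    rw [div_eq_mul_inv, smul_mul', smul_inv'']
    field_simp
    exact e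
  rcases h.pm this with e | e
  · rw [div_eq_one_iff_eq hy] at e; rw [e]
  · rw [div_eq_iff hy] at e; rw [e]; simp
end
section
variable {K G : Type} [Field K] [Finite K] [CommGroup G] [MulSemiringAction G K]

theorem PF.hBA {f t : G} {n D : ℕ} (h : PF K f t n D) {B a : K} (hB0 : B ≠ 0)
    (hBn : B ^ (n * (2 * n + 2)) = -1) (ha0 : a ≠ 0) (ha : t • a = a) :
    f⁻¹ • (a / B * B) * t • (a / B) ≠ B := by
  intro e
  have htB : t • B ≠ 0 := (smul_ne_zero_iff_ne t).2 hB0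
  rw [div_mul_cancel₀ _ hB0, div_eq_mul_inv, smul_mul', smul_inv'', ha] at e
  have e2 : f⁻¹ • a * a = B * t • B := by
    rw [← mul_assoc, mul_inv_eq_iff_eq_mul₀ htB] at e; exact e
  have e3 : (a ^ n) * (a ^ n) = 1 := by
    have h1 : a ^ (2 * n) * a = 1 * a := by rw [← pow_succ, ← h.hθ, ha, one_mul]
    rw [← pow_add, ← two_mul]; exact mul_right_cancel₀ ha0 h1
  have e4 : f⁻¹ • (a ^ n) = a ^ n := by
    rcases mul_self_eq_one_iff.1 e3 with e | e <;> rw [e] <;> simp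
  have e5 := congrArg (· ^ n) e2
  simp only [mul_pow, ← smul_pow', e4, e3] at e5
  rw [h.hθ, ← pow_succ', ← pow_mul, hBn] at e5
  exact h.hneg e5.symm

variable [Fintype G] [DecidableEq G]

theorem core
    (hind : ∀ c : G → K, (∀ x : K, ∑ g, c g * g • x = 0) → c = 0)
    (hexp : ∀ f : K →+ K, ∃ c : G → K, ∀ x, f x = ∑ g, c g * g • x)
    (hK : ∀ x y u v : K, x ≠ 0 → y ≠ 0 → ∃ b : K, b ≠ 0 ∧ x + b * u ≠ 0 ∧ y + b * v ≠ 0)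
    {f t r : G} (h : GF f t r) {n D : ℕ} (hP : PF K f t n D)
    {B a a' : K} (hB0 : B ≠ 0) (hBn : B ^ (n * (2 * n + 2)) = -1)
    (ha0' : a' ≠ 0) (ha' : t • a' = a')
    (hiso : ∃ N L M : K × K ≃+ K × K, ∀ z w,
      N (st f r B (a / B) z w) = st f r B (a' / B) (L z) (M w)) :
    ∃ (s : G) (t0 : K), t0 ≠ 0 ∧
      ((t0 * f • t0 * s • B = B ∧ f • (t0 * t • t0) * s • (a' / B * B) = a / B * B) ∨
      (t0 * f • t0 * s • B⁻¹ = B ∧ f • (t0 * t • t0) * s • ((a' / B)⁻¹ * B⁻¹) = a / B * B)) := by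
  obtain ⟨N, L, M, hiso⟩ := hiso
  obtain ⟨Nh, Lh, Mh, h1, h2, h3⟩ := exists_polar hind hexp f r B (a / B) B (a' / B) N L M hiso
  obtain ⟨s, α, β, α', β', hE⟩ := eqs_of_iso hK h hB0 hB0 (div_ne_zero ha0' hB0)
    (hP.hBA hB0 hBn ha0' ha') Nh Lh Mh h1 h2 h3
  rcases hE with hE | hE
  · obtain ⟨s, t0, q0, q1, q2⟩ := normal hP h.hr h.t2 hE hB0 hBn
      (by rw [div_mul_cancel₀ _ hB0, ha'])
    exact ⟨s, t0, q0, Or.inl ⟨q1, q2⟩⟩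
  · rw [← smul_inv'', ← smul_inv''] at hE
    obtain ⟨s, t0, q0, q1, q2⟩ := normal hP h.hr h.t2 hE (inv_ne_zero hB0)
      (by rw [inv_pow, hBn, inv_neg_one])
      (by rw [← mul_inv, div_mul_cancel₀ _ hB0, smul_inv'', ha'])
    exact ⟨s, t0, q0, Or.inr ⟨q1, q2⟩⟩

theorem main_abs
    (hind : ∀ c : G → K, (∀ x : K, ∑ g, c g * g • x = 0) → c = 0)
    (hexp : ∀ f : K →+ K, ∃ c : G → K, ∀ x, f x = ∑ g, c g * g • x)
    (hK : ∀ x y u v : K, x ≠ 0 → y ≠ 0 → ∃ b : K, b ≠ 0 ∧ x + b * u ≠ 0 ∧ y + b * v ≠ 0)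
    {f t r : G} (h : GF f t r) {n D : ℕ} (hP : PF K f t n D)
    {B a : K} (hB0 : B ≠ 0) (hBn : B ^ (n * (2 * n + 2)) = -1)
    (ha0 : a ≠ 0) (ha : t • a = a) :
    (∀ a' : K, a' ≠ 0 → t • a' = a' →
      (∃ N L M : K × K ≃+ K × K, ∀ z w,
        N (st f r B (a / B) z w) = st f r B (a' / B) (L z) (M w)) →
      ∃ N L : K × K ≃+ K × K, ∀ z w,
        N (st f r B (a / B) z w) = st f r B (a' / B) (L z) (L w)) ∧
    Set.ncard {a' : K | a' ≠ 0 ∧ t • a' = a' ∧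
      ∃ N L M : K × K ≃+ K × K, ∀ z w,
        N (st f r B (a' / B) z w) = st f r B (a / B) (L z) (M w)} ≤ 2 * Fintype.card G := by
  constructor
  · intro a' ha0' ha' hiso
    obtain ⟨s, t0, q0, ⟨q1, q2⟩ | ⟨q1, q2⟩⟩ := core hind hexp hK h hP hB0 hBn ha0' ha' hiso
    · exact strong_of_normal h.hr hB0 q0 q1 q2
    · exact strong_swap hB0 (div_ne_zero ha0' hB0)
        (strong_of_normal h.hr (inv_ne_zero hB0) q0 q1 q2)
  · set S := {a' : K | a' ≠ 0 ∧ t • a' = a' ∧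
      ∃ N L M : K × K ≃+ K × K, ∀ z w,
        N (st f r B (a' / B) z w) = st f r B (a / B) (L z) (M w)} with hS
    have key : ∀ x : S, ∃ g : G × Bool, ∃ t0 : K, t0 ≠ 0 ∧
        t0 * f • t0 * g.1 • (if g.2 then B else B⁻¹) = B ∧
        f • (t0 * t • t0) * g.1 • (if g.2 then a / B * B else (a / B)⁻¹ * B⁻¹) = x := by
      rintro ⟨x, hx0, hx, hiso⟩
      obtain ⟨s, t0, q0, ⟨q1, q2⟩ | ⟨q1, q2⟩⟩ := core hind hexp hK h hP hB0 hBn ha0 ha hiso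
      · refine ⟨(s, true), t0, q0, q1, ?_⟩
        simp only [if_true]
        rw [q2, div_mul_cancel₀ _ hB0]
      · refine ⟨(s, false), t0, q0, by simpa using q1, ?_⟩
        simp only [Bool.false_eq_true, if_false]
        rw [q2, div_mul_cancel₀ _ hB0]
    choose g hg using key
    have inj : Function.Injective g := by
      intro x y hxy
      obtain ⟨u, u0, u1, u2⟩ := hg x
      obtain ⟨v, v0, v1, v2⟩ := hg y
      rw [hxy] at u1 u2
      have hb : (g y).1 • (if (g y).2 then B else B⁻¹) ≠ 0 := by
        apply (smul_ne_zero_iff_ne _).2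
        split_ifs
        · exact hB0
        · exact inv_ne_zero hB0
      have := hP.uniq hb v0 (u1.trans v1.symm)
      apply Subtype.ext
      rw [← u2, ← v2, this]
    have := Nat.card_le_card_of_injective g inj
    rw [Nat.card_coe_set_eq] at this
    refine this.trans ?_
    simp [Nat.card_eq_fintype_card, mul_comm]
end
section
variable {K G : Type} [Field K] [Fintype K] [CommGroup G] [MulSemiringAction G K] [Fintype G]

theorem hind_of [FaithfulSMul G K] (c : G → K) (hc : ∀ x : K, ∑ g, c g * g • x = 0) : c = 0 := by
  have h1 := linearIndependent_monoidHom K K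
  let i : G → (K →* K) := fun g => (MulSemiringAction.toRingHom G K g : K →* K)
  have hi : Function.Injective i := by
    intro g g' e
    apply FaithfulSMul.eq_of_smul_eq_smul (α := K)
    intro x
    exact DFunLike.congr_fun e x
  have h2 := h1.comp i hi
  rw [Fintype.linearIndependent_iff] at h2
  funext g
  refine h2 c ?_ g
  funext x
  have := hc x
  simpa [Finset.sum_apply, i] using this

theorem hexp_of (p m : ℕ) (hp : p.Prime) (hcard : Fintype.card K = p ^ m)
    (hG : Fintype.card G = m) (hm : m ≠ 0)
    (hind : ∀ c : G → K, (∀ x : K, ∑ g, c g * g • x = 0) → c = 0)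
    (F : K →+ K) : ∃ c : G → K, ∀ x, F x = ∑ g, c g * g • x := by
  classical
  haveI : Fact p.Prime := ⟨hp⟩
  haveI : CharP K p := by
    obtain ⟨q, hq⟩ := CharP.exists K
    obtain ⟨n, hqp, hn⟩ := FiniteField.card K q
    rw [hcard] at hn
    have : p ∣ q ^ (n : ℕ) := hn ▸ dvd_pow_self p hm
    have := (Nat.prime_dvd_prime_iff_eq hp hqp).1 (hp.dvd_of_dvd_pow this)
    rw [this]; exact hq
  letI : Algebra (ZMod p) K := ZMod.algebra K p
  let Φ : (G → K) →+ (K →+ K) :=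
    AddMonoidHom.mk' (fun c => AddMonoidHom.mk' (fun x => ∑ g, c g * g • x) (by
      intro x y; simp [mul_add, Finset.sum_add_distrib])) (by
      intro c d; ext x; simp [add_mul, Finset.sum_add_distrib])
  have hΦ : Function.Injective Φ := by
    rw [injective_iff_map_eq_zero]
    intro c hc
    exact hind c (fun x => DFunLike.congr_fun hc x)
  have hfr : Module.finrank (ZMod p) K = m := by
    have := Module.card_eq_pow_finrank (K := ZMod p) (V := K)
    rw [hcard, ZMod.card] at this
    exact (Nat.pow_right_injective hp.two_le this).symm
  have e : (K →+ K) ≃ (K →ₗ[ZMod p] K) := (AddMonoidHom.toZModLinearMapEquiv p).toEquiv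
  haveI : Finite (K →+ K) := Finite.of_injective _ (DFunLike.coe_injective)
  have hc : Nat.card (K →+ K) ≤ Nat.card (G → K) := by
    rw [Nat.card_congr e, Module.natCard_eq_pow_finrank (K := ZMod p), Module.finrank_linearMap, hfr]
    simp [Nat.card_eq_fintype_card, hcard, hG, pow_mul]
  obtain ⟨c, hc⟩ := (hΦ.bijective_of_nat_card_le hc).2 F
  exact ⟨c, fun x => by rw [← hc]; rfl⟩

theorem hK_of (h3 : 3 < Fintype.card K) (x y u v : K) (hx : x ≠ 0) (hy : y ≠ 0) :
    ∃ b : K, b ≠ 0 ∧ x + b * u ≠ 0 ∧ y + b * v ≠ 0 := by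
  classical
  obtain ⟨b, hb⟩ : ∃ b, b ∉ ({0, -x / u, -y / v} : Finset K) := by
    by_contra hc
    push Not at hc
    have : (Finset.univ : Finset K) ⊆ {0, -x / u, -y / v} := fun b _ => hc b
    have := Finset.card_le_card this
    have h2 := Finset.card_le_three (a := (0 : K)) (b := -x / u) (c := -y / v)
    rw [Finset.card_univ] at this
    omega
  simp only [Finset.mem_insert, Finset.mem_singleton, not_or] at hb
  obtain ⟨b0, b1, b2⟩ := hb
  refine ⟨b, b0, ?_, ?_⟩
  · intro e
    by_cases hu : u = 0
    · subst hu; simp at e; exact hx e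
    · exact b1 (by rw [eq_div_iff hu]; linear_combination e)
  · intro e
    by_cases hu : v = 0
    · subst hu; simp at e; exact hy e
    · exact b2 (by rw [eq_div_iff hu]; linear_combination e)

theorem main_gal [FaithfulSMul G K] (p m k : ℕ) (hp : Nat.Prime p) (hp2 : p ≠ 2)
    (hm : 2 < m) (hmeven : Even m) (hcard : Fintype.card K = p ^ m)
    (hk1 : 1 ≤ k) (hk2 : k ≤ m - 1) (hodd : Odd (m / Nat.gcd k m))
    (φ : G) (hφ : ∀ x : K, φ • x = x ^ p) (hG : Fintype.card G = m) (hord : orderOf φ = m)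
    (a B : K) (ha0 : a ≠ 0) (haQ : a ^ p ^ (m / 2) = a)
    (hB0 : B ≠ 0) (hB : ¬ ∃ c : K, c ^ 2 = B) :
    (∀ a' : K, a' ≠ 0 → a' ^ p ^ (m / 2) = a' →
      (∃ N L K' : K × K ≃+ K × K, ∀ z w : K × K,
          N (sstar K (p ^ k) (p ^ (k + m / 2)) B (a / B) z w)
            = sstar K (p ^ k) (p ^ (k + m / 2)) B (a' / B) (L z) (K' w)) →
      (∃ N L : K × K ≃+ K × K, ∀ z w : K × K,
          N (sstar K (p ^ k) (p ^ (k + m / 2)) B (a / B) z w)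
            = sstar K (p ^ k) (p ^ (k + m / 2)) B (a' / B) (L z) (L w)))
    ∧ Set.ncard
        {a' : K | a' ≠ 0 ∧ a' ^ p ^ (m / 2) = a' ∧
          ∃ N L K' : K × K ≃+ K × K, ∀ z w : K × K,
            N (sstar K (p ^ k) (p ^ (k + m / 2)) B (a' / B) z w)
              = sstar K (p ^ k) (p ^ (k + m / 2)) B (a / B) (L z) (K' w)}
        ≤ 2 * m := by
  classical
  have hpow : ∀ (j : ℕ) (x : K), φ ^ j • x = x ^ p ^ j := by
    intro j x
    induction j with
    | zero => simp
    | succ j ih => rw [pow_succ', mul_smul, ih, hφ, ← pow_mul, ← pow_succ]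
  have hst : ∀ B A : K, sstar K (p ^ k) (p ^ (k + m / 2)) B A
      = st (φ ^ k) (φ ^ (k + m / 2)) B A := by
    intro B A
    funext z w
    simp only [sstar, st, hpow]
  have hind := hind_of (K := K) (G := G)
  have hexp := hexp_of (K := K) (G := G) p m hp hcard hG (by omega) hind
  have hp3 : 3 ≤ p := by
    have := hp.two_le
    omega
  have podd : Odd p := hp.odd_of_ne_two hp2
  have hKc : 3 < Fintype.card K := by
    rw [hcard]
    calc 3 < 3 ^ 2 := by norm_num
      _ ≤ p ^ 2 := Nat.pow_le_pow_left hp3 2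
      _ ≤ p ^ m := Nat.pow_le_pow_right (by omega) (by omega)
  obtain ⟨h, rfl⟩ : ∃ h, m = 2 * h := hmeven.two_dvd
  have hh : 2 * h / 2 = h := by omega
  simp only [hh] at haQ hst ⊢
  have hg0 : Nat.gcd k (2 * h) ≠ 0 := by
    intro e; rw [Nat.gcd_eq_zero_iff] at e; omega
  have hgm : Nat.gcd k (2 * h) ∣ 2 * h := Nat.gcd_dvd_right _ _
  obtain ⟨l, hl⟩ : ∃ l, l = 2 * h / Nat.gcd k (2 * h) := ⟨_, rfl⟩
  have hlm : 2 * h = Nat.gcd k (2 * h) * l := by rw [hl, Nat.mul_div_cancel' hgm]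
  rw [← hl] at hodd
  have hgk : Nat.gcd k (2 * h) ∣ k := Nat.gcd_dvd_left _ _
  have hfl : (φ ^ k) ^ l = 1 := by
    rw [← pow_mul, ← orderOf_dvd_iff_pow_eq_one, hord]
    nth_rewrite 1 [hlm]
    refine Nat.mul_dvd_mul ?_ dvd_rfl
    exact hgk
  have hkeven : Even k := by
    have : Even (Nat.gcd k (2 * h) * l) := hlm ▸ even_two_mul h
    rw [Nat.even_mul] at this
    rcases this with e | e
    · exact even_iff_two_dvd.2 (e.two_dvd.trans hgk)
    · exact absurd e (Nat.not_even_iff_odd.2 hodd)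
  have hf1 : φ ^ k ≠ 1 := by
    intro e
    rw [← orderOf_dvd_iff_pow_eq_one, hord] at e
    have := Nat.le_of_dvd (by omega) e
    omega
  have hgf : GF (φ ^ k) (φ ^ h) (φ ^ (k + h)) := by
    refine ⟨pow_add _ _ _, ?_, ?_, ?_⟩
    · rw [← pow_add, ← two_mul, ← hord, pow_orderOf_eq_one]
    · intro e
      rw [← orderOf_dvd_iff_pow_eq_one, hord] at e
      have := Nat.le_of_dvd (by omega) e
      omega
    · intro e
      have d1 := orderOf_dvd_iff_pow_eq_one.2 e
      have d2 := orderOf_dvd_iff_pow_eq_one.2 hfl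
      have cop : Nat.Coprime 8 l := by
        have : Nat.Coprime (2 ^ 3) l := Nat.Coprime.pow_left 3 (Nat.coprime_two_left.2 hodd)
        simpa using this
      have := Nat.eq_one_of_dvd_coprimes cop d1 d2
      exact hf1 (orderOf_eq_one_iff.1 this)
  obtain ⟨n, hn⟩ : Odd (p ^ h) := podd.pow
  obtain ⟨j, hj⟩ : ∃ j, p ^ k = 4 * j + 1 := by
    obtain ⟨k', rfl⟩ := hkeven.two_dvd
    have h1 : p ^ 2 % 4 = 1 := by
      obtain ⟨i, rfl⟩ := podd
      have : (2 * i + 1) ^ 2 = 4 * (i * i + i) + 1 := by ring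
      rw [this]; omega
    have : p ^ (2 * k') % 4 = 1 := by
      rw [pow_mul, Nat.pow_mod, h1, one_pow]; norm_num
    exact ⟨p ^ (2 * k') / 4, by omega⟩
  have hchar : ringChar K ≠ 2 := by
    intro e
    have h1 := FiniteField.even_card_of_char_two e
    rw [hcard] at h1
    have := Nat.odd_iff.1 (podd.pow (n := 2 * h))
    omega
  have hneg : (-1 : K) ≠ 1 := Ring.neg_one_ne_one_of_char_ne_two hchar
  have hPF : PF K (φ ^ k) (φ ^ h) n (2 * j + 1) := by
    refine ⟨fun x => by rw [hpow, hn], fun x => ?_, ⟨j, rfl⟩, fun x hx => ?_, hneg⟩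
    · rw [hpow, hj, ← pow_succ']; congr 1; ring
    · obtain ⟨i, hi⟩ := hodd
      have h2 : ∀ i : ℕ, (φ ^ k) ^ (2 * i) • x = x := by
        intro i
        induction i with
        | zero => simp
        | succ i ih =>
          rw [mul_add, pow_add, mul_smul]
          have : (φ ^ k) ^ (2 * 1) • x = x := by rw [mul_one, pow_two, mul_smul, hx]
          rw [this, ih]
      have h3 : (φ ^ k) ^ l • x = x := by rw [hfl, one_smul]
      rw [hi, pow_succ', mul_smul, h2] at h3
      exact h3
  have hBn : B ^ (n * (2 * n + 2)) = -1 := by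
    have hc2 : Fintype.card K / 2 = n * (2 * n + 2) := by
      have : p ^ (2 * h) = 2 * (n * (2 * n + 2)) + 1 := by
        rw [mul_comm 2 h, pow_mul, hn]; ring
      rw [hcard]; omega
    rw [← hc2]
    rcases FiniteField.pow_dichotomy hchar hB0 with e | e
    · exfalso
      obtain ⟨c, hc⟩ := (FiniteField.isSquare_iff hchar hB0).2 e
      exact hB ⟨c, by rw [hc, pow_two]⟩
    · exact e
  have := main_abs hind hexp (hK_of hKc) hgf hPF hB0 hBn ha0 (by rw [hpow, haQ])
  simp only [hpow, hG] at this
  simp only [hst]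
  exact this
end

/-- The Galois group as a commutative group. -/
@[reducible] noncomputable def galComm (F K : Type) [Field F] [Field K] [Finite K] [Algebra F K] :
    CommGroup (K ≃ₐ[F] K) :=
  { (inferInstance : Group (K ≃ₐ[F] K)) with
    mul_comm := fun a b => (IsCyclic.isMulCommutative (α := K ≃ₐ[F] K)).is_comm.comm a b }

end FamS

/-- Fixing admissible `q`, a non-square `B` and `a ∈ 𝔽_Q^×`:
(i) if `P_{q,B,a}` and `P_{q,B,a′}` are isotopic then they are strongly isotopic;
(ii) at most `2m` values `a′ ∈ 𝔽_Q^×` give `P_{q,B,a′}` isotopic to `P_{q,B,a}`. -/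
theorem stmt_16 (p m k : ℕ) (hp : Nat.Prime p) (hp2 : p ≠ 2)
    (hm : 2 < m) (hmeven : Even m)
    (K : Type) [Field K] [Fintype K] (hcard : Fintype.card K = p ^ m)
    (hk1 : 1 ≤ k) (hk2 : k ≤ m - 1) (hodd : Odd (m / Nat.gcd k m))
    (a B : K) (ha0 : a ≠ 0) (haQ : a ^ p ^ (m / 2) = a)
    (hB0 : B ≠ 0) (hB : ¬ ∃ c : K, c ^ 2 = B) :
    (∀ a' : K, a' ≠ 0 → a' ^ p ^ (m / 2) = a' →
      (∃ N L K' : K × K ≃+ K × K, ∀ z w : K × K,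
          N (sstar K (p ^ k) (p ^ (k + m / 2)) B (a / B) z w)
            = sstar K (p ^ k) (p ^ (k + m / 2)) B (a' / B) (L z) (K' w)) →
      (∃ N L : K × K ≃+ K × K, ∀ z w : K × K,
          N (sstar K (p ^ k) (p ^ (k + m / 2)) B (a / B) z w)
            = sstar K (p ^ k) (p ^ (k + m / 2)) B (a' / B) (L z) (L w)))
    ∧ Set.ncard
        {a' : K | a' ≠ 0 ∧ a' ^ p ^ (m / 2) = a' ∧
          ∃ N L K' : K × K ≃+ K × K, ∀ z w : K × K,
            N (sstar K (p ^ k) (p ^ (k + m / 2)) B (a' / B) z w)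
              = sstar K (p ^ k) (p ^ (k + m / 2)) B (a / B) (L z) (K' w)}
        ≤ 2 * m := by
  classical
  haveI : Fact p.Prime := ⟨hp⟩
  haveI : CharP K p := by
    obtain ⟨q, hq⟩ := CharP.exists K
    obtain ⟨n, hqp, hn⟩ := FiniteField.card K q
    rw [hcard] at hn
    have : p ∣ q ^ (n : ℕ) := hn ▸ dvd_pow_self p (by omega)
    have := (Nat.prime_dvd_prime_iff_eq hp hqp).1 (hp.dvd_of_dvd_pow this)
    rw [this]; exact hq
  letI : Algebra (ZMod p) K := ZMod.algebra K p
  have hfr : Module.finrank (ZMod p) K = m := by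
    have := Module.card_eq_pow_finrank (K := ZMod p) (V := K)
    rw [hcard, ZMod.card] at this
    exact (Nat.pow_right_injective hp.two_le this).symm
  letI := FamS.galComm (ZMod p) K
  letI : Fintype (K ≃ₐ[ZMod p] K) := Fintype.ofFinite _
  refine FamS.main_gal (G := K ≃ₐ[ZMod p] K) p m k hp hp2 hm hmeven hcard hk1 hk2 hodd
    (FiniteField.frobeniusAlgEquivOfAlgebraic (ZMod p) K) ?_ ?_ ?_ a B ha0 haQ hB0 hB
  · intro x
    have := congrFun (FiniteField.coe_frobeniusAlgEquivOfAlgebraic (ZMod p) K) x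
    rw [ZMod.card] at this
    exact this
  · rw [← Nat.card_eq_fintype_card, ← hfr]
    have := Nat.card_eq_of_bijective _ (FiniteField.bijective_frobeniusAlgEquivOfAlgebraic_pow (ZMod p) K)
    rw [← this]; simp
  · rw [← hfr]
    exact FiniteField.orderOf_frobeniusAlgEquivOfAlgebraic (ZMod p) K
end

section
/- Let n be a positive integer divisible by 4, m = n/2, and σ(n) the odd part of n (σ(n) = n/2^{ν₂(n)}). Then there exists a set T of 𝔽_p-bilinear multiplications on M × M ≅ 𝔽_p^n, each commutative and without zero divisors (i.e., each making M × M a commutative pre-semifield), which are pairwise non-isotopic and satisfy |T| ≥ (σ(n) − 1)(p^{n/4} − 1)/(2n). In particular, the number of pairwise non-isotopic commutative pre-semifields of order p^n grows exponentially in n along n = 4t with t not a power of 2. -/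
set_option linter.unusedSimpArgs false
set_option linter.unusedSectionVars false

namespace GK

/-- The multiplication attached to a pair of commuting automorphisms and two constants. -/
noncomputable def mulS {k M : Type} [Field k] [Field M] [Algebra k M] (φ ι : M ≃ₐ[k] M) (B a : M)
    (z w : M × M) : M × M :=
  (φ z.1 * w.1 + z.1 * φ w.1 + B * (φ z.2 * w.2 + z.2 * φ w.2),
   φ (ι z.1) * w.2 + φ (ι w.1) * z.2 + a / B * (z.1 * φ (ι w.2) + w.1 * φ (ι z.2)))

open Classical in
/-- The standing assumptions on the data of the construction. -/
structure Good {k M : Type} [Field k] [Field M] [Fintype M] [Algebra k M] (φ ι : M ≃ₐ[k] M) (B : M) :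
    Prop where
  neg : ∀ x, φ x = -x → x = 0
  two : ∀ x, φ (φ x) = x → φ x = x
  comm : ∀ x, φ (ι x) = ι (φ x)
  inv : ∀ x, ι (ι x) = x
  sqfix : ∀ x, x ≠ 0 → ι x = x → quadraticChar M x = 1
  nsq : quadraticChar M B = -1
  fixB : φ B = B

section
variable {k M : Type} [Field k] [Field M] [Fintype M] [Algebra k M]

open Classical in
lemma chi_map (φ : M ≃ₐ[k] M) (x : M) : quadraticChar M (φ x) = quadraticChar M x := by
  by_cases hx : x = 0
  · simp [hx]
  have hx' : φ x ≠ 0 := by simpa using hx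
  have key : IsSquare (φ x) ↔ IsSquare x := by
    constructor
    · rintro ⟨y, hy⟩
      exact ⟨φ.symm y, by rw [← map_mul, ← hy]; simp⟩
    · rintro ⟨y, hy⟩
      exact ⟨φ y, by rw [← map_mul, ← hy]⟩
  by_cases h : IsSquare x
  · rw [(quadraticChar_one_iff_isSquare hx).2 h, (quadraticChar_one_iff_isSquare hx').2 (key.2 h)]
  · rw [quadraticChar_neg_one_iff_not_isSquare.2 h,
      quadraticChar_neg_one_iff_not_isSquare.2 (fun h' => h (key.1 h'))]

open Classical in
lemma chi_mul_map (φ : M ≃ₐ[k] M) (x : M) (hx : x ≠ 0) : quadraticChar M (x * φ x) = 1 := by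
  rw [map_mul, chi_map, ← sq, quadraticChar_sq_one hx]

lemma mulS_comm (φ ι : M ≃ₐ[k] M) (B a : M) (z w : M × M) : mulS φ ι B a z w = mulS φ ι B a w z := by
  ext <;> simp only [mulS] <;> ring

lemma mulS_add (φ ι : M ≃ₐ[k] M) (B a : M) (x y z : M × M) :
    mulS φ ι B a (x + y) z = mulS φ ι B a x z + mulS φ ι B a y z := by
  ext <;> simp only [mulS, Prod.fst_add, Prod.snd_add, map_add] <;> ring

variable {φ ι : M ≃ₐ[k] M} {B : M}

open Classical in
lemma Good.B0 (h : Good φ ι B) : B ≠ 0 := by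
  rintro rfl
  have := h.nsq
  simp at this

open Classical in
lemma Good.chi_neg (h : Good φ ι B) : quadraticChar M (-1) = 1 :=
  h.sqfix _ (by simp) (by simp)

open Classical in
/-- An equation `v * φ ι u + (a/B) * ...` has only trivial solutions. -/
lemma Good.aux (h : Good φ ι B) {a : M} (ha : a ≠ 0) (hia : ι a = a) {u y : M} (hu : u ≠ 0)
    (e : φ (ι u) * y + a / B * (u * φ (ι y)) = 0) : y = 0 := by
  by_contra hy
  have hB := h.B0
  have e' : φ (ι u) * y * B = (-1) * a * (u * φ (ι y)) := by
    field_simp at e; linear_combination e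
  have := congrArg (quadraticChar M) e'
  simp only [map_mul, chi_map, h.nsq, h.chi_neg, h.sqfix a ha hia] at this
  rcases quadraticChar_dichotomy hu with h1 | h1 <;>
  rcases quadraticChar_dichotomy hy with h2 | h2 <;> simp [h1, h2] at this

open Classical in
theorem Good.nzd (h : Good φ ι B) {a : M} (ha : a ≠ 0) (hia : ι a = a) (z w : M × M)
    (e : mulS φ ι B a z w = 0) : z = 0 ∨ w = 0 := by
  have hB := h.B0
  obtain ⟨x, y⟩ := z
  obtain ⟨u, v⟩ := w
  have e1 := congrArg Prod.fst e
  have e2 := congrArg Prod.snd e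
  simp only [mulS, Prod.fst_zero, Prod.snd_zero] at e1 e2
  have key : ∀ {b c : M}, c ≠ 0 → φ b * c + b * φ c = 0 → b = 0 := by
    intro b c hc hbc
    have hc' : φ c ≠ 0 := by simpa using hc
    have : b / c = 0 := h.neg _ (by rw [map_div₀]; field_simp; linear_combination hbc)
    simpa [hc] using this
  by_cases hv : v = 0
  · by_cases hu : u = 0
    · right; simp [hu, hv]
    left
    subst hv
    have hy0 : x = 0 := key hu (by simpa using e1)
    subst hy0
    have : y = 0 := h.aux ha hia hu (by simpa using e2)
    simp [this]
  by_cases hu : u = 0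
  · left
    subst hu
    have hy0 : y = 0 := key hv (by simpa [hB] using e1)
    subst hy0
    have e2' : φ (ι x) * v + a / B * (x * φ (ι v)) = 0 := by simpa using e2
    have : x = 0 := by
      by_contra hx
      exact hv (h.aux ha hia hx e2')
    simp [this]
  left
  obtain ⟨s, rfl⟩ : ∃ s, x = u * s := ⟨x / u, by field_simp⟩
  obtain ⟨t, rfl⟩ : ∃ t, y = v * t := ⟨y / v, by field_simp⟩
  have hu' : φ u ≠ 0 := by simpa using hu
  have hv' : φ v ≠ 0 := by simpa using hv
  have hiu' : φ (ι u) ≠ 0 := by simpa using hu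
  have hiv' : φ (ι v) ≠ 0 := by simpa using hv
  simp only [map_mul] at e1 e2
  set X1 := φ s + s with hX1
  set X2 := φ t + t with hX2
  have E1 : u * φ u * X1 = (-1) * B * (v * φ v) * X2 := by
    rw [hX1, hX2]; linear_combination e1
  by_cases hX20 : X2 = 0
  · have ht : t = 0 := h.neg _ (by linear_combination hX20)
    have : X1 = 0 := by simpa [hX20, hu, hu'] using E1
    have hs : s = 0 := h.neg _ (by linear_combination this)
    simp [hs, ht]
  exfalso
  have hX10 : X1 ≠ 0 := by
    intro h0
    rw [h0] at E1
    simp [hB, hv, hv', hX20] at E1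
  have hchi : quadraticChar M X1 = - quadraticChar M X2 := by
    have := congrArg (quadraticChar M) E1
    have g1 := chi_mul_map φ u hu
    have g2 := chi_mul_map φ v hv
    rw [map_mul] at g1 g2
    simp only [map_mul] at this
    rw [g1, g2, h.nsq, h.chi_neg] at this
    linarith
  have hX1sq := quadraticChar_sq_one hX10
  have hne : quadraticChar M X1 ≠ quadraticChar M X2 := by
    intro h1
    rw [h1] at hchi
    have : quadraticChar M X2 = 0 := by linarith
    rw [h1, this] at hX1sq
    norm_num at hX1sq
  set S := φ (ι s) + t with hS
  set R := s + φ (ι t) with hR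
  have E2 : φ (ι u) * v * S * B = - (a * u * φ (ι v) * R) := by
    rw [hS, hR]
    field_simp at e2
    linear_combination e2
  by_cases hR0 : R = 0
  · have hS0 : S = 0 := by simpa [hR0, hiu', hv, hB] using E2
    have hs1 : s = - φ (ι t) := by linear_combination hR0
    have ht1 : t = - φ (ι s) := by linear_combination hS0
    have h2 : φ (φ s) = s := by
      conv_rhs => rw [hs1, ht1]
      simp [h.comm, h.inv]
    have h3 := h.two s h2
    have : X2 = (-1) * ι X1 := by
      rw [hX2, hX1, ht1, h.comm, h3]
      simp [h.comm, h3]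
    apply hne
    rw [this, map_mul, h.chi_neg, chi_map, one_mul]
  have E3 : X1 * (φ u * φ (ι u)) * S = a * (φ v * φ (ι v)) * X2 * R := by
    have : u * v * B ≠ 0 := by simp [hu, hv, hB]
    apply mul_left_cancel₀ this
    linear_combination v * φ (ι u) * S * B * E1 - B * v * φ v * X2 * E2
  have E4 := congrArg ι E3
  simp only [map_mul, hia] at E4
  rw [← h.comm, ← h.comm, h.inv, ← h.comm, ← h.comm, h.inv] at E4
  have hS' : ι S = φ s + ι t := by rw [hS, map_add, ← h.comm, h.inv]
  have hR' : ι R = ι s + φ t := by rw [hR, map_add, ← h.comm, h.inv]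
  have E5 : X1 * S * (ι X2 * ι R) = X2 * R * (ι X1 * ι S) := by
    have : a * (φ u * φ (ι u)) * (φ v * φ (ι v)) ≠ 0 := by simp [*]
    apply mul_left_cancel₀ this
    linear_combination a * (φ v * φ (ι v)) * ι X2 * ι R * E3 - a * (φ v * φ (ι v)) * X2 * R * E4
  set X := X1 * ι X2 with hX
  set Y := (s - ι t) * φ (s - ι t) with hY
  have f1 : R * ι S = X + Y := by
    rw [hX, hY, hR, hS', hX1, hX2]
    simp only [map_add, map_sub, ← h.comm]
    ring
  have f2 : S * ι R = ι X + ι Y := by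
    rw [← map_add, ← f1, map_mul, h.inv]; ring
  have f3 : ι X = ι X1 * X2 := by rw [hX, map_mul, h.inv]
  have E6 : X * ι Y = ι X * Y := by
    have : X * (S * ι R) = ι X * (R * ι S) := by
      rw [f3, hX]; linear_combination E5
    rw [f1, f2] at this
    linear_combination this
  by_cases hst : s = ι t
  · apply hne
    rw [← chi_map ι X2]
    congr 1
    rw [hX1, hX2, hst, map_add, h.comm]
  have hst' : s - ι t ≠ 0 := sub_ne_zero.2 hst
  have hY0 : Y ≠ 0 := by
    rw [hY]; exact mul_ne_zero hst' ((map_ne_zero φ).2 hst')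
  have hX0 : X ≠ 0 := by
    rw [hX]; exact mul_ne_zero hX10 (by simpa using hX20)
  have hc1 : quadraticChar M Y = 1 := by rw [hY]; exact chi_mul_map _ _ hst'
  have hc2 := h.sqfix (X * ι Y) (mul_ne_zero hX0 (by simpa using hY0))
    (by rw [map_mul, h.inv, E6])
  rw [map_mul, chi_map, hc1, hX, map_mul, chi_map, hchi] at hc2
  have := quadraticChar_sq_one hX20
  nlinarith
end
section
variable {p : ℕ} [Fact p.Prime] {M : Type} [Field M] [Fintype M] [Algebra (ZMod p) M]

lemma ded (c : (M ≃ₐ[ZMod p] M) → M) (h : ∀ x, ∑ g, c g * g x = 0) (g : M ≃ₐ[ZMod p] M) : c g = 0 := by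
  have h1 := linearIndependent_monoidHom M M
  have h2 : LinearIndependent M (fun g : M ≃ₐ[ZMod p] M => ((g : M →* M) : M → M)) := by
    refine h1.comp (fun g : M ≃ₐ[ZMod p] M => (g : M →* M)) ?_
    intro a b hab
    ext x
    exact DFunLike.congr_fun hab x
  rw [Fintype.linearIndependent_iff] at h2
  refine h2 c ?_ g
  ext x
  simpa using h x

lemma exists_coeff (n : M →+ M) : ∃ ν : (M ≃ₐ[ZMod p] M) → M, ∀ x, n x = ∑ g, ν g * g x := by
  have hli : LinearIndependent M
      (fun g : M ≃ₐ[ZMod p] M => (g.toLinearMap : M →ₗ[ZMod p] M)) := by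
    rw [Fintype.linearIndependent_iff]
    intro c hc g
    refine ded c (fun x => ?_) g
    have := LinearMap.congr_fun hc x
    simpa using this
  have hcard : Fintype.card (M ≃ₐ[ZMod p] M) = Module.finrank M (M →ₗ[ZMod p] M) := by
    rw [Module.finrank_linearMap_self, ← Nat.card_eq_fintype_card, IsGalois.card_aut_eq_finrank]
  have htop := hli.span_eq_top_of_card_eq_finrank' hcard
  have hmem : n.toZModLinearMap p ∈ Submodule.span M
      (Set.range (fun g : M ≃ₐ[ZMod p] M => (g.toLinearMap : M →ₗ[ZMod p] M))) := by
    rw [htop]; trivial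
  rw [Submodule.mem_span_range_iff_exists_fun] at hmem
  obtain ⟨c, hc⟩ := hmem
  refine ⟨c, fun x => ?_⟩
  have := LinearMap.congr_fun hc x
  simpa using this.symm

open Classical in
lemma key_aux (n : M →+ M) (ν : (M ≃ₐ[ZMod p] M) → M) (hn : ∀ x, n x = ∑ g, ν g * g x)
    (α β : M ≃ₐ[ZMod p] M) (c c' s t : M) (hβ1 : β ≠ 1) (hβ : β ≠ α⁻¹)
    (H : ∀ x u, n (c * (α x * u) + c' * (x * α u)) = s * (β x * u) + t * (x * β u)) :
    t = if β = α then ν 1 * c' else 0 := by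
  have h1 : ∀ u, ν α⁻¹ * α⁻¹ (c * u) + ν 1 * c' * α u - t * β u = 0 := by
    intro u
    have := ded (fun h : M ≃ₐ[ZMod p] M => ν (h * α⁻¹) * (h * α⁻¹) (c * u) + ν h * h (c' * α u)
      - (if h = β then s * u else 0) - (if h = 1 then t * β u else 0)) ?_ 1
    · simp only [one_mul, if_neg hβ1.symm, if_true] at this
      simp only [AlgEquiv.one_apply] at this
      linear_combination this
    · intro x
      have e := H x u
      rw [hn] at e
      simp only [sub_mul, add_mul, Finset.sum_sub_distrib, Finset.sum_add_distrib, ite_mul, zero_mul,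
        Finset.sum_ite_eq', Finset.mem_univ, if_true]
      have e2 : ∑ h : M ≃ₐ[ZMod p] M, ν (h * α⁻¹) * (h * α⁻¹) (c * u) * h x
          = ∑ g : M ≃ₐ[ZMod p] M, ν g * g (c * u) * (g * α) x := by
        refine Fintype.sum_equiv (Equiv.mulRight α⁻¹) _ _ ?_
        intro h
        simp
      rw [e2]
      have e3 : ∑ g : M ≃ₐ[ZMod p] M, ν g * g (c * (α x * u) + c' * (x * α u)) =
          ∑ g : M ≃ₐ[ZMod p] M, ν g * g (c * u) * (g * α) x
          + ∑ g : M ≃ₐ[ZMod p] M, ν g * g (c' * α u) * g x := by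
        rw [← Finset.sum_add_distrib]
        refine Finset.sum_congr rfl fun g _ => ?_
        simp only [map_add, map_mul, AlgEquiv.mul_apply]
        ring
      rw [e3] at e
      simp only [AlgEquiv.one_apply]
      linear_combination e
  have := ded (fun h : M ≃ₐ[ZMod p] M => (if h = α⁻¹ then ν α⁻¹ * α⁻¹ c else 0)
    + (if h = α then ν 1 * c' else 0) - (if h = β then t else 0)) ?_ β
  · simp only [if_neg hβ, if_true] at this
    linear_combination -this
  · intro x
    simp only [sub_mul, add_mul, Finset.sum_sub_distrib, Finset.sum_add_distrib, ite_mul, zero_mul,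
        Finset.sum_ite_eq', Finset.mem_univ, if_true]
    have := h1 x
    rw [map_mul] at this
    linear_combination this

open Classical in
lemma key (n : M →+ M) (ν : (M ≃ₐ[ZMod p] M) → M) (hn : ∀ x, n x = ∑ g, ν g * g x)
    (α β : M ≃ₐ[ZMod p] M) (c c' s t : M) (hβ1 : β ≠ 1) (hβ : β ≠ α⁻¹)
    (H : ∀ x u, n (c * (α x * u) + c' * (x * α u)) = s * (β x * u) + t * (x * β u)) :
    s = (if β = α then ν 1 * c else 0) ∧ t = if β = α then ν 1 * c' else 0 := by
  refine ⟨?_, key_aux n ν hn α β c c' s t hβ1 hβ H⟩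
  refine key_aux n ν hn α β c' c t s hβ1 hβ ?_
  intro x u
  have := H u x
  rw [add_comm, mul_comm (α x), mul_comm x, this]
  ring
end
section
variable {p : ℕ} [Fact p.Prime] {M : Type} [Field M] [Fintype M] [Algebra (ZMod p) M]

/-- The matrix acting on pairs. -/
def act (A : Matrix (Fin 2) (Fin 2) M) (z : M × M) : M × M :=
  (A 0 0 * z.1 + A 0 1 * z.2, A 1 0 * z.1 + A 1 1 * z.2)

/-- The hypotheses on two automorphisms that make monomials distinct. -/
structure Sep (φ₁ φ₂ ι : M ≃ₐ[ZMod p] M) : Prop where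
  h1 : φ₂ ≠ 1
  h2 : φ₂ ≠ φ₁⁻¹
  h3 : φ₂ * ι ≠ 1
  h4 : φ₂ ≠ φ₁ * ι
  h5 : φ₂ ≠ (φ₁ * ι)⁻¹
  h6 : φ₂ * ι ≠ φ₁
  h7 : φ₂ * ι ≠ φ₁⁻¹
  h8 : φ₂ * ι ≠ (φ₁ * ι)⁻¹

/-- The relations satisfied by a linear isotopism. -/
structure LinRel (φ ι : M ≃ₐ[ZMod p] M) (B₁ a₁ B₂ a₂ : M) (A C : Matrix (Fin 2) (Fin 2) M)
    (α β : M) : Prop where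
  r1 : (A.transpose.map φ) * !![1, 0; 0, B₂] * C = α • !![1, 0; 0, B₁]
  r2 : A.transpose * !![1, 0; 0, B₂] * (C.map φ) = α • !![1, 0; 0, B₁]
  r3 : (A.transpose.map (φ * ι)) * !![0, 1; a₂ / B₂, 0] * C = β • !![0, 1; a₁ / B₁, 0]
  r4 : A.transpose * !![0, a₂ / B₂; 1, 0] * (C.map (φ * ι)) = β • !![0, a₁ / B₁; 1, 0]

open Classical in
lemma lin_entries (φ₁ φ₂ ι : M ≃ₐ[ZMod p] M) (hs : Sep φ₁ φ₂ ι) (B₁ a₁ B₂ a₂ : M)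
    (A C : Matrix (Fin 2) (Fin 2) M) (N : M × M →+ M × M)
    (H : ∀ z w, N (mulS φ₁ ι B₁ a₁ z w) = mulS φ₂ ι B₂ a₂ (act A z) (act C w)) :
    (φ₁ ≠ φ₂ → mulS φ₂ ι B₂ a₂ (A 0 0, A 1 0) (C 0 0, C 1 0) = 0) ∧
    (φ₁ = φ₂ → ∃ α β, LinRel φ₂ ι B₁ a₁ B₂ a₂ A C α β) := by
  obtain ⟨h1, h2, h3, h4, h5, h6, h7, h8⟩ := hs
  let n11 : M →+ M := (AddMonoidHom.fst M M).comp (N.comp (AddMonoidHom.inl M M))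
  let n12 : M →+ M := (AddMonoidHom.fst M M).comp (N.comp (AddMonoidHom.inr M M))
  let n21 : M →+ M := (AddMonoidHom.snd M M).comp (N.comp (AddMonoidHom.inl M M))
  let n22 : M →+ M := (AddMonoidHom.snd M M).comp (N.comp (AddMonoidHom.inr M M))
  obtain ⟨ν11, hν11⟩ := exists_coeff (p := p) n11
  obtain ⟨ν12, hν12⟩ := exists_coeff (p := p) n12
  obtain ⟨ν21, hν21⟩ := exists_coeff (p := p) n21
  obtain ⟨ν22, hν22⟩ := exists_coeff (p := p) n22
  have xu1 := key n11 ν11 hν11 φ₁ φ₂ 1 1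
    (φ₂ (A 0 0) * C 0 0 + B₂ * (φ₂ (A 1 0) * C 1 0))
    (A 0 0 * φ₂ (C 0 0) + B₂ * (A 1 0 * φ₂ (C 1 0))) h1 h2 (by
      intro x u
      have := congrArg Prod.fst (H (x, 0) (u, 0))
      simp only [mulS, act, map_zero, mul_zero, zero_mul, add_zero, map_mul, map_add] at this
      simp only [n11, AddMonoidHom.comp_apply, AddMonoidHom.inl_apply, AddMonoidHom.coe_fst, one_mul]
      rw [this]; ring)
  have yv1 := key n11 ν11 hν11 φ₁ φ₂ B₁ B₁
    (φ₂ (A 0 1) * C 0 1 + B₂ * (φ₂ (A 1 1) * C 1 1))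
    (A 0 1 * φ₂ (C 0 1) + B₂ * (A 1 1 * φ₂ (C 1 1))) h1 h2 (by
      intro x u
      have := congrArg Prod.fst (H (0, x) (0, u))
      simp only [mulS, act, map_zero, mul_zero, zero_mul, add_zero, zero_add, map_mul, map_add] at this
      simp only [n11, AddMonoidHom.comp_apply, AddMonoidHom.inl_apply, AddMonoidHom.coe_fst]
      rw [← mul_add, this]; ring)
  have xv1 := key n12 ν12 hν12 (φ₁ * ι) φ₂ 1 (a₁ / B₁)
    (φ₂ (A 0 0) * C 0 1 + B₂ * (φ₂ (A 1 0) * C 1 1))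
    (A 0 0 * φ₂ (C 0 1) + B₂ * (A 1 0 * φ₂ (C 1 1))) h1 h5 (by
      intro x u
      have := congrArg Prod.fst (H (x, 0) (0, u))
      simp only [mulS, act, map_zero, mul_zero, zero_mul, add_zero, zero_add, map_mul, map_add] at this
      simp only [n12, AddMonoidHom.comp_apply, AddMonoidHom.inr_apply, AddMonoidHom.coe_fst,
        AlgEquiv.mul_apply, one_mul]
      rw [this]; ring)
  have yu1 := key n12 ν12 hν12 (φ₁ * ι) φ₂ (a₁ / B₁) 1
    (φ₂ (A 0 1) * C 0 0 + B₂ * (φ₂ (A 1 1) * C 1 0))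
    (A 0 1 * φ₂ (C 0 0) + B₂ * (A 1 1 * φ₂ (C 1 0))) h1 h5 (by
      intro x u
      have := congrArg Prod.fst (H (0, x) (u, 0))
      simp only [mulS, act, map_zero, mul_zero, zero_mul, add_zero, zero_add, map_mul, map_add] at this
      simp only [n12, AddMonoidHom.comp_apply, AddMonoidHom.inr_apply, AddMonoidHom.coe_fst,
        AlgEquiv.mul_apply, one_mul]
      rw [add_comm, mul_comm x, mul_comm ((φ₁ (ι x))), this]; ring)
  have xu2 := key n21 ν21 hν21 φ₁ (φ₂ * ι) 1 1
    (φ₂ (ι (A 0 0)) * C 1 0 + a₂ / B₂ * (φ₂ (ι (A 1 0)) * C 0 0))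
    (A 1 0 * φ₂ (ι (C 0 0)) + a₂ / B₂ * (A 0 0 * φ₂ (ι (C 1 0)))) h3 h7 (by
      intro x u
      have := congrArg Prod.snd (H (x, 0) (u, 0))
      simp only [mulS, act, map_zero, mul_zero, zero_mul, add_zero, map_mul, map_add] at this
      simp only [n21, AddMonoidHom.comp_apply, AddMonoidHom.inl_apply, AddMonoidHom.coe_snd, one_mul,
        AlgEquiv.mul_apply]
      rw [this]; ring)
  have yv2 := key n21 ν21 hν21 φ₁ (φ₂ * ι) B₁ B₁
    (φ₂ (ι (A 0 1)) * C 1 1 + a₂ / B₂ * (φ₂ (ι (A 1 1)) * C 0 1))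
    (A 1 1 * φ₂ (ι (C 0 1)) + a₂ / B₂ * (A 0 1 * φ₂ (ι (C 1 1)))) h3 h7 (by
      intro x u
      have := congrArg Prod.snd (H (0, x) (0, u))
      simp only [mulS, act, map_zero, mul_zero, zero_mul, add_zero, zero_add, map_mul, map_add] at this
      simp only [n21, AddMonoidHom.comp_apply, AddMonoidHom.inl_apply, AddMonoidHom.coe_snd,
        AlgEquiv.mul_apply]
      rw [← mul_add, this]; ring)
  have xv2 := key n22 ν22 hν22 (φ₁ * ι) (φ₂ * ι) 1 (a₁ / B₁)
    (φ₂ (ι (A 0 0)) * C 1 1 + a₂ / B₂ * (φ₂ (ι (A 1 0)) * C 0 1))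
    (A 1 0 * φ₂ (ι (C 0 1)) + a₂ / B₂ * (A 0 0 * φ₂ (ι (C 1 1)))) h3 h8 (by
      intro x u
      have := congrArg Prod.snd (H (x, 0) (0, u))
      simp only [mulS, act, map_zero, mul_zero, zero_mul, add_zero, zero_add, map_mul, map_add] at this
      simp only [n22, AddMonoidHom.comp_apply, AddMonoidHom.inr_apply, AddMonoidHom.coe_snd,
        AlgEquiv.mul_apply, one_mul]
      rw [this]; ring)
  have yu2 := key n22 ν22 hν22 (φ₁ * ι) (φ₂ * ι) (a₁ / B₁) 1
    (φ₂ (ι (A 0 1)) * C 1 0 + a₂ / B₂ * (φ₂ (ι (A 1 1)) * C 0 0))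
    (A 1 1 * φ₂ (ι (C 0 0)) + a₂ / B₂ * (A 0 1 * φ₂ (ι (C 1 0)))) h3 h8 (by
      intro x u
      have := congrArg Prod.snd (H (0, x) (u, 0))
      simp only [mulS, act, map_zero, mul_zero, zero_mul, add_zero, zero_add, map_mul, map_add] at this
      simp only [n22, AddMonoidHom.comp_apply, AddMonoidHom.inr_apply, AddMonoidHom.coe_snd,
        AlgEquiv.mul_apply, one_mul]
      rw [add_comm, mul_comm x, mul_comm ((φ₁ (ι x))), this]; ring)
  simp only [if_neg h4] at xv1 yu1
  simp only [if_neg h6] at xu2 yv2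
  constructor
  · intro hne
    simp only [if_neg hne.symm] at xu1
    ext
    · simp only [mulS, Prod.fst_zero]
      linear_combination xu1.1 + xu1.2
    · simp only [mulS, Prod.snd_zero]
      linear_combination xu2.1 + xu2.2
  · rintro rfl
    simp only [if_true] at xu1 yv1 xv2 yu2
    refine ⟨ν11 1, ν22 1, ?_, ?_, ?_, ?_⟩
    · ext i j
      fin_cases i <;> fin_cases j <;> simp [Matrix.mul_apply, Fin.sum_univ_two]
      · linear_combination xu1.1
      · linear_combination xv1.1
      · linear_combination yu1.1
      · linear_combination yv1.1
    · ext i j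
      fin_cases i <;> fin_cases j <;> simp [Matrix.mul_apply, Fin.sum_univ_two]
      · linear_combination xu1.2
      · linear_combination xv1.2
      · linear_combination yu1.2
      · linear_combination yv1.2
    · ext i j
      fin_cases i <;> fin_cases j <;> simp [Matrix.mul_apply, Fin.sum_univ_two]
      · linear_combination xu2.1
      · linear_combination xv2.1
      · linear_combination yu2.1
      · linear_combination yv2.1
    · ext i j
      fin_cases i <;> fin_cases j <;> simp [Matrix.mul_apply, Fin.sum_univ_two]
      · linear_combination xu2.2
      · linear_combination xv2.2
      · linear_combination yu2.2
      · linear_combination yv2.2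

lemma comm_scalar (W Q : Matrix (Fin 2) (Fin 2) M) (a : M) (ha : a ≠ 0) (h : W * Q = a • 1) :
    Q * W = a • 1 := by
  have h1 : (a⁻¹ • W) * Q = 1 := by rw [Matrix.smul_mul, h, smul_smul, inv_mul_cancel₀ ha, one_smul]
  have h2 := mul_eq_one_comm.1 h1
  rw [Matrix.mul_smul] at h2
  rw [← h2, smul_smul, mul_inv_cancel₀ ha, one_smul]

variable {φ ι : M ≃ₐ[ZMod p] M} {B₁ a₁ B₂ a₂ : M} {A C : Matrix (Fin 2) (Fin 2) M} {α β : M}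

lemma map_map_aut (g h : M ≃ₐ[ZMod p] M) (X : Matrix (Fin 2) (Fin 2) M) :
    (X.map h).map g = X.map (g * h) := by
  ext; simp

lemma map_mul_aut (g : M ≃ₐ[ZMod p] M) (X Y : Matrix (Fin 2) (Fin 2) M) :
    (X * Y).map g = X.map g * Y.map g := by
  ext; simp [Matrix.mul_apply]

lemma diag_mul (b : M) (hb : b ≠ 0) : !![1, 0; 0, b⁻¹] * !![1, 0; 0, b] = (1 : Matrix (Fin 2) (Fin 2) M) := by
  ext i j
  fin_cases i <;> fin_cases j <;> simp [Matrix.mul_apply, Fin.sum_univ_two, hb]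

lemma diag_mul' (b : M) (hb : b ≠ 0) : !![1, 0; 0, b] * !![1, 0; 0, b⁻¹] = (1 : Matrix (Fin 2) (Fin 2) M) := by
  ext i j
  fin_cases i <;> fin_cases j <;> simp [Matrix.mul_apply, Fin.sum_univ_two, hb]

lemma diag_map (g : M ≃ₐ[ZMod p] M) (b : M) : (!![1, 0; 0, b]).map g = !![1, 0; 0, g b] := by
  ext i j
  fin_cases i <;> fin_cases j <;> simp

lemma smul_map (g : M ≃ₐ[ZMod p] M) (b : M) (X : Matrix (Fin 2) (Fin 2) M) :
    (b • X).map g = g b • X.map g := by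
  ext i j
  simp

lemma LinRel.eqC (h : LinRel φ ι B₁ a₁ B₂ a₂ A C α β) (hα : α ≠ 0) (hB₁ : B₁ ≠ 0)
    (f1 : φ B₁ = B₁) (f2 : φ B₂ = B₂) :
    α • C.map (φ * φ) = φ α • C := by
  have e1 : (!![1, 0; 0, B₁⁻¹] * ((A.transpose.map φ) * !![1, 0; 0, B₂])) * C = α • 1 := by
    rw [Matrix.mul_assoc, h.r1, Matrix.mul_smul, diag_mul _ hB₁]
  have e2 : (!![1, 0; 0, B₁⁻¹] * ((A.transpose.map φ) * !![1, 0; 0, B₂])) * C.map (φ * φ) = φ α • 1 := by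
    have := congrArg (fun X => X.map φ) h.r2
    simp only [map_mul_aut, smul_map, diag_map, f1, f2, map_map_aut] at this
    rw [Matrix.mul_assoc, this, Matrix.mul_smul, diag_mul _ hB₁]
  have e3 := comm_scalar _ _ _ hα e1
  calc α • C.map (φ * φ) = (α • 1) * C.map (φ * φ) := by simp
    _ = C * (φ α • 1) := by rw [← e3, Matrix.mul_assoc, e2]
    _ = φ α • C := by simp

lemma LinRel.eqA (h : LinRel φ ι B₁ a₁ B₂ a₂ A C α β) (hα : α ≠ 0) (hB₁ : B₁ ≠ 0) (hB₂ : B₂ ≠ 0)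
    (f1 : φ B₁ = B₁) (f2 : φ B₂ = B₂) :
    α • A.transpose.map (φ * φ) = φ α • A.transpose := by
  have e1 : (!![1, 0; 0, B₁⁻¹] * ((A.transpose) * !![1, 0; 0, B₂])) * C.map φ = α • 1 := by
    rw [Matrix.mul_assoc, h.r2, Matrix.mul_smul, diag_mul _ hB₁]
  have e2 : A.transpose.map (φ * φ) * !![1, 0; 0, B₂] * C.map φ = φ α • !![1, 0; 0, B₁] := by
    have := congrArg (fun X => X.map φ) h.r1
    simpa only [map_mul_aut, smul_map, diag_map, f1, f2, map_map_aut] using this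
  have e3 := comm_scalar _ _ _ hα e1
  have e4 : α • A.transpose.map (φ * φ) * !![1, 0; 0, B₂] = φ α • A.transpose * !![1, 0; 0, B₂] := by
    calc α • A.transpose.map (φ * φ) * !![1, 0; 0, B₂]
        = A.transpose.map (φ * φ) * !![1, 0; 0, B₂] * (α • 1) := by simp
      _ = φ α • !![1, 0; 0, B₁] * (!![1, 0; 0, B₁⁻¹] * ((A.transpose) * !![1, 0; 0, B₂])) := by
          rw [← e3, ← Matrix.mul_assoc, e2]
      _ = φ α • A.transpose * !![1, 0; 0, B₂] := by
          rw [← Matrix.mul_assoc, Matrix.smul_mul, diag_mul' _ hB₁]; simp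
  calc α • A.transpose.map (φ * φ)
      = α • A.transpose.map (φ * φ) * !![1, 0; 0, B₂] * !![1, 0; 0, B₂⁻¹] := by
        rw [Matrix.mul_assoc, diag_mul' _ hB₂, Matrix.mul_one]
    _ = φ α • A.transpose := by
        rw [e4, Matrix.mul_assoc, diag_mul' _ hB₂, Matrix.mul_one]

lemma LinRel.eq3 (h : LinRel φ ι B₁ a₁ B₂ a₂ A C α β) (hα : α ≠ 0) (hB₁ : B₁ ≠ 0) (hc : ι * φ = φ * ι) :
    ι α • (A.transpose * !![0, a₂ / B₂; 1, 0]) =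
      β • (!![0, a₁ / B₁ / ι B₁; 1, 0] * (A.transpose.map ι * !![1, 0; 0, ι B₂])) := by
  have e1 : (!![1, 0; 0, (ι B₁)⁻¹] * (A.transpose.map ι * !![1, 0; 0, ι B₂])) * C.map (φ * ι) = ι α • 1 := by
    have := congrArg (fun X => X.map ι) h.r2
    simp only [map_mul_aut, smul_map, diag_map, map_map_aut, hc] at this
    rw [Matrix.mul_assoc, this, Matrix.mul_smul, diag_mul _ (by simpa using hB₁)]
  have e3 := comm_scalar _ _ _ (by simpa using hα) e1
  calc ι α • (A.transpose * !![0, a₂ / B₂; 1, 0]) = A.transpose * !![0, a₂ / B₂; 1, 0] * (ι α • 1) := by simp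
    _ = β • (!![0, a₁ / B₁; 1, 0] * !![1, 0; 0, (ι B₁)⁻¹] * (A.transpose.map ι * !![1, 0; 0, ι B₂])) := by
        rw [← e3, ← Matrix.mul_assoc, h.r4, Matrix.smul_mul, Matrix.mul_assoc]
    _ = _ := by
        congr 2
        ext i j
        fin_cases i <;> fin_cases j <;> simp [Matrix.mul_apply, Fin.sum_univ_two, div_eq_mul_inv]

lemma LinRel.eq2 (h : LinRel φ ι B₁ a₁ B₂ a₂ A C α β) (hα : α ≠ 0) (hB₁ : B₁ ≠ 0) :
    α • (A.transpose.map (φ * ι) * !![0, 1; a₂ / B₂, 0]) =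
      β • (!![0, 1 / B₁; a₁ / B₁, 0] * (A.transpose.map φ * !![1, 0; 0, B₂])) := by
  have e1 : (!![1, 0; 0, (B₁)⁻¹] * (A.transpose.map φ * !![1, 0; 0, B₂])) * C = α • 1 := by
    rw [Matrix.mul_assoc, h.r1, Matrix.mul_smul, diag_mul _ hB₁]
  have e3 := comm_scalar _ _ _ hα e1
  calc α • (A.transpose.map (φ * ι) * !![0, 1; a₂ / B₂, 0])
      = A.transpose.map (φ * ι) * !![0, 1; a₂ / B₂, 0] * (α • 1) := by simp
    _ = β • (!![0, 1; a₁ / B₁, 0] * !![1, 0; 0, B₁⁻¹] * (A.transpose.map φ * !![1, 0; 0, B₂])) := by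
        rw [← e3, ← Matrix.mul_assoc, h.r3, Matrix.smul_mul, Matrix.mul_assoc]
    _ = _ := by
        congr 2
        ext i j
        fin_cases i <;> fin_cases j <;> simp [Matrix.mul_apply, Fin.sum_univ_two, div_eq_mul_inv]
end
section
variable {p : ℕ} [Fact p.Prime] {M : Type} [Field M] [Fintype M] [Algebra (ZMod p) M]
variable {φ ι : M ≃ₐ[ZMod p] M} {B₁ a₁ B₂ a₂ : M} {A C : Matrix (Fin 2) (Fin 2) M} {α β : M}

lemma Good.sq_of (g : Good φ ι B₁) {e c : M} (hc : c ≠ 0) (hφ : φ c = c) (h : e * φ e = c) :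
    e ^ 2 = c := by
  have he : φ e ≠ 0 := by
    rintro h0; apply hc; rw [← h, h0, mul_zero]
  have h1 := congrArg φ h
  rw [map_mul, hφ, ← h, mul_comm e] at h1
  have := g.two e (mul_left_cancel₀ he h1)
  rw [this] at h
  rw [sq, h]

theorem LinRel.final (h : LinRel φ ι B₁ a₁ B₂ a₂ A C α β) (g₁ : Good φ ι B₁) (g₂ : Good φ ι B₂)
    (ha₁ : a₁ ≠ 0) (hi₁ : ι a₁ = a₁) (ha₂ : a₂ ≠ 0) (hi₂ : ι a₂ = a₂) (hα : α ≠ 0)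
    (hA : A 0 0 ≠ 0 ∨ A 1 0 ≠ 0) :
    a₂ ^ 2 * (B₁ * ι B₁) = a₁ ^ 2 * (B₂ * ι B₂) ∨
      (a₁ * a₂) ^ 2 = (B₁ * ι B₁) * (B₂ * ι B₂) := by
  have hB₁ := g₁.B0
  have hB₂ := g₂.B0
  have hiB₁ : ι B₁ ≠ 0 := by simpa using hB₁
  have hiB₂ : ι B₂ ≠ 0 := by simpa using hB₂
  have hiα : ι α ≠ 0 := by simpa using hα
  have e3 := h.eq3 hα hB₁ (by ext x; simp [g₁.comm])
  have e2 := h.eq2 hα hB₁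
  have x11 := congrFun (congrFun e3 0) 0
  have x12 := congrFun (congrFun e3 0) 1
  have x21 := congrFun (congrFun e3 1) 0
  have x22 := congrFun (congrFun e3 1) 1
  have z11 := congrFun (congrFun e2 0) 0
  have z12 := congrFun (congrFun e2 0) 1
  simp only [Matrix.smul_apply, Matrix.mul_apply, Fin.sum_univ_two, smul_eq_mul] at x11 x12 x21 x22 z11 z12
  simp at x11 x12 x21 x22 z11 z12
  clear e2 e3
  obtain ⟨κ, rfl⟩ : ∃ κ, β = κ * ι α := ⟨β / ι α, by field_simp⟩
  set y11 := A 0 0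
  set y12 := A 1 0
  set y21 := A 0 1
  set y22 := A 1 1
  have fN1 : φ (B₁ * ι B₁) = B₁ * ι B₁ := by rw [map_mul, g₁.comm, g₁.fixB]
  have fN2 : φ (B₂ * ι B₂) = B₂ * ι B₂ := by rw [map_mul, g₁.comm, g₂.fixB]
  have hN1 : B₁ * ι B₁ ≠ 0 := mul_ne_zero hB₁ hiB₁
  have hN2 : B₂ * ι B₂ ≠ 0 := mul_ne_zero hB₂ hiB₂
  have iN1 : ι (B₁ * ι B₁) = B₁ * ι B₁ := by rw [map_mul, g₁.inv, mul_comm]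
  have iN2 : ι (B₂ * ι B₂) = B₂ * ι B₂ := by rw [map_mul, g₁.inv, mul_comm]
  have ife : ι (φ κ) * φ κ = φ (κ * ι κ) := by rw [map_mul, g₁.comm, mul_comm]
  rcases hA with hy | hy
  · left
    have q1 : y22 = κ * ι y11 := by
      apply mul_left_cancel₀ hiα; linear_combination x21
    have q1' : ι y22 = ι κ * y11 := by rw [q1, map_mul, g₁.inv]
    have q2 : a₂ * (B₁ * ι B₁) = κ * ι κ * a₁ * (B₂ * ι B₂) := by
      rw [q1'] at x12
      field_simp at x12
      linear_combination x12
    have hφy : φ (ι y11) ≠ 0 := by simpa using hy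
    have q3 : α * B₁ = κ * ι α * φ κ * B₂ := by
      rw [q1, map_mul] at z12
      field_simp at z12
      linear_combination z12
    have q3' := congrArg ι q3
    simp only [map_mul, g₁.inv] at q3'
    have q4 : (B₁ * ι B₁) = (κ * ι κ) * φ (κ * ι κ) * (B₂ * ι B₂) := by
      rw [← ife]
      have : α * ι α ≠ 0 := mul_ne_zero hα hiα
      apply mul_left_cancel₀ this
      linear_combination ι α * ι B₁ * q3 + κ * ι α * φ κ * B₂ * q3'
    have q5 := g₁.sq_of (e := κ * ι κ) (c := (B₁ * ι B₁) / (B₂ * ι B₂)) (div_ne_zero hN1 hN2)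
      (by rw [map_div₀, fN1, fN2]) (by rw [q4]; field_simp)
    generalize κ * ι κ = e at *
    generalize B₁ * ι B₁ = N₁ at *
    generalize B₂ * ι B₂ = N₂ at *
    have q6 : e ^ 2 * N₂ = N₁ := by rw [q5]; field_simp
    apply mul_left_cancel₀ hN1
    linear_combination (a₂ * N₁ + e * a₁ * N₂) * q2 + a₁ ^ 2 * N₂ * q6
  · right
    have q1 : y12 * (B₁ * ι B₁) = κ * a₁ * ι y21 := by
      field_simp at x11
      linear_combination x11
    have q1' : ι y12 * (B₁ * ι B₁) = ι κ * a₁ * y21 := by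
      have := congrArg ι q1
      rw [map_mul, iN1] at this
      simpa [g₁.inv, hi₁] using this
    have q2 : y21 * a₂ = κ * ι y12 * (B₂ * ι B₂) := by
      field_simp at x22
      linear_combination x22
    have hκy : κ ≠ 0 ∧ ι y21 ≠ 0 := by
      constructor <;> · intro h0
                        rw [h0] at q1
                        simp [hy, hB₁] at q1
    have hκ := hκy.1
    have hy21 : y21 ≠ 0 := by simpa using hκy.2
    have hiκ : ι κ ≠ 0 := by simpa using hκ
    have q3 : a₂ * (B₁ * ι B₁) = κ * ι κ * a₁ * (B₂ * ι B₂) := by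
      apply mul_left_cancel₀ hy21
      linear_combination (B₁ * ι B₁) * q2 + κ * (B₂ * ι B₂) * q1'
    have q4 := congrArg φ q1'
    rw [map_mul, fN1, map_mul, map_mul] at q4
    have q5 : α * φ (ι y12) * a₂ * B₁ = κ * ι α * φ y21 * B₂ := by
      field_simp at z11
      linear_combination z11
    have hφy : φ (ι y12) ≠ 0 := by simpa using hy
    have q6 : α * a₂ * φ a₁ * φ (ι κ) * B₁ = κ * ι α * B₂ * (B₁ * ι B₁) := by
      apply mul_left_cancel₀ hφy
      linear_combination φ (ι κ) * φ a₁ * q5 - κ * ι α * B₂ * q4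
    have q6' := congrArg ι q6
    simp only [map_mul, g₁.inv, hi₂, ← g₁.comm, hi₁] at q6'
    have q7 : a₂ ^ 2 * φ a₁ ^ 2 * φ (κ * ι κ) = (κ * ι κ) * (B₁ * ι B₁) * (B₂ * ι B₂) := by
      have : α * ι α * (B₁ * ι B₁) ≠ 0 := mul_ne_zero (mul_ne_zero hα hiα) hN1
      apply mul_left_cancel₀ this
      rw [map_mul]
      linear_combination ι α * a₂ * φ a₁ * φ κ * ι B₁ * q6 + κ * ι α * B₂ * (B₁ * ι B₁) * q6'
    have q8 := congrArg φ q3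
    rw [map_mul, fN1, map_mul, map_mul _ _ a₁, fN2] at q8
    have he : κ * ι κ ≠ 0 := mul_ne_zero hκ hiκ
    have hφa₁ : φ a₁ ≠ 0 := by simpa using ha₁
    generalize κ * ι κ = e at *
    generalize B₁ * ι B₁ = N₁ at *
    generalize B₂ * ι B₂ = N₂ at *
    refine g₁.sq_of (mul_ne_zero hN1 hN2) (by rw [map_mul, fN1, fN2]) ?_
    rw [map_mul]
    have : N₁ * a₂ ≠ 0 := mul_ne_zero hN1 ha₂
    apply mul_left_cancel₀ this
    linear_combination a₁ * a₂ ^ 2 * φ a₁ * q8 + a₁ * N₂ * q7 - N₁ * N₂ * q3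
end
section
open Polynomial

lemma zs_root (p m q : ℕ) (hq : q.Prime) (hm : 0 < m)
    (h : (q : ℤ) ∣ (cyclotomic m ℤ).eval (p : ℤ)) :
    ∃ k m', m = q ^ k * m' ∧ ¬ q ∣ m' ∧ orderOf (p : ZMod q) = m' := by
  have := Fact.mk hq
  obtain ⟨k, m', h1, h2⟩ := Nat.exists_eq_pow_mul_and_not_dvd hm.ne' q hq.ne_one
  refine ⟨k, m', h2, h1, ?_⟩
  have : NeZero (m' : ZMod q) := ⟨by rwa [Ne, ZMod.natCast_eq_zero_iff]⟩
  have : (cyclotomic (q ^ k * m') (ZMod q)).IsRoot (p : ZMod q) := by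
    rw [← h2, IsRoot.def]
    have := (ZMod.intCast_zmod_eq_zero_iff_dvd _ q).2 h
    rw [← map_cyclotomic_int, eval_map]
    rw [← this]
    have h5 : ((p : ℕ) : ZMod q) = Int.castRingHom (ZMod q) (p : ℤ) := by simp
    rw [h5, eval₂_hom]
    rfl
  rw [isRoot_cyclotomic_prime_pow_mul_iff_of_charP] at this
  exact this.eq_orderOf.symm

lemma zs_sq (p m q : ℕ) (hq : q.Prime) (hp : Odd p) (hp3 : 3 ≤ p) (hm : 3 ≤ m) (hqm : q ∣ m)
    (h : (q : ℤ) ∣ (cyclotomic m ℤ).eval (p : ℤ)) :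
    ¬ ((q : ℤ) ^ 2 ∣ (cyclotomic m ℤ).eval (p : ℤ)) := by
  intro hsq
  have := Fact.mk hq
  obtain ⟨k, m', e1, e2, e3⟩ := zs_root p m q hq (by omega) h
  obtain ⟨d, hd⟩ := hqm
  have hm'd : m' ∣ d := by
    have : Nat.Coprime m' q := ((Nat.Prime.coprime_iff_not_dvd hq).2 e2).symm
    exact this.dvd_of_dvd_mul_left (by rw [← hd, e1]; exact Dvd.intro_left _ rfl)
  have hd0 : 0 < d := by rcases Nat.eq_zero_or_pos d with h0 | h0; · subst h0; omega
                         · exact h0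
  have hdlt : d < m := by rw [hd]; have := hq.two_le; nlinarith
  have hx : (q : ℤ) ∣ (p : ℤ) ^ d - 1 := by
    rw [← ZMod.intCast_zmod_eq_zero_iff_dvd]
    push_cast
    rw [sub_eq_zero, ← orderOf_dvd_iff_pow_eq_one, e3]
    exact hm'd
  set x : ℤ := (p : ℤ) ^ d with hxdef
  have hx1 : x - 1 ≠ 0 := by
    have : (1 : ℤ) < x := one_lt_pow₀ (by exact_mod_cast (by omega)) hd0.ne'
    omega
  have hdv : (cyclotomic m ℤ).eval (p : ℤ) ∣ ∑ i ∈ Finset.range q, x ^ i := by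
    have := X_pow_sub_one_mul_cyclotomic_dvd_X_pow_sub_one_of_dvd ℤ
      (Nat.mem_properDivisors.2 ⟨⟨q, by rw [hd, mul_comm]⟩, hdlt⟩)
    have := eval_dvd (x := (p : ℤ)) this
    simp only [eval_mul, eval_sub, eval_pow, eval_X, eval_one] at this
    apply (mul_dvd_mul_iff_left hx1).1
    rw [mul_comm _ (∑ i ∈ Finset.range q, x ^ i), geom_sum_mul, hxdef, ← pow_mul, mul_comm d, ← hd]
    exact this
  have hS := hsq.trans hdv
  rcases hq.eq_two_or_odd' with rfl | hodd
  · have hm1 : m' = 1 := by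
      rw [← e3, orderOf_eq_one_iff]
      exact (ZMod.natCast_eq_one_iff_odd).2 hp
    have : Even d := by
      subst hm1
      match k, e1 with
      | 0, e1 => omega
      | 1, e1 => omega
      | k + 2, e1 => exact ⟨2 ^ k, by rw [pow_add] at e1; omega⟩
    obtain ⟨r, hr⟩ := this
    have hpz : Odd ((p : ℤ) ^ r) := (by exact_mod_cast hp : Odd (p : ℤ)).pow
    obtain ⟨s, hs⟩ := hpz
    have : x = (2 * s + 1) ^ 2 := by rw [← hs, hxdef, hr, ← pow_mul]; congr 1; ring
    simp [Finset.sum_range_succ] at hS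
    obtain ⟨c, hc⟩ := hS
    rw [this] at hc
    ring_nf at hc
    omega
  · obtain ⟨b, hb⟩ := hx
    have h6 := odd_sq_dvd_geom_sum₂_sub (a := (1 : ℤ)) (b := b) hodd
    have : (1 : ℤ) + q * b = x := by rw [← hb]; ring
    simp only [this, one_pow, mul_one] at h6
    have h7 := (dvd_sub_right hS).1 h6
    have h8 : q ^ 2 ∣ q := by exact_mod_cast h7
    have := Nat.le_of_dvd hq.pos h8
    have := hq.two_le
    nlinarith

lemma zsig (p m : ℕ) (hp : p.Prime) (hp3 : 3 ≤ p) (hm : 3 ≤ m) :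
    ∃ z : ℕ, z.Prime ∧ m < z ∧ ∀ d, z ∣ p ^ d - 1 ↔ m ∣ d := by
  have hodd : Odd p := hp.odd_of_ne_two (by omega)
  set Φ := (cyclotomic m ℤ).eval (p : ℤ) with hΦ
  by_cases hex : ∃ q : ℕ, q.Prime ∧ (q : ℤ) ∣ Φ ∧ ¬ q ∣ m
  · obtain ⟨q, hq, h1, h2⟩ := hex
    have := Fact.mk hq
    obtain ⟨k, m', e1, e2, e3⟩ := zs_root p m q hq (by omega) h1
    have hk : k = 0 := by
      by_contra hk
      exact h2 (by rw [e1]; exact Dvd.dvd.mul_right (dvd_pow_self q hk) _)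
    have hmm : m = m' := by rw [e1, hk]; simp
    rw [← hmm] at e3
    have key : ∀ d, q ∣ p ^ d - 1 ↔ m ∣ d := by
      intro d
      have h1 : 1 ≤ p ^ d := Nat.one_le_pow _ _ hp.pos
      rw [← e3, orderOf_dvd_iff_pow_eq_one, ← ZMod.natCast_eq_zero_iff, Nat.cast_sub h1, sub_eq_zero]
      simp
    refine ⟨q, hq, ?_, key⟩
    have hp0 : (p : ZMod q) ≠ 0 := by
      intro h0
      rw [h0, orderOf_zero] at e3
      omega
    have h5 := ZMod.pow_card_sub_one_eq_one hp0
    rw [← orderOf_dvd_iff_pow_eq_one, e3] at h5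
    have := Nat.le_of_dvd (by have := hq.two_le; omega) h5
    have := hq.two_le
    omega
  · exfalso
    push Not at hex
    have hlow := sub_one_pow_totient_lt_natAbs_cyclotomic_eval (n := m) (q := p) (by omega) (by omega)
    rw [← hΦ] at hlow
    have hΦ1 : Φ.natAbs ≠ 1 := by
      intro h0
      have : 1 ≤ (p - 1) ^ m.totient := Nat.one_le_pow _ _ (by omega)
      omega
    have hΦ0 : Φ.natAbs ≠ 0 := by omega
    obtain ⟨q, hq, hqΦ⟩ := Nat.exists_prime_and_dvd hΦ1
    have hqm := hex q hq (Int.natCast_dvd.2 hqΦ)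
    have lt_aux : ∀ q₁ q₂ : ℕ, q₁.Prime → q₂.Prime → (q₁ : ℤ) ∣ Φ → q₂ ∣ m → q₁ ≠ q₂ → q₂ < q₁ := by
      intro q₁ q₂ h1 h2 h3 h4 hne
      have := Fact.mk h1
      obtain ⟨k, m', e1, e2, e3⟩ := zs_root p m q₁ h1 (by omega) h3
      have h6 : q₂ ∣ m' := by
        rw [e1] at h4
        rcases h2.dvd_mul.1 h4 with h | h
        · exact absurd ((Nat.prime_dvd_prime_iff_eq h2 h1).1 (h2.dvd_of_dvd_pow h)).symm hne
        · exact h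
      have hp0 : (p : ZMod q₁) ≠ 0 := by
        intro h0
        rw [h0, orderOf_zero] at e3
        rw [← e3] at e2
        simp at e2
      have h5 := ZMod.pow_card_sub_one_eq_one hp0
      rw [← orderOf_dvd_iff_pow_eq_one, e3] at h5
      have := Nat.le_of_dvd (by have := h1.two_le; omega) (h6.trans h5)
      have := h1.two_le
      omega
    have huniq : ∀ d : ℕ, d.Prime → d ∣ Φ.natAbs → d = q := by
      intro d hd hdd
      by_contra hne
      have hdm := hex d hd (Int.natCast_dvd.2 hdd)
      have := lt_aux d q hd hq (Int.natCast_dvd.2 hdd) hqm hne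
      have := lt_aux q d hq hd (Int.natCast_dvd.2 hqΦ) hdm (Ne.symm hne)
      omega
    have hpow := Nat.eq_prime_pow_of_unique_prime_dvd hΦ0 (fun {d} => huniq d)
    have hns := zs_sq p m q hq hodd hp3 hm hqm (Int.natCast_dvd.2 hqΦ)
    have hlen : Φ.natAbs.primeFactorsList.length ≤ 1 := by
      by_contra hl
      apply hns
      have : q ^ 2 ∣ Φ.natAbs := by
        rw [hpow]; exact pow_dvd_pow _ (by omega)
      exact_mod_cast Int.natCast_dvd.2 this
    have hle : Φ.natAbs ≤ q := by
      rw [hpow]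
      calc _ ≤ q ^ 1 := Nat.pow_le_pow_right hq.pos hlen
        _ = q := pow_one q
    have htot : q - 1 ≤ m.totient := by
      rw [← Nat.totient_prime hq]
      exact Nat.le_of_dvd (Nat.totient_pos.2 (by omega)) (Nat.totient_dvd_of_dvd hqm)
    have h2 : 2 ^ (q - 1) ≤ (p - 1) ^ m.totient :=
      (Nat.pow_le_pow_left (by omega) _).trans (Nat.pow_le_pow_right (by omega) htot)
    have h3 : q - 1 < 2 ^ (q - 1) := Nat.lt_two_pow_self
    omega
end
section
variable {p : ℕ} [Fact p.Prime] {M : Type} [Field M] [Fintype M] [Algebra (ZMod p) M]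

lemma LinRel.alpha_ne {φ ι : M ≃ₐ[ZMod p] M} {B₁ a₁ B₂ a₂ α β : M}
    {A C : Matrix (Fin 2) (Fin 2) M} (h : LinRel φ ι B₁ a₁ B₂ a₂ A C α β) (g₂ : Good φ ι B₂)
    (ha₂ : a₂ ≠ 0) (hi₂ : ι a₂ = a₂) (hA : (A 0 0, A 1 0) ≠ (0 : M × M))
    (hC : (C 0 0, C 1 0) ≠ (0 : M × M)) : α ≠ 0 := by
  rintro rfl
  have x1 := congrFun (congrFun h.r1 0) 0
  have x2 := congrFun (congrFun h.r2 0) 0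
  have x3 := congrFun (congrFun h.r3 0) 0
  have x4 := congrFun (congrFun h.r4 0) 0
  simp only [Matrix.smul_apply, Matrix.mul_apply, Fin.sum_univ_two, smul_eq_mul] at x1 x2 x3 x4
  simp at x1 x2 x3 x4
  have : mulS φ ι B₂ a₂ (A 0 0, A 1 0) (C 0 0, C 1 0) = 0 := by
    ext
    · simp only [mulS, Prod.fst_zero]
      linear_combination x1 + x2
    · simp only [mulS, Prod.snd_zero]
      linear_combination x3 + x4
  rcases g₂.nzd ha₂ hi₂ _ _ this with h | h
  · exact hA h
  · exact hC h

lemma act_col_ne (A : Matrix (Fin 2) (Fin 2) M) (hA : Function.Injective (act A)) :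
    (A 0 0, A 1 0) ≠ (0 : M × M) := by
  intro h
  have : act A (1, 0) = act A 0 := by
    simp only [act]
    simp at h
    simp [h]
  simpa using congrArg Prod.fst (hA this)

theorem lin_main {φ₁ φ₂ ι : M ≃ₐ[ZMod p] M} (hs : Sep φ₁ φ₂ ι) {B₁ a₁ B₂ a₂ : M}
    (g₂ : Good φ₂ ι B₂) (ha₂ : a₂ ≠ 0) (hi₂ : ι a₂ = a₂)
    {A C : Matrix (Fin 2) (Fin 2) M} (hA : Function.Injective (act A))
    (hC : Function.Injective (act C)) (N : M × M →+ M × M)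
    (H : ∀ z w, N (mulS φ₁ ι B₁ a₁ z w) = mulS φ₂ ι B₂ a₂ (act A z) (act C w)) :
    φ₁ = φ₂ ∧ ∃ α β, α ≠ 0 ∧ LinRel φ₂ ι B₁ a₁ B₂ a₂ A C α β := by
  obtain ⟨k1, k2⟩ := lin_entries φ₁ φ₂ ι hs B₁ a₁ B₂ a₂ A C N H
  have hA' := act_col_ne A hA
  have hC' := act_col_ne C hC
  have : φ₁ = φ₂ := by
    by_contra hne
    rcases g₂.nzd ha₂ hi₂ _ _ (k1 hne) with h | h
    · exact hA' h
    · exact hC' h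
  refine ⟨this, ?_⟩
  obtain ⟨α, β, h⟩ := k2 this
  exact ⟨α, β, h.alpha_ne g₂ ha₂ hi₂ hA' hC', h⟩

/-- Semilinear additive automorphisms. -/
def SemiL (L : M × M ≃+ M × M) (τ : M ≃ₐ[ZMod p] M) : Prop := ∀ (c : M) v, L (c • v) = τ c • L v

/-- The matrix of a semilinear map. -/
def matOf (L : M × M ≃+ M × M) : Matrix (Fin 2) (Fin 2) M :=
  !![(L (1, 0)).1, (L (0, 1)).1; (L (1, 0)).2, (L (0, 1)).2]

lemma act_matOf {L : M × M ≃+ M × M} {τ : M ≃ₐ[ZMod p] M} (h : SemiL L τ) (x : M × M) :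
    L x = act (matOf L) (τ x.1, τ x.2) := by
  have : x = x.1 • ((1, 0) : M × M) + x.2 • ((0, 1) : M × M) := by ext <;> simp
  conv_lhs => rw [this, map_add, h, h]
  ext <;> simp [act, matOf, mul_comm]

lemma act_matOf_inj {L : M × M ≃+ M × M} {τ : M ≃ₐ[ZMod p] M} (h : SemiL L τ) :
    Function.Injective (act (matOf L)) := by
  intro x y hxy
  have h1 := act_matOf h (τ.symm x.1, τ.symm x.2)
  have h2 := act_matOf h (τ.symm y.1, τ.symm y.2)
  simp only [AlgEquiv.apply_symm_apply] at h1 h2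
  rw [Prod.mk.eta] at h1 h2
  rw [hxy, ← h2] at h1
  have := L.injective h1
  simp at this
  ext
  · exact this.1
  · exact this.2

lemma gal_comm (σ τ : M ≃ₐ[ZMod p] M) (x : M) : σ (τ x) = τ (σ x) := by
  have : σ * τ = τ * σ := mul_comm' σ τ
  exact DFunLike.congr_fun this x

/-- Applying an automorphism to both coordinates. -/
def tau2 (τ : M ≃ₐ[ZMod p] M) : M × M →+ M × M :=
  AddMonoidHom.prodMap (τ : M →+ M) (τ : M →+ M)

lemma mulS_tau (φ ι τ : M ≃ₐ[ZMod p] M) (B a : M) (z w : M × M) :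
    mulS φ ι B a (τ z.1, τ z.2) (τ w.1, τ w.2) =
      tau2 τ (mulS φ ι (τ.symm B) (τ.symm a) z w) := by
  ext <;> simp [mulS, tau2, gal_comm τ]

theorem semi_lin {φ₁ φ₂ ι : M ≃ₐ[ZMod p] M} (hs : Sep φ₁ φ₂ ι) {B₁ a₁ B₂ a₂ : M}
    (g₂ : Good φ₂ ι B₂) (ha₂ : a₂ ≠ 0) (hi₂ : ι a₂ = a₂)
    {L K : M × M ≃+ M × M} {τ : M ≃ₐ[ZMod p] M} (hL : SemiL L τ) (hK : SemiL K τ)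
    (N : M × M →+ M × M)
    (H : ∀ z w, N (mulS φ₁ ι B₁ a₁ z w) = mulS φ₂ ι B₂ a₂ (L z) (K w)) :
    φ₁ = φ₂ ∧ ∃ α β, α ≠ 0 ∧ LinRel φ₂ ι (τ B₁) (τ a₁) B₂ a₂ (matOf L) (matOf K) α β := by
  refine lin_main hs g₂ ha₂ hi₂ (act_matOf_inj hL) (act_matOf_inj hK) (N.comp (tau2 τ.symm)) ?_
  intro z w
  have h := H (τ.symm z.1, τ.symm z.2) (τ.symm w.1, τ.symm w.2)
  rw [act_matOf hL, act_matOf hK, mulS_tau] at h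
  simpa using h

theorem semi_main {φ₁ φ₂ ι : M ≃ₐ[ZMod p] M} (hs : Sep φ₁ φ₂ ι) {B₁ a₁ B₂ a₂ : M}
    {L K : M × M ≃+ M × M} {τ : M ≃ₐ[ZMod p] M} (g₁ : Good φ₁ ι (τ B₁))
    (g₂ : Good φ₂ ι B₂) (ha₁ : a₁ ≠ 0) (hi₁ : ι a₁ = a₁) (ha₂ : a₂ ≠ 0) (hi₂ : ι a₂ = a₂)
    (hL : SemiL L τ) (hK : SemiL K τ) (N : M × M →+ M × M)
    (H : ∀ z w, N (mulS φ₁ ι B₁ a₁ z w) = mulS φ₂ ι B₂ a₂ (L z) (K w)) :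
    φ₁ = φ₂ ∧ (a₂ ^ 2 * (τ B₁ * ι (τ B₁)) = τ a₁ ^ 2 * (B₂ * ι B₂) ∨
      (τ a₁ * a₂) ^ 2 = (τ B₁ * ι (τ B₁)) * (B₂ * ι B₂)) := by
  obtain ⟨rfl, α, β, hα, h⟩ := semi_lin hs g₂ ha₂ hi₂ hL hK N H
  refine ⟨rfl, h.final g₁ g₂ (by simpa using ha₁) (by rw [gal_comm, hi₁]) ha₂ hi₂ hα ?_⟩
  have := act_col_ne _ (act_matOf_inj hL)
  by_contra hc
  push Not at hc
  exact this (by rw [hc.1, hc.2]; rfl)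
end
section
variable {p : ℕ} [Fact p.Prime] {M : Type} [Field M] [Fintype M] [Algebra (ZMod p) M]

/-- Scalars that are transported by a pair of additive maps. -/
def transField (L K : M × M ≃+ M × M) : Subfield M where
  carrier := {c | ∃ c' : M, ∀ v, L (c • v) = c' • L v ∧ K (c • v) = c' • K v}
  mul_mem' := by
    rintro a b ⟨a', ha⟩ ⟨b', hb⟩
    refine ⟨a' * b', fun v => ?_⟩
    rw [mul_smul, mul_smul, mul_smul, (ha _).1, (hb _).1, (ha _).2, (hb _).2]
    exact ⟨rfl, rfl⟩
  one_mem' := ⟨1, fun v => by simp⟩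
  add_mem' := by
    rintro a b ⟨a', ha⟩ ⟨b', hb⟩
    refine ⟨a' + b', fun v => ?_⟩
    rw [add_smul, add_smul, add_smul, map_add, map_add, (ha _).1, (hb _).1, (ha _).2, (hb _).2]
    exact ⟨rfl, rfl⟩
  zero_mem' := ⟨0, fun v => by simp⟩
  neg_mem' := by
    rintro a ⟨a', ha⟩
    refine ⟨-a', fun v => ?_⟩
    rw [neg_smul, neg_smul, neg_smul, map_neg, map_neg, (ha _).1, (ha _).2]
    exact ⟨rfl, rfl⟩
  inv_mem' := by
    rintro a ⟨a', ha⟩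
    by_cases h0 : a = 0
    · refine ⟨0, fun v => by simp [h0]⟩
    have h0' : a' ≠ 0 := by
      rintro rfl
      have := (ha (1, 0)).1
      simp [h0] at this
    refine ⟨a'⁻¹, fun v => ?_⟩
    have h1 := ha (a⁻¹ • v)
    rw [smul_smul, mul_inv_cancel₀ h0, one_smul] at h1
    rw [h1.1, h1.2, smul_smul, smul_smul, inv_mul_cancel₀ h0', one_smul, one_smul]
    exact ⟨rfl, rfl⟩

lemma charP_M : CharP M p := (Algebra.charP_iff (ZMod p) M p).1 inferInstance

lemma transField_top {m z : ℕ} (hm : 0 < m) (hcard : Fintype.card M = p ^ m)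
    (hz : ∀ d, z ∣ p ^ d - 1 → m ∣ d) {ζ : M} (hz0 : ζ ≠ 0) (hζ : orderOf ζ = z) (R : Subfield M) (h : ζ ∈ R) :
    R = ⊤ := by
  have := charP_M (p := p) (M := M)
  classical
  have : CharP R p := (Algebra.charP_iff R M p).2 inferInstance
  obtain ⟨d, hp, hd⟩ := FiniteField.card R p
  have h1 : ζ ^ (p ^ (d : ℕ) - 1) = 1 := by
    have := FiniteField.pow_card_sub_one_eq_one (⟨ζ, h⟩ : R) (by simpa [Subtype.ext_iff] using hz0)
    rw [hd] at this
    simpa [Subtype.ext_iff] using this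
  have h2 := hz _ (by rw [← hζ]; exact orderOf_dvd_of_pow_eq_one h1)
  have h3 : p ^ m ≤ p ^ (d : ℕ) := Nat.pow_le_pow_right hp.pos (Nat.le_of_dvd d.pos h2)
  rw [← hd, ← hcard] at h3
  apply SetLike.coe_injective
  apply Set.eq_of_subset_of_ncard_le (Set.subset_univ _) _ (Set.toFinite _)
  change Set.univ.ncard ≤ _
  rw [Set.ncard_univ, Nat.card_eq_fintype_card, Set.ncard_eq_toFinset_card', Set.toFinset_card]
  convert h3
  rfl

lemma exists_tau {m z : ℕ} (hm : 0 < m) (hcard : Fintype.card M = p ^ m)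
    (hz : ∀ d, z ∣ p ^ d - 1 → m ∣ d) {ζ ζ' : M} (hz0 : ζ ≠ 0) (hζ : orderOf ζ = z)
    (L K : M × M ≃+ M × M) (hL : ∀ v, L (ζ • v) = ζ' • L v) (hK : ∀ v, K (ζ • v) = ζ' • K v) :
    ∃ τ : M ≃ₐ[ZMod p] M, SemiL L τ ∧ SemiL K τ := by
  have htop := transField_top (p := p) hm hcard hz hz0 hζ (transField L K) ⟨ζ', fun v => ⟨hL v, hK v⟩⟩
  have : ∀ c : M, ∃ c' : M, ∀ v, L (c • v) = c' • L v ∧ K (c • v) = c' • K v := by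
    intro c
    have : c ∈ transField L K := by rw [htop]; trivial
    exact this
  choose t ht using this
  have hu : ∀ c d : M, L (c • (1, 0)) = d • L (1, 0) → t c = d := by
    intro c d h
    rw [(ht c _).1] at h
    have h0 : L (1, 0) ≠ 0 := by simp
    exact smul_left_injective M h0 h
  let f : M →+* M :=
    { toFun := t
      map_one' := hu _ _ (by simp)
      map_mul' := fun a b => hu _ _ (by rw [mul_smul, (ht a _).1, (ht b _).1, mul_smul])
      map_zero' := hu _ _ (by simp)
      map_add' := fun a b => hu _ _ (by rw [add_smul, map_add, (ht a _).1, (ht b _).1, add_smul]) }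
  let g : M →ₐ[ZMod p] M :=
    { toRingHom := f
      commutes' := fun r => DFunLike.congr_fun
        (RingHom.ext_zmod (f.comp (algebraMap (ZMod p) M)) (algebraMap (ZMod p) M)) r }
  have hg : Function.Bijective g := by
    rw [← Finite.injective_iff_bijective]
    exact f.injective
  refine ⟨AlgEquiv.ofBijective g hg, fun c v => (ht c v).1, fun c v => (ht c v).2⟩

/-- Additive automorphisms of the plane. -/
abbrev AddA (M : Type) [Field M] := M × M ≃+ M × M

/-- Composition. -/
instance autGroup : Group (AddA M) where
  mul g h := h.trans g
  one := AddEquiv.refl _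
  inv g := g.symm
  mul_assoc _ _ _ := rfl
  one_mul _ := rfl
  mul_one _ := rfl
  inv_mul_cancel g := AddEquiv.ext fun x => g.symm_apply_apply x

lemma mulA_apply (g h : AddA M) (v : M × M) : (g * h) v = g (h v) := rfl
lemma oneA_apply (v : M × M) : (1 : AddA M) v = v := rfl
lemma invA_apply (g : AddA M) (v : M × M) : g (g⁻¹ v) = v := g.apply_symm_apply v

instance autFinite : Finite (AddA M) := DFunLike.finite _

/-- Pairs of additive automorphisms that extend to autotopisms. -/
def autG (S : M × M → M × M → M × M) : Subgroup (AddA M × AddA M) where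
  carrier := {g | ∃ N : M × M ≃+ M × M, ∀ z w, N (S z w) = S (g.1 z) (g.2 w)}
  mul_mem' := by
    rintro a b ⟨N, hN⟩ ⟨N', hN'⟩
    exact ⟨N'.trans N, fun z w => by simp [hN, hN', mulA_apply]⟩
  one_mem' := ⟨AddEquiv.refl _, fun z w => by simp [oneA_apply]⟩
  inv_mem' := by
    rintro a ⟨N, hN⟩
    refine ⟨N.symm, fun z w => ?_⟩
    rw [AddEquiv.symm_apply_eq, hN]
    simp only [Prod.fst_inv, Prod.snd_inv, invA_apply]

/-- One scalar multiplication. -/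
def scal1 : Mˣ →* AddA M where
  toFun c := DistribMulAction.toAddEquiv (M × M) c
  map_one' := by ext v <;> simp [oneA_apply]
  map_mul' a b := by ext v <;> simp [mulA_apply, mul_smul]

lemma scal1_apply (c : Mˣ) (v : M × M) : scal1 c v = (c : M) • v := rfl

/-- Scalar multiplications. -/
def scal : Mˣ →* AddA M × AddA M := scal1.prod scal1

lemma scal_inj : Function.Injective (scal (M := M)) := by
  intro a b h
  have := congrArg (fun g => (g.1 (1, 0)).1) h
  simp [scal, scal1_apply] at this
  exact Units.ext this

lemma scal_mem (φ ι : M ≃ₐ[ZMod p] M) (B a : M) (c : Mˣ) : scal c ∈ autG (mulS φ ι B a) := by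
  have h1 : (c : M) * φ c ≠ 0 := by simp
  have h2 : (c : M) * φ (ι c) ≠ 0 := by simp
  refine ⟨AddEquiv.prodCongr (DistribMulAction.toAddEquiv M (Units.mk0 _ h1)) (DistribMulAction.toAddEquiv M (Units.mk0 _ h2)), ?_⟩
  intro z w
  ext
  · change ((c : M) * φ c) * (mulS φ ι B a z w).1 = _
    simp [scal, scal1_apply, mulS]; ring
  · change ((c : M) * φ (ι c)) * (mulS φ ι B a z w).2 = _
    simp [scal, scal1_apply, mulS]; ring

lemma SemiL.mul {L K : AddA M} {τ σ : M ≃ₐ[ZMod p] M} (h : SemiL L τ) (h' : SemiL K σ) :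
    SemiL (L * K) (τ * σ) := by
  intro c v
  simp only [mulA_apply, AlgEquiv.mul_apply]
  rw [h', h]

lemma SemiL.one : SemiL (1 : AddA M) (1 : M ≃ₐ[ZMod p] M) := fun c v => by simp [oneA_apply]

lemma SemiL.pow {L : AddA M} {τ : M ≃ₐ[ZMod p] M} (h : SemiL L τ) (n : ℕ) :
    SemiL (L ^ n) (τ ^ n) := by
  induction n with
  | zero => exact SemiL.one
  | succ n ih => rw [pow_succ, pow_succ]; exact ih.mul h

lemma SemiL.eq_one {τ : M ≃ₐ[ZMod p] M} (h : SemiL (1 : AddA M) τ) : τ = 1 := by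
  ext c
  have := congrArg Prod.fst (h c (1, 0))
  simpa [oneA_apply] using this.symm
end
section
lemma sylow_conj {W : Type} [Group W] [Finite W] (z : ℕ) [Fact z.Prime] (G P Q : Subgroup W)
    (hP : IsPGroup z P) (hPG : P ≤ G)
    (hmax : ∀ g ∈ G, (∃ s : ℕ, g ^ (z ^ s) = 1) → (∀ x ∈ P, g * x * g⁻¹ ∈ P) → g ∈ P)
    (hQ : IsPGroup z Q) (hQG : Q ≤ G) : ∃ x ∈ G, ∀ q ∈ Q, x * q * x⁻¹ ∈ P := by
  have hP1 : IsPGroup z (P.subgroupOf G) := by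
    rintro ⟨x, hx⟩
    obtain ⟨k, hk⟩ := hP ⟨x, hx⟩
    refine ⟨k, ?_⟩
    simpa [Subtype.ext_iff] using hk
  have hQ1 : IsPGroup z (Q.subgroupOf G) := by
    rintro ⟨x, hx⟩
    obtain ⟨k, hk⟩ := hQ ⟨x, hx⟩
    refine ⟨k, ?_⟩
    simpa [Subtype.ext_iff] using hk
  let S : Sylow z G :=
    { toSubgroup := P.subgroupOf G
      isPGroup' := hP1
      is_maximal' := by
        intro R hR hle
        have : Group.IsNilpotent R := hR.isNilpotent
        have hn : NormalizerCondition R := Group.normalizerCondition_of_isNilpotent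
        by_contra hne
        have hlt : (P.subgroupOf G).subgroupOf R < ⊤ := by
          rw [lt_top_iff_ne_top]
          intro h
          exact hne (le_antisymm (Subgroup.subgroupOf_eq_top.1 h) hle)
        obtain ⟨-, r, hr, hr'⟩ := SetLike.lt_iff_le_and_exists.1 (hn _ hlt)
        apply hr'
        rw [Subgroup.mem_subgroupOf, Subgroup.mem_subgroupOf]
        apply hmax _ r.1.2
        · obtain ⟨s, hs⟩ := hR r
          exact ⟨s, by simpa [Subtype.ext_iff] using hs⟩
        · intro x hx
          have hxR : (⟨x, hPG hx⟩ : G) ∈ R := hle (by rw [Subgroup.mem_subgroupOf]; exact hx)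
          have := (Subgroup.mem_normalizer_iff.1 hr ⟨⟨x, hPG hx⟩, hxR⟩).1
            (by rw [Subgroup.mem_subgroupOf, Subgroup.mem_subgroupOf]; exact hx)
          rw [Subgroup.mem_subgroupOf, Subgroup.mem_subgroupOf] at this
          exact this }
  obtain ⟨S', hS'⟩ := hQ1.exists_le_sylow
  obtain ⟨x, hx⟩ := MulAction.exists_smul_eq G S' S
  refine ⟨x, x.2, fun q hq => ?_⟩
  have h1 : (⟨q, hQG hq⟩ : G) ∈ (S' : Subgroup G) := hS' (by rw [Subgroup.mem_subgroupOf]; exact hq)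
  have h2 : x * ⟨q, hQG hq⟩ * x⁻¹ ∈ (S : Subgroup G) := by
    rw [← hx, Sylow.coe_subgroup_smul]
    exact Subgroup.smul_mem_pointwise_smul _ (MulAut.conj x) _ h1
  exact h2
end

section
variable {p : ℕ} [Fact p.Prime] {M : Type} [Field M] [Fintype M] [Algebra (ZMod p) M]

/-- Scalar multiplications of `z`-power order. -/
def PZ (M : Type) [Field M] (z : ℕ) : Subgroup (AddA M × AddA M) where
  carrier := {g | ∃ c : Mˣ, (∃ k : ℕ, c ^ (z ^ k) = 1) ∧ g = scal c}
  mul_mem' := by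
    rintro _ _ ⟨a, ⟨k, hk⟩, rfl⟩ ⟨b, ⟨l, hl⟩, rfl⟩
    refine ⟨a * b, ⟨k + l, ?_⟩, by rw [map_mul]⟩
    rw [mul_pow, pow_add, pow_mul, hk, mul_comm (z ^ k), pow_mul b, hl, one_pow, one_pow, mul_one]
  one_mem' := ⟨1, ⟨0, by simp⟩, by simp⟩
  inv_mem' := by
    rintro _ ⟨a, ⟨k, hk⟩, rfl⟩
    exact ⟨a⁻¹, ⟨k, by rw [inv_pow, hk, inv_one]⟩, by rw [map_inv]⟩

lemma PZ_isPGroup (z : ℕ) : IsPGroup z (PZ M z) := by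
  rintro ⟨_, a, ⟨k, hk⟩, rfl⟩
  refine ⟨k, ?_⟩
  rw [Subtype.ext_iff]
  simp only [Subgroup.coe_pow, Subgroup.coe_one]
  rw [← map_pow, hk, map_one]

lemma norm_semi {m z : ℕ} (hm : 0 < m) (hcard : Fintype.card M = p ^ m) (hzp : z.Prime)
    (hz : ∀ d, z ∣ p ^ d - 1 ↔ m ∣ d) (g : AddA M × AddA M)
    (hg : ∀ x ∈ PZ M z, g * x * g⁻¹ ∈ PZ M z) :
    ∃ τ : M ≃ₐ[ZMod p] M, SemiL g.1 τ ∧ SemiL g.2 τ := by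
  have := Fact.mk hzp
  classical
  obtain ⟨ζ, hζ⟩ := exists_prime_orderOf_dvd_card (G := Mˣ) z
    (by rw [Fintype.card_units, hcard]; exact (hz m).2 dvd_rfl)
  obtain ⟨ζ', -, h⟩ := hg (scal ζ) ⟨ζ, ⟨1, by rw [pow_one, ← hζ, pow_orderOf_eq_one]⟩, rfl⟩
  rw [mul_inv_eq_iff_eq_mul] at h
  refine exists_tau (ζ := ζ) (ζ' := ζ') hm hcard (fun d => (hz d).1) (by simp)
    (by rw [orderOf_units, hζ]) g.1 g.2 (fun v => ?_) (fun v => ?_)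
  · exact DFunLike.congr_fun (congrArg Prod.fst h) v
  · exact DFunLike.congr_fun (congrArg Prod.snd h) v

lemma act_mul (A B : Matrix (Fin 2) (Fin 2) M) (v : M × M) : act (A * B) v = act A (act B v) := by
  ext <;> simp [act, Matrix.mul_apply, Fin.sum_univ_two] <;> ring

lemma act_one (v : M × M) : act 1 v = v := by
  ext <;> simp [act]

lemma act_smul_one (c : M) (v : M × M) : act (c • 1) v = c • v := by
  ext <;> simp [act]

lemma act_pow (A : Matrix (Fin 2) (Fin 2) M) (L : AddA M) (h : ∀ v, L v = act A v) (n : ℕ) (v : M × M) :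
    (L ^ n) v = act (A ^ n) v := by
  induction n generalizing v with
  | zero => simp [act_one, oneA_apply]
  | succ n ih => rw [pow_succ, pow_succ, mulA_apply, h, ih, act_mul]

lemma act_det (A : Matrix (Fin 2) (Fin 2) M) (h : Function.Injective (act A)) : A.det ≠ 0 := by
  intro h0
  obtain ⟨v, hv, hv0⟩ := Matrix.exists_mulVec_eq_zero_iff.2 h0
  apply hv
  have e0 := congrFun hv0 0
  have e1 := congrFun hv0 1
  simp [Matrix.mulVec, dotProduct, Fin.sum_univ_two] at e0 e1
  have : act A (v 0, v 1) = act A 0 := by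
    ext <;> simp [act, e0, e1]
  have := h this
  simp at this
  ext i
  fin_cases i
  · exact this.1
  · exact this.2

/-- The fixed field. -/
abbrev fixF (φ : M ≃ₐ[ZMod p] M) : IntermediateField (ZMod p) M :=
  IntermediateField.fixedField (Subgroup.zpowers φ)

lemma mem_fixF (φ : M ≃ₐ[ZMod p] M) (x : M) (hx : φ x = x) : x ∈ fixF φ := by
  rw [IntermediateField.mem_fixedField_iff]
  intro f hf
  have hs : φ ∈ MulAction.stabilizer (M ≃ₐ[ZMod p] M) x := by
    rw [MulAction.mem_stabilizer_iff]; exact hx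
  have := (Subgroup.zpowers_le (H := MulAction.stabilizer (M ≃ₐ[ZMod p] M) x)).2 hs hf
  exact this

lemma pow_scalar (φ : M ≃ₐ[ZMod p] M) (A : Matrix (Fin 2) (Fin 2) M) (y : M) (hy : y ≠ 0)
    (hA : Function.Injective (act A)) (h : ∀ i j, φ (A i j / y) = A i j / y) :
    A ^ (Nat.card (GL (Fin 2) (fixF φ))) = y ^ (Nat.card (GL (Fin 2) (fixF φ))) • 1 := by
  let A0 : Matrix (Fin 2) (Fin 2) (fixF φ) := fun i j => ⟨A i j / y, mem_fixF φ _ (h i j)⟩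
  have e : A = y • (algebraMap (fixF φ) M).mapMatrix A0 := by
    ext i j
    change _ = y * (A i j / y)
    field_simp
  have hd : A0.det ≠ 0 := by
    intro h0
    apply act_det A hA
    rw [e, Matrix.det_smul, ← RingHom.map_det, h0, map_zero, mul_zero]
  have h1 : A0 ^ (Nat.card (GL (Fin 2) (fixF φ))) = 1 := by
    have := pow_card_eq_one' (x := Matrix.GeneralLinearGroup.mkOfDetNeZero A0 hd)
    have := congrArg Units.val this
    rw [Units.val_pow_eq_pow_val, Units.val_one] at this
    exact this
  rw [e, smul_pow, ← map_pow, h1, map_one]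

lemma card_GL_coprime {m z : ℕ} (hm : 0 < m) (hcard : Fintype.card M = p ^ m) (hzp : z.Prime)
    (hz : ∀ d, z ∣ p ^ d - 1 ↔ m ∣ d) (φ : M ≃ₐ[ZMod p] M) (ho : 3 ≤ orderOf φ) :
    Nat.Coprime z (Nat.card (GL (Fin 2) (fixF φ))) := by
  classical
  have hp : p.Prime := Fact.out
  have hpz : ¬ z ∣ p := by
    intro h
    have := (Nat.prime_dvd_prime_iff_eq hzp hp).1 h
    subst this
    have h1 := (hz m).2 dvd_rfl
    have h2 : z ∣ z ^ m := dvd_pow_self z hm.ne'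
    have h3 := (Nat.dvd_sub_iff_right (Nat.one_le_pow _ _ hp.pos) h2).1 h1
    exact hzp.one_lt.ne' (Nat.dvd_one.1 h3)
  have hfr : Module.finrank (ZMod p) M = m := by
    have := Module.card_eq_pow_finrank (K := ZMod p) (V := M)
    rw [hcard, ZMod.card] at this
    exact (Nat.pow_right_injective hp.two_le this).symm
  set d := Module.finrank (ZMod p) (fixF φ) with hd
  have hmul : d * orderOf φ = m := by
    rw [← hfr, ← Module.finrank_mul_finrank (ZMod p) (fixF φ) M,
      IntermediateField.finrank_fixedField_eq_card, Nat.card_zpowers]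
  have hd0 : 0 < d := Module.finrank_pos
  have hcF : Fintype.card (fixF φ) = p ^ d := by
    rw [Module.card_eq_pow_finrank (K := ZMod p) (V := fixF φ), ZMod.card]
  rw [Nat.Prime.coprime_iff_not_dvd hzp, Matrix.card_GL_field, Fin.prod_univ_two, hcF]
  have hnd : ∀ e, 0 < e → e < m → ¬ z ∣ p ^ e - 1 := by
    intro e h0 h1 h2
    have := Nat.le_of_dvd h0 ((hz e).1 h2)
    omega
  have hlt : 2 * d < m := by rw [← hmul]; nlinarith
  intro h
  rcases hzp.dvd_mul.1 h with h | h
  · apply hnd (d * 2) (by omega) (by omega)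
    simpa [pow_mul] using h
  · have : (p ^ d) ^ 2 - (p ^ d) ^ ((1 : Fin 2) : ℕ) = p ^ d * (p ^ d - 1) := by
      rw [Nat.mul_sub, sq]; simp
    rw [this] at h
    rcases hzp.dvd_mul.1 h with h | h
    · exact hpz (hzp.dvd_of_dvd_pow h)
    · exact hnd d hd0 (by omega) h

lemma core {m z : ℕ} (hm : 0 < m) (hcard : Fintype.card M = p ^ m) (hzp : z.Prime) (hmz : m < z)
    (hz : ∀ d, z ∣ p ^ d - 1 ↔ m ∣ d) {φ ι : M ≃ₐ[ZMod p] M} (ho : 3 ≤ orderOf φ) {B a : M}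
    (hs : Sep φ φ ι) (hB : Good φ ι B) (ha : a ≠ 0) (hia : ι a = a)
    (g : AddA M × AddA M) (hg : g ∈ autG (mulS φ ι B a)) (hs' : ∃ s : ℕ, g ^ (z ^ s) = 1)
    (hn : ∀ x ∈ PZ M z, g * x * g⁻¹ ∈ PZ M z) : g ∈ PZ M z := by
  obtain ⟨τ, hL, hK⟩ := norm_semi hm hcard hzp hz g hn
  obtain ⟨s, hs'⟩ := hs'
  have hp : p.Prime := Fact.out
  have hfr : Module.finrank (ZMod p) M = m := by
    have := Module.card_eq_pow_finrank (K := ZMod p) (V := M)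
    rw [hcard, ZMod.card] at this
    exact (Nat.pow_right_injective hp.two_le this).symm
  have hτ : τ = 1 := by
    have h1 : τ ^ (z ^ s) = 1 := by
      have := hL.pow (z ^ s)
      rw [← Prod.pow_fst, hs'] at this
      exact this.eq_one
    have h2 : orderOf τ ∣ m := by
      rw [← hfr, ← IsGalois.card_aut_eq_finrank]
      exact orderOf_dvd_natCard τ
    have h3 : Nat.Coprime m (z ^ s) := by
      apply Nat.Coprime.pow_right
      exact (Nat.coprime_of_lt_prime hm.ne' hmz hzp).symm
    exact orderOf_eq_one_iff.1 (Nat.eq_one_of_dvd_coprimes h3 h2 (orderOf_dvd_of_pow_eq_one h1))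
  subst hτ
  obtain ⟨N, hN⟩ := hg
  obtain ⟨-, α, β, hα, h⟩ := semi_lin hs hB ha hia hL hK (N : M × M →+ M × M) hN
  simp only [AlgEquiv.one_apply] at h
  have iL := act_matOf_inj hL
  have iK := act_matOf_inj hK
  have eL : ∀ v, g.1 v = act (matOf g.1) v := fun v => by
    rw [act_matOf hL]; simp
  have eK : ∀ v, g.2 v = act (matOf g.2) v := fun v => by
    rw [act_matOf hK]; simp
  set A := matOf g.1
  set C := matOf g.2
  have cA : ∀ i j, α * φ (φ (A i j)) = φ α * A i j := fun i j => by
    have := congrFun (congrFun (h.eqA hα hB.B0 hB.B0 hB.fixB hB.fixB) j) i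
    simpa using this
  have cC : ∀ i j, α * φ (φ (C i j)) = φ α * C i j := fun i j => by
    have := congrFun (congrFun (h.eqC hα hB.B0 hB.fixB hB.fixB) i) j
    simpa using this
  obtain ⟨i0, hy⟩ : ∃ i, A i 0 ≠ 0 := by
    by_contra hc
    push Not at hc
    exact act_col_ne A iL (by rw [hc, hc]; rfl)
  set y := A i0 0
  have hφα : φ α ≠ 0 := by simpa using hα
  have fixq : ∀ x, α * φ (φ x) = φ α * x → φ (x / y) = x / y := by
    intro x hx
    apply hB.two
    have hy' : φ (φ y) ≠ 0 := by simpa using hy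
    rw [map_div₀, map_div₀, div_eq_div_iff hy' hy]
    apply mul_left_cancel₀ (mul_ne_zero hα hφα)
    linear_combination (φ α * y) * hx - φ α * x * cA i0 0
  set E := Nat.card (GL (Fin 2) (fixF φ)) with hE
  have pA := pow_scalar φ A y hy iL (fun i j => fixq _ (cA i j))
  have pC := pow_scalar φ C y hy iK (fun i j => fixq _ (cC i j))
  have hgE : g ^ E = scal (Units.mk0 y hy ^ E) := by
    apply Prod.ext
    · apply AddEquiv.ext
      intro v
      rw [Prod.pow_fst, act_pow A _ eL, pA, act_smul_one]
      rfl
    · apply AddEquiv.ext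
      intro v
      rw [Prod.pow_snd, act_pow C _ eK, pC, act_smul_one]
      rfl
  have hcop : Nat.Coprime E (z ^ s) :=
    ((card_GL_coprime hm hcard hzp hz φ ho).pow_left s).symm
  have hcop' : Nat.Coprime (orderOf g) E :=
    (Nat.Coprime.coprime_dvd_right (orderOf_dvd_of_pow_eq_one hs') hcop).symm
  obtain ⟨j, hj⟩ := exists_pow_eq_self_of_coprime hcop'.symm
  rw [hgE, ← map_pow] at hj
  refine ⟨_, ⟨s, ?_⟩, hj.symm⟩
  apply scal_inj
  rw [map_pow, hj, hs', map_one]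

theorem iso_main {m z : ℕ} (hm : 0 < m) (hcard : Fintype.card M = p ^ m) (hzp : z.Prime) (hmz : m < z)
    (hz : ∀ d, z ∣ p ^ d - 1 ↔ m ∣ d) {φ₁ φ₂ ι : M ≃ₐ[ZMod p] M} (ho : 3 ≤ orderOf φ₂)
    {B₁ a₁ B₂ a₂ : M} (hs : Sep φ₁ φ₂ ι) (hs2 : Sep φ₂ φ₂ ι)
    (g₁ : ∀ τ : M ≃ₐ[ZMod p] M, Good φ₁ ι (τ B₁)) (g₂ : Good φ₂ ι B₂)
    (ha₁ : a₁ ≠ 0) (hi₁ : ι a₁ = a₁) (ha₂ : a₂ ≠ 0) (hi₂ : ι a₂ = a₂)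
    (N L K : M × M ≃+ M × M)
    (H : ∀ z w, N (mulS φ₁ ι B₁ a₁ z w) = mulS φ₂ ι B₂ a₂ (L z) (K w)) :
    φ₁ = φ₂ ∧ ∃ τ : M ≃ₐ[ZMod p] M, (a₂ ^ 2 * (τ B₁ * ι (τ B₁)) = τ a₁ ^ 2 * (B₂ * ι B₂) ∨
      (τ a₁ * a₂) ^ 2 = (τ B₁ * ι (τ B₁)) * (B₂ * ι B₂)) := by
  have := Fact.mk hzp
  let h : AddA M × AddA M := (L, K)
  let Q : Subgroup (AddA M × AddA M) := (PZ M z).map (MulAut.conj h).toMonoidHom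
  have hQ : IsPGroup z Q := (PZ_isPGroup z).map _
  have hQG : Q ≤ autG (mulS φ₂ ι B₂ a₂) := by
    rintro _ ⟨_, ⟨c, -, rfl⟩, rfl⟩
    obtain ⟨R, hR⟩ := scal_mem φ₁ ι B₁ a₁ c
    refine ⟨N.symm.trans (R.trans N), fun z w => ?_⟩
    have h1 := H (L.symm z) (K.symm w)
    simp only [AddEquiv.apply_symm_apply] at h1
    rw [← h1]
    simp only [AddEquiv.trans_apply, AddEquiv.symm_apply_apply]
    rw [hR, H]
    rfl
  obtain ⟨x, hxG, hx⟩ := sylow_conj z (autG (mulS φ₂ ι B₂ a₂)) (PZ M z) Q (PZ_isPGroup z)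
    (by rintro _ ⟨c, -, rfl⟩; exact scal_mem _ _ _ _ c)
    (fun g hg hs' hn => core hm hcard hzp hmz hz ho hs2 g₂ ha₂ hi₂ g hg hs' hn) hQ hQG
  obtain ⟨τ, hL, hK⟩ := norm_semi hm hcard hzp hz (x * h) (by
    intro y hy
    have := hx (h * y * h⁻¹) ⟨y, hy, rfl⟩
    convert this using 1
    group)
  obtain ⟨R, hR⟩ := hxG
  obtain ⟨e, hh⟩ := semi_main hs (g₁ τ) g₂ ha₁ hi₁ ha₂ hi₂ hL hK ((N.trans R : M × M ≃+ M × M) : M × M →+ M × M) (by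
    intro z w
    simp only [AddMonoidHom.coe_coe, AddEquiv.trans_apply]
    rw [H, hR]
    rfl)
  exact ⟨e, τ, hh⟩
end
section
lemma indep_exists {α : Type} [DecidableEq α] (R : α → α → Prop) (hrefl : ∀ x, R x x)
    (hsymm : ∀ x y, R x y → R y x) (n : ℕ) (k : ℕ) :
    ∀ I : Finset α, I.card = k → (∀ y ∈ I, ∀ J : Finset α, J ⊆ I → (∀ x ∈ J, R x y) → J.card ≤ n) →
    ∃ T : Finset α, T ⊆ I ∧ (∀ x ∈ T, ∀ y ∈ T, x ≠ y → ¬ R x y) ∧ I.card ≤ n * T.card := by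
  classical
  induction k using Nat.strong_induction_on with
  | _ k ih =>
    intro I hk hI
    rcases I.eq_empty_or_nonempty with rfl | ⟨y, hy⟩
    · exact ⟨∅, by simp⟩
    · have hlt : (I.filter (fun x => ¬ R x y)).card < k := by
        rw [← hk]
        apply Finset.card_lt_card
        refine ⟨Finset.filter_subset _ _, fun h => ?_⟩
        have := h hy
        simp [hrefl] at this
      obtain ⟨T, hT1, hT2, hT3⟩ := ih _ hlt (I.filter (fun x => ¬ R x y)) rfl
        (fun w hw J hJ hJw => hI w (Finset.filter_subset _ _ hw) J (hJ.trans (Finset.filter_subset _ _)) hJw)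
      have hyT : y ∉ T := fun h => by
        have := hT1 h
        simp [hrefl] at this
      have hTy : ∀ x ∈ T, ¬ R x y := fun x hx => (Finset.mem_filter.1 (hT1 hx)).2
      refine ⟨insert y T, ?_, ?_, ?_⟩
      · intro x hx
        rcases Finset.mem_insert.1 hx with rfl | h
        · exact hy
        · exact Finset.filter_subset _ _ (hT1 h)
      · intro a ha b hb hab
        rcases Finset.mem_insert.1 ha with rfl | h
        · rcases Finset.mem_insert.1 hb with rfl | h'
          · exact absurd rfl hab
          · exact fun hR => hTy b h' (hsymm _ _ hR)
        · rcases Finset.mem_insert.1 hb with rfl | h'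
          · exact hTy a h
          · exact hT2 a h b h' hab
      · rw [Finset.card_insert_of_notMem hyT]
        have h1 := Finset.card_filter_add_card_filter_not (s := I) (fun x => R x y)
        have h2 := hI y hy (I.filter (fun x => R x y)) (Finset.filter_subset _ _) (by simp)
        rw [mul_add]
        omega

lemma card_le_two {M : Type} [Field M] [DecidableEq M] (s : Finset M)
    (h : ∀ x ∈ s, ∀ y ∈ s, x ^ 2 = y ^ 2) : s.card ≤ 2 := by
  rcases s.eq_empty_or_nonempty with rfl | ⟨y, hy⟩
  · simp
  · refine (Finset.card_le_card (t := {y, -y}) fun x hx => ?_).trans Finset.card_le_two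
    have := sq_eq_sq_iff_eq_or_eq_neg.1 (h x hx y hy)
    simpa using this
end

section
variable {p : ℕ} [Fact p.Prime] {M : Type} [Field M] [Fintype M] [Algebra (ZMod p) M]

lemma finrank_M {m : ℕ} (hcard : Fintype.card M = p ^ m) : Module.finrank (ZMod p) M = m := by
  have hp : p.Prime := Fact.out
  have := Module.card_eq_pow_finrank (K := ZMod p) (V := M)
  rw [hcard, ZMod.card] at this
  exact (Nat.pow_right_injective hp.two_le this).symm

lemma fixF_apply (φ : M ≃ₐ[ZMod p] M) (x : fixF φ) : φ x = x :=
  (IntermediateField.mem_fixedField_iff _ _).1 x.2 φ (Subgroup.mem_zpowers φ)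

lemma card_fixF {h : ℕ} (hcard : Fintype.card M = p ^ (2 * h)) (ι : M ≃ₐ[ZMod p] M)
    (ho : orderOf ι = 2) : Nat.card (fixF ι) = p ^ h := by
  classical
  have hfr := finrank_M hcard
  have hmul : Module.finrank (ZMod p) (fixF ι) * 2 = 2 * h := by
    rw [← hfr, ← Module.finrank_mul_finrank (ZMod p) (fixF ι) M,
      IntermediateField.finrank_fixedField_eq_card, Nat.card_zpowers, ho]
  rw [Nat.card_eq_fintype_card, Module.card_eq_pow_finrank (K := ZMod p) (V := fixF ι), ZMod.card]
  congr 1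
  omega

open Classical in
lemma card_fix_ne {h : ℕ} (hcard : Fintype.card M = p ^ (2 * h)) (ι : M ≃ₐ[ZMod p] M)
    (ho : orderOf ι = 2) :
    p ^ h - 1 ≤ (Finset.univ.filter (fun a : M => a ≠ 0 ∧ ι a = a)).card := by
  have h1 := card_fixF hcard ι ho
  have h2 : Nat.card (fixF ι) ≤ (insert 0 (Finset.univ.filter (fun a : M => a ≠ 0 ∧ ι a = a))).card := by
    rw [Nat.card_eq_fintype_card, ← Finset.card_univ]
    apply Finset.card_le_card_of_injOn (fun x : fixF ι => (x : M))
    · intro x _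
      have := fixF_apply ι x
      simp [this]
      tauto
    · intro x _ y _ hxy
      exact Subtype.ext hxy
  have h3 := Finset.card_insert_le (0 : M) (Finset.univ.filter (fun a : M => a ≠ 0 ∧ ι a = a))
  omega

open Classical in
lemma sqfix_of {h : ℕ} (hp2 : p ≠ 2) (hcard : Fintype.card M = p ^ (2 * h)) (ι : M ≃ₐ[ZMod p] M)
    (ho : orderOf ι = 2) (x : M) (hx : x ≠ 0) (hi : ι x = x) : quadraticChar M x = 1 := by
  have hp : p.Prime := Fact.out
  have := charP_M (p := p) (M := M)
  have hr : ringChar M ≠ 2 := by rw [ringChar.eq M p]; exact hp2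
  rw [quadraticChar_one_iff_isSquare hx, FiniteField.isSquare_iff hr hx, hcard]
  have h1 := card_fixF hcard ι ho
  have h2 : x ^ (p ^ h - 1) = 1 := by
    have := FiniteField.pow_card_sub_one_eq_one (⟨x, mem_fixF ι x hi⟩ : fixF ι)
      (by simpa [Subtype.ext_iff] using hx)
    rw [← Nat.card_eq_fintype_card, h1] at this
    simpa [Subtype.ext_iff] using this
  obtain ⟨r, hr⟩ : Odd (p ^ h) := (hp.odd_of_ne_two hp2).pow
  have : p ^ (2 * h) / 2 = (p ^ h - 1) * (r + 1) := by
    rw [mul_comm, pow_mul, hr, Nat.add_sub_cancel]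
    have : (2 * r + 1) ^ 2 = 2 * (2 * r * (r + 1)) + 1 := by ring
    omega
  rw [this, pow_mul, h2, one_pow]

open Classical in
lemma good_of {h σ : ℕ} (hp2 : p ≠ 2) (hcard : Fintype.card M = p ^ (2 * h)) (φ ι : M ≃ₐ[ZMod p] M)
    (ho : orderOf ι = 2) (hσ : Odd σ) (hφ : φ ^ σ = 1) {B : M} (hB : quadraticChar M B = -1)
    (hf : φ B = B) : Good φ ι B := by
  have := charP_M (p := p) (M := M)
  have hp : p.Prime := Fact.out
  have h20 : (2 : M) ≠ 0 := by
    intro h0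
    have : ((2 : ℕ) : M) = 0 := by exact_mod_cast h0
    rw [CharP.cast_eq_zero_iff M p] at this
    exact hp2 ((Nat.prime_dvd_prime_iff_eq hp Nat.prime_two).1 this)
  have h2pow : ∀ x, φ (φ x) = x → ∀ n : ℕ, (φ ^ (2 * n)) x = x := by
    intro x hx n
    induction n with
    | zero => simp
    | succ n ih =>
      rw [mul_add, pow_add, AlgEquiv.mul_apply, mul_one, sq, AlgEquiv.mul_apply, hx, ih]
  have htwo : ∀ x, φ (φ x) = x → φ x = x := by
    intro x hx
    obtain ⟨r, hr⟩ := hσ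
    have h1 := h2pow x hx r
    have h2 : (φ ^ (2 * r + 1)) x = x := by rw [← hr, hφ]; rfl
    rw [pow_succ', AlgEquiv.mul_apply, h1] at h2
    exact h2
  refine ⟨fun x hx => ?_, htwo, fun x => gal_comm _ _ _, fun x => ?_, sqfix_of hp2 hcard ι ho, hB, hf⟩
  · have h1 := htwo x (by rw [hx, map_neg, hx, neg_neg])
    rw [h1] at hx
    have : 2 * x = 0 := by linear_combination hx
    simpa [h20] using this
  · have : ι ^ 2 = 1 := by rw [← ho]; exact pow_orderOf_eq_one ι
    have := DFunLike.congr_fun this x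
    simpa [sq] using this

open Classical in
lemma exists_B {σ : ℕ} (hp2 : p ≠ 2) (φ : M ≃ₐ[ZMod p] M) (hσ : Odd σ) (hφ : φ ^ σ = 1) :
    ∃ B : M, quadraticChar M B = -1 ∧ φ B = B := by
  have := charP_M (p := p) (M := M)
  have hr : ringChar M ≠ 2 := by rw [ringChar.eq M p]; exact hp2
  obtain ⟨b, hb⟩ := FiniteField.exists_nonsquare hr
  have hb0 : b ≠ 0 := by rintro rfl; exact hb (IsSquare.zero)
  have hχ : quadraticChar M b = -1 := quadraticChar_neg_one_iff_not_isSquare.2 hb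
  refine ⟨∏ i ∈ Finset.range σ, (φ ^ i) b, ?_, ?_⟩
  · rw [map_prod]
    simp only [chi_map, hχ]
    rw [Finset.prod_const, Finset.card_range, hσ.neg_one_pow]
  · have h1 := Finset.prod_range_succ (fun i => (φ ^ i) b) σ
    rw [Finset.prod_range_succ'] at h1
    simp only [hφ, pow_zero] at h1
    have h2 := mul_right_cancel₀ (by simpa using hb0) h1
    rw [map_prod, ← h2]
    apply Finset.prod_congr rfl
    intro i _
    rw [pow_succ', AlgEquiv.mul_apply]

lemma sep_of {σ : ℕ} (hσ : Odd σ) (φ₀ ι : M ≃ₐ[ZMod p] M) (hφ : orderOf φ₀ = σ) (ho : orderOf ι = 2)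
    {i j : ℕ} (hi : 0 < i) (hi' : 2 * i < σ) (hj : 0 < j) (hj' : 2 * j < σ) :
    Sep (φ₀ ^ i) (φ₀ ^ j) ι := by
  have hne : ∀ k, 0 < k → k < σ → φ₀ ^ k ≠ 1 := by
    intro k h1 h2 h
    have := Nat.le_of_dvd h1 (orderOf_dvd_of_pow_eq_one h)
    omega
  have hp : ∀ k, (φ₀ ^ k) ^ σ = 1 := by
    intro k
    rw [← pow_mul, mul_comm, pow_mul, ← hφ, pow_orderOf_eq_one, one_pow]
  have hι2 : ι ^ 2 = 1 := by rw [← ho]; exact pow_orderOf_eq_one ι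
  have hι1 : ι ≠ 1 := by
    intro h
    rw [h, orderOf_one] at ho
    omega
  have hισ : ι ^ σ = ι := by
    obtain ⟨r, rfl⟩ := hσ
    rw [pow_succ, pow_mul, hι2, one_pow, one_mul]
  have hmp : ∀ a b : M ≃ₐ[ZMod p] M, (a * b) ^ σ = a ^ σ * b ^ σ := fun a b =>
    (show Commute a b from mul_comm' a b).mul_pow σ
  have hij : φ₀ ^ j * φ₀ ^ i ≠ 1 := by
    rw [← pow_add]; exact hne _ (by omega) (by omega)
  refine ⟨hne j hj (by omega), ?_, ?_, ?_, ?_, ?_, ?_, ?_⟩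
  · intro h; exact hij (by rw [h]; simp)
  · intro h
    have := congrArg (· ^ σ) h
    simp only [hmp, hp, hισ, one_mul, one_pow] at this
    exact hι1 this
  · intro h
    have := congrArg (· ^ σ) h
    simp only [hmp, hp, hισ, one_mul] at this
    exact hι1 this.symm
  · intro h
    have := congrArg (· ^ σ) h
    simp only [inv_pow, hmp, hp, hισ, one_mul] at this
    exact hι1 (inv_eq_one.1 this.symm)
  · intro h
    have := congrArg (· ^ σ) h
    simp only [hmp, hp, hισ, one_mul] at this
    exact hι1 this
  · intro h
    have := congrArg (· ^ σ) h
    simp only [inv_pow, hmp, hp, hισ, one_mul, inv_one] at this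
    exact hι1 this
  · intro h
    apply hij
    rw [eq_inv_iff_mul_eq_one] at h
    rw [← h, mul_comm' (φ₀ ^ i) ι, mul_assoc, ← mul_assoc ι, ← sq, hι2, one_mul]
end

section
variable {p : ℕ} [Fact p.Prime] {M : Type} [Field M] [Fintype M] [Algebra (ZMod p) M]

lemma tau_red {h : ℕ} (hh : 0 < h) (F : M ≃ₐ[ZMod p] M) (hF : orderOf F = 2 * h)
    (hg : ∀ τ : M ≃ₐ[ZMod p] M, τ ∈ Subgroup.zpowers F) (B : M) (τ : M ≃ₐ[ZMod p] M) :
    ∃ r < h, (∀ a, (F ^ h) a = a → τ a = (F ^ r) a) ∧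
      τ B * (F ^ h) (τ B) = (F ^ r) B * (F ^ h) ((F ^ r) B) := by
  have h1 : τ ∈ Submonoid.powers F := by
    exact (mem_powers_iff_mem_zpowers).2 (hg τ)
  obtain ⟨s, hs⟩ := h1
  have hs : F ^ (s % (2 * h)) = τ := by
    rw [← hs, ← hF, pow_mod_orderOf]
  have hlt : s % (2 * h) < 2 * h := Nat.mod_lt _ (by omega)
  generalize s % (2 * h) = r at *
  by_cases hr : r < h
  · exact ⟨r, hr, fun a _ => by rw [hs], by rw [hs]⟩
  · have e1 : τ = F ^ (r - h) * F ^ h := by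
      rw [← pow_add, ← hs]; congr 1; omega
    have e2 : ∀ x, (F ^ h) ((F ^ h) x) = x := by
      intro x
      rw [← AlgEquiv.mul_apply, ← pow_add, ← two_mul, ← hF, pow_orderOf_eq_one]; rfl
    refine ⟨r - h, by omega, fun a ha => by rw [e1, AlgEquiv.mul_apply, ha], ?_⟩
    rw [e1, AlgEquiv.mul_apply, gal_comm (F ^ h) (F ^ (r - h)) ((F ^ h) B), e2,
      gal_comm (F ^ h) (F ^ (r - h)) B, mul_comm]

/-- Isotopism relation on multiplications. -/
def Isot (s₁ s₂ : M × M → M × M → M × M) : Prop :=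
  ∃ N L K' : M × M ≃+ M × M, ∀ z w : M × M, N (s₁ z w) = s₂ (L z) (K' w)

lemma Isot.refl (s : M × M → M × M → M × M) : Isot s s :=
  ⟨AddEquiv.refl _, AddEquiv.refl _, AddEquiv.refl _, fun _ _ => rfl⟩

lemma Isot.symm {s t : M × M → M × M → M × M} (h : Isot s t) : Isot t s := by
  obtain ⟨N, L, K, H⟩ := h
  refine ⟨N.symm, L.symm, K.symm, fun z w => ?_⟩
  apply N.injective
  rw [H]; simp

open Classical in
theorem count_main {h e σ : ℕ} (hp2 : p ≠ 2) (hcard : Fintype.card M = p ^ (2 * h))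
    (hσ : Odd σ) (hσ3 : 3 ≤ σ) (hm : 2 * h = 2 ^ e * σ) :
    ∃ T : Set ((M × M) → (M × M) → (M × M)),
      (∀ s ∈ T,
        (∀ x y z : M × M, s (x + y) z = s x z + s y z ∧ s z (x + y) = s z x + s z y)
        ∧ (∀ x y : M × M, s x y = s y x)
        ∧ (∀ x y : M × M, s x y = 0 → x = 0 ∨ y = 0))
      ∧ (∀ s₁ ∈ T, ∀ s₂ ∈ T, s₁ ≠ s₂ → ¬ Isot s₁ s₂)
      ∧ (σ - 1) * (p ^ h - 1) ≤ 2 * (4 * h) * Nat.card T := by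
  have hp : p.Prime := Fact.out
  have hp3 : 3 ≤ p := by have := hp.two_le; omega
  have he : 0 < e := by
    rcases Nat.eq_zero_or_pos e with rfl | h'
    · obtain ⟨t, ht⟩ := hσ; omega
    · exact h'
  have hge : 3 ≤ 2 * h := by
    rw [hm]
    have : 1 ≤ 2 ^ e := Nat.one_le_two_pow
    nlinarith
  have hh : 0 < h := by omega
  obtain ⟨z, hzp, hmz, hz⟩ := zsig p (2 * h) hp hp3 hge
  obtain ⟨F, hg⟩ := IsCyclic.exists_generator (α := M ≃ₐ[ZMod p] M)
  have hF : orderOf F = 2 * h := by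
    rw [orderOf_eq_card_of_forall_mem_zpowers hg, IsGalois.card_aut_eq_finrank, finrank_M hcard]
  obtain ⟨φ₀, hφ₀⟩ : ∃ φ₀, φ₀ = F ^ (2 ^ e) := ⟨_, rfl⟩
  obtain ⟨ι, hι⟩ : ∃ ι, ι = F ^ h := ⟨_, rfl⟩
  have hoφ : orderOf φ₀ = σ := by
    rw [hφ₀, orderOf_pow_of_dvd (by positivity) (by rw [hF, hm]; exact dvd_mul_right _ _), hF, hm]
    exact Nat.mul_div_cancel_left _ (by positivity)
  have hoι : orderOf ι = 2 := by
    rw [hι, orderOf_pow_of_dvd (by omega) (by rw [hF]; exact dvd_mul_left _ _), hF]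
    exact Nat.mul_div_cancel _ hh
  have hφ1 : φ₀ ^ σ = 1 := by rw [← hoφ]; exact pow_orderOf_eq_one _
  obtain ⟨B, hB, hBf⟩ := exists_B hp2 φ₀ hσ hφ1
  have hpow : ∀ j, (φ₀ ^ j) ^ σ = 1 := fun j => by rw [← pow_mul, mul_comm, pow_mul, hφ1, one_pow]
  have hfix : ∀ j, (φ₀ ^ j) B = B := by
    intro j
    induction j with
    | zero => rfl
    | succ j ih => rw [pow_succ, AlgEquiv.mul_apply, hBf, ih]
  have hgood : ∀ j (τ : M ≃ₐ[ZMod p] M), Good (φ₀ ^ j) ι (τ B) := fun j τ =>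
    good_of hp2 hcard _ ι hoι hσ (hpow j) (by rw [chi_map, hB]) (by rw [gal_comm, hfix])
  have hgood1 : ∀ j, Good (φ₀ ^ j) ι B := fun j => hgood j 1
  have hB0 : B ≠ 0 := (hgood1 0).B0
  have hsep : ∀ i j, i < (σ - 1) / 2 → j < (σ - 1) / 2 → Sep (φ₀ ^ (i + 1)) (φ₀ ^ (j + 1)) ι :=
    fun i j hi hj => sep_of hσ φ₀ ι hoφ hoι (by omega) (by omega) (by omega) (by omega)
  have ho3 : ∀ j, j < (σ - 1) / 2 → 3 ≤ orderOf (φ₀ ^ (j + 1)) := by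
    intro j hj
    have h1 : φ₀ ^ (j + 1) ≠ 1 := (hsep j j hj hj).h1
    have h2 : orderOf (φ₀ ^ (j + 1)) ∣ σ := orderOf_dvd_of_pow_eq_one (hpow _)
    have h3 : orderOf (φ₀ ^ (j + 1)) ≠ 1 := fun h => h1 (orderOf_eq_one_iff.1 h)
    have h4 : Odd (orderOf (φ₀ ^ (j + 1))) := Odd.of_dvd_nat hσ h2
    obtain ⟨t, ht⟩ := h4
    omega
  let S : ℕ × M → (M × M → M × M → M × M) := fun x => mulS (φ₀ ^ (x.1 + 1)) ι B x.2
  let A : Finset M := Finset.univ.filter (fun a : M => a ≠ 0 ∧ ι a = a)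
  let I : Finset (ℕ × M) := Finset.range ((σ - 1) / 2) ×ˢ A
  have hmemI : ∀ x ∈ I, x.1 < (σ - 1) / 2 ∧ x.2 ≠ 0 ∧ ι x.2 = x.2 := by
    intro x hx
    simpa [I, A] using hx
  have hclass : ∀ y ∈ I, ∀ J : Finset (ℕ × M), J ⊆ I → (∀ x ∈ J, Isot (S x) (S y)) →
      J.card ≤ 4 * h := by
    intro y hy J hJ hR
    obtain ⟨hy1, hy2, hy3⟩ := hmemI y hy
    let C1 : ℕ → Finset M := fun r => Finset.univ.filter (fun a =>
      y.2 ^ 2 * ((F ^ r) B * ι ((F ^ r) B)) = (F ^ r) a ^ 2 * (B * ι B))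
    let C2 : ℕ → Finset M := fun r => Finset.univ.filter (fun a =>
      ((F ^ r) a * y.2) ^ 2 = ((F ^ r) B * ι ((F ^ r) B)) * (B * ι B))
    have hBB : B * ι B ≠ 0 := mul_ne_zero hB0 (by simpa using hB0)
    have c1 : ∀ r, (C1 r).card ≤ 2 := by
      intro r
      apply card_le_two
      intro u hu v hv
      simp only [C1, Finset.mem_filter, Finset.mem_univ, true_and] at hu hv
      have := mul_right_cancel₀ hBB (hu.symm.trans hv)
      rw [← map_pow, ← map_pow] at this
      exact (F ^ r).injective this
    have c2 : ∀ r, (C2 r).card ≤ 2 := by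
      intro r
      apply card_le_two
      intro u hu v hv
      simp only [C2, Finset.mem_filter, Finset.mem_univ, true_and] at hu hv
      have := hu.trans hv.symm
      rw [mul_pow, mul_pow] at this
      have := mul_right_cancel₀ (pow_ne_zero 2 hy2) this
      rw [← map_pow, ← map_pow] at this
      exact (F ^ r).injective this
    have hsub : J ⊆ {y.1} ×ˢ (Finset.range h).biUnion (fun r => C1 r ∪ C2 r) := by
      intro x hx
      obtain ⟨hx1, hx2, hx3⟩ := hmemI x (hJ hx)
      obtain ⟨N, L, K, H⟩ := hR x hx
      obtain ⟨q1, τ, q2⟩ := iso_main (by omega) hcard hzp hmz hz (ho3 y.1 hy1)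
        (hsep x.1 y.1 hx1 hy1) (hsep y.1 y.1 hy1 hy1) (hgood (x.1 + 1)) (hgood1 (y.1 + 1))
        hx2 hx3 hy2 hy3 N L K H
      have hxy : x.1 = y.1 := by
        have := pow_injOn_Iio_orderOf (x := φ₀) (by rw [hoφ]; simp only [Set.mem_Iio]; omega)
          (by rw [hoφ]; simp only [Set.mem_Iio]; omega) q1
        omega
      obtain ⟨r, hr, r1, r2⟩ := tau_red hh F hF hg B τ
      rw [← hι] at r1 r2
      rw [r1 _ hx3, r2] at q2
      rw [Finset.mem_product, Finset.mem_singleton]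
      refine ⟨hxy, Finset.mem_biUnion.2 ⟨r, Finset.mem_range.2 hr, ?_⟩⟩
      rw [Finset.mem_union]
      simpa only [C1, C2, Finset.mem_filter, Finset.mem_univ, true_and] using q2
    calc J.card ≤ _ := Finset.card_le_card hsub
      _ = ((Finset.range h).biUnion (fun r => C1 r ∪ C2 r)).card := by simp
      _ ≤ (Finset.range h).card * 4 := Finset.card_biUnion_le_card_mul _ _ _ (fun r _ =>
          (Finset.card_union_le _ _).trans (by have := c1 r; have := c2 r; omega))
      _ = 4 * h := by simp [mul_comm]
  obtain ⟨T, hTI, hT, hTc⟩ := indep_exists (fun x y => Isot (S x) (S y)) (fun x => Isot.refl _)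
    (fun x y h => h.symm) (4 * h) I.card I rfl hclass
  have hinj : Set.InjOn S T := by
    intro x hx y hy hxy
    by_contra hne
    apply hT x hx y hy hne
    rw [hxy]
    exact Isot.refl _
  refine ⟨S '' T, ?_, ?_, ?_⟩
  · rintro _ ⟨x, hx, rfl⟩
    obtain ⟨hx1, hx2, hx3⟩ := hmemI x (hTI hx)
    refine ⟨fun u v w => ⟨mulS_add _ _ _ _ _ _ _, ?_⟩, mulS_comm _ _ _ _,
      (hgood1 (x.1 + 1)).nzd hx2 hx3⟩
    simp only [S]
    rw [mulS_comm, mulS_add, mulS_comm _ _ _ _ u, mulS_comm _ _ _ _ v]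
  · rintro _ ⟨x, hx, rfl⟩ _ ⟨y, hy, rfl⟩ hne
    exact hT x hx y hy (fun h => hne (by rw [h]))
  · have e1 : Nat.card (S '' (T : Set (ℕ × M))) = T.card := by
      rw [Nat.card_image_of_injOn hinj]; simp
    rw [e1]
    have e2 : I.card = (σ - 1) / 2 * A.card := by simp [I]
    have e3 : p ^ h - 1 ≤ A.card := card_fix_ne hcard ι hoι
    have e4 : σ - 1 = 2 * ((σ - 1) / 2) := by obtain ⟨t, ht⟩ := hσ; omega
    calc (σ - 1) * (p ^ h - 1) ≤ (σ - 1) * A.card := Nat.mul_le_mul_left _ e3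
      _ = 2 * I.card := by rw [e2, ← mul_assoc, ← e4]
      _ ≤ 2 * (4 * h * T.card) := Nat.mul_le_mul_left _ hTc
      _ = _ := by ring
end

end GK

/-- For `n` divisible by 4 and `K = 𝔽_{p^{n/2}}`, there is a set `T` of commutative
pre-semifield multiplications on `K × K ≅ 𝔽_p^n` (biadditive, i.e. `𝔽_p`-bilinear,
commutative, without zero divisors), pairwise non-isotopic, with
`|T| ≥ (σ(n) - 1)(p^{n/4} - 1)/(2n)`, where `σ(n) = n / 2^{ν₂(n)}` is the odd part
of `n`.  (The inequality is stated multiplied out as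
`(σ(n) - 1)(p^{n/4} - 1) ≤ 2n·|T|`.) -/
theorem stmt_17 (p n : ℕ) (hp : Nat.Prime p) (hp2 : p ≠ 2)
    (hn0 : 0 < n) (h4 : 4 ∣ n)
    (K : Type) [Field K] [Fintype K] (hcard : Fintype.card K = p ^ (n / 2)) :
    ∃ T : Set ((K × K) → (K × K) → (K × K)),
      (∀ s ∈ T,
        (∀ x y z : K × K, s (x + y) z = s x z + s y z ∧ s z (x + y) = s z x + s z y)
        ∧ (∀ x y : K × K, s x y = s y x)
        ∧ (∀ x y : K × K, s x y = 0 → x = 0 ∨ y = 0))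
      ∧ (∀ s₁ ∈ T, ∀ s₂ ∈ T, s₁ ≠ s₂ →
          ¬ ∃ N L K' : K × K ≃+ K × K, ∀ z w : K × K, N (s₁ z w) = s₂ (L z) (K' w))
      ∧ (n / 2 ^ (n.factorization 2) - 1) * (p ^ (n / 4) - 1) ≤ 2 * n * Nat.card T := by
  classical
  haveI : Fact p.Prime := ⟨hp⟩
  obtain ⟨h, rfl⟩ := h4
  have a1 : 4 * h / 2 = 2 * h := by omega
  have a2 : 4 * h / 4 = h := by omega
  rw [a1] at hcard
  rw [a2]
  haveI : CharP K p := by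
    obtain ⟨q, hq⟩ := CharP.exists K
    obtain ⟨k, hqp, hk⟩ := FiniteField.card K q
    have h1 : p ∣ q ^ (k : ℕ) := by
      rw [← hk, hcard]; exact dvd_pow_self _ (by omega)
    have : p = q := (Nat.prime_dvd_prime_iff_eq hp hqp).1 (hp.dvd_of_dvd_pow h1)
    rw [this]; exact hq
  letI : Algebra (ZMod p) K := ZMod.algebra K p
  have hodd : Odd (4 * h / 2 ^ ((4 * h).factorization 2)) := by
    have := Nat.coprime_ordCompl Nat.prime_two hn0.ne'
    exact Nat.coprime_two_left.1 this
  have hmul := Nat.ordProj_mul_ordCompl_eq_self (4 * h) 2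
  have hpos : 0 < (4 * h).factorization 2 :=
    Nat.prime_two.factorization_pos_of_dvd hn0.ne' (by omega)
  generalize 4 * h / 2 ^ ((4 * h).factorization 2) = σ at *
  generalize (4 * h).factorization 2 = f at *
  by_cases h3 : 3 ≤ σ
  · obtain ⟨e, rfl⟩ : ∃ e, f = e + 1 := ⟨f - 1, by omega⟩
    have hm : 2 * h = 2 ^ e * σ := by
      rw [pow_succ] at hmul
      nlinarith
    obtain ⟨T, t1, t2, t3⟩ := GK.count_main hp2 hcard hodd h3 hm
    exact ⟨T, t1, t2, t3⟩
  · refine ⟨∅, by simp, by simp, ?_⟩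
    have : σ = 1 := by obtain ⟨t, ht⟩ := hodd; omega
    simp [this]
end
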